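/- Let p ≥ 3 be an integer, and let I ≠ {0} be a closed ideal of A⁺ such that h(I) ∩ Γ is contained in the perfect symmetric set E_{1/p} of constant ratio 1/p. Then I = I^A ∩ S_I·H^∞, i.e., I consists exactly of those functions of A⁺ which belong to the closed ideal generated by I in A(Γ) and whose inner factor is divisible by S_I. -/

import Mathlib

noncomputable section

/-- An invertible contraction on a (complex) Banach space. -/
structure BanachContraction where
  X : Type
  [grp : NormedAddCommGroup X]
  [mod : NormedSpace ℂ X]
  [cpl : CompleteSpace X]
  T : X →L[ℂ] X
  Tinv : X →L[ℂ] X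
  norm_le : ‖T‖ ≤ 1
  mul_inv : T * Tinv = 1
  inv_mul : Tinv * T = 1

attribute [instance] BanachContraction.grp BanachContraction.mod BanachContraction.cpl

open Complex MeasureTheory Metric Set Filter

/-- The `n`-th Taylor coefficient of `f` at `0`, i.e. `f⁽ⁿ⁾(0)/n!`. -/
def taylorCoeff (f : ℂ → ℂ) (n : ℕ) : ℂ := iteratedDeriv n f 0 / (n.factorial : ℂ)

/-- `A⁺`, the algebra of absolutely convergent Taylor series: functions which, on the
closed unit disk, are sums of a power series with absolutely summable coefficients. -/
def APlus : Set (ℂ → ℂ) :=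
  {f | ∃ a : ℕ → ℂ, Summable (fun n => ‖a n‖) ∧
    ∀ z ∈ Metric.closedBall (0 : ℂ) 1, HasSum (fun n => a n * z ^ n) (f z)}

/-- The norm `‖f‖₁ = ∑ₙ |f⁽ⁿ⁾(0)/n!|` on `A⁺`. -/
def APlusNorm (f : ℂ → ℂ) : ℝ := ∑' n : ℕ, ‖taylorCoeff f n‖

/-- The `n`-th Fourier coefficient of (the boundary values of) `f` on the unit circle. -/
def fcoeff (f : ℂ → ℂ) (n : ℤ) : ℂ :=
  (1 / (2 * Real.pi)) * ∫ θ in (0:ℝ)..(2 * Real.pi),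
    f (Complex.exp ((θ : ℂ) * Complex.I)) * Complex.exp (-(n : ℂ) * (θ : ℂ) * Complex.I)

/-- The Wiener algebra `A(Γ)` of absolutely convergent Fourier series on the unit circle,
viewed as functions `ℂ → ℂ` (only the values on the unit circle are relevant). -/
def WienerAlg : Set (ℂ → ℂ) :=
  {f | Summable (fun n : ℤ => ‖fcoeff f n‖) ∧
    ∀ z ∈ Metric.sphere (0 : ℂ) 1, HasSum (fun n : ℤ => fcoeff f n * z ^ n) (f z)}

/-- The norm `‖f‖₁ = ∑_{n ∈ ℤ} |f̂(n)|` on `A(Γ)`. -/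
def WienerNorm (f : ℂ → ℂ) : ℝ := ∑' n : ℤ, ‖fcoeff f n‖

/-- `I` is a closed ideal of `A⁺` (closedness w.r.t. the norm `APlusNorm`). -/
def IsClosedIdealAPlus (I : Set (ℂ → ℂ)) : Prop :=
  I ⊆ APlus ∧
  (∀ f ∈ I, ∀ g ∈ I, f + g ∈ I) ∧
  (∀ f ∈ APlus, ∀ g ∈ I, f * g ∈ I) ∧
  (∀ f ∈ APlus, (∀ ε > 0, ∃ g ∈ I, APlusNorm (f - g) < ε) → f ∈ I)

/-- `J` is a closed ideal of the Wiener algebra `A(Γ)`. -/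
def IsClosedIdealW (J : Set (ℂ → ℂ)) : Prop :=
  J ⊆ WienerAlg ∧
  (∀ f ∈ J, ∀ g ∈ J, f + g ∈ J) ∧
  (∀ f ∈ WienerAlg, ∀ g ∈ J, f * g ∈ J) ∧
  (∀ f ∈ WienerAlg, (∀ ε > 0, ∃ g ∈ J, WienerNorm (f - g) < ε) → f ∈ J)

/-- `I^A` : the closed ideal generated by `I` in the Wiener algebra `A(Γ)`. -/
def IdealGenW (I : Set (ℂ → ℂ)) : Set (ℂ → ℂ) := ⋂₀ {J | IsClosedIdealW J ∧ I ⊆ J}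

/-- The hull `h(I)`: common zeros in the closed unit disk of all elements of `I`. -/
def hull (I : Set (ℂ → ℂ)) : Set ℂ :=
  {z ∈ Metric.closedBall (0 : ℂ) 1 | ∀ f ∈ I, f z = 0}

/-- `I ≠ {0}`: `I` contains an element not identically zero on the unit disk. -/
def NontrivialIdeal (I : Set (ℂ → ℂ)) : Prop :=
  ∃ f ∈ I, ∃ z ∈ Metric.ball (0 : ℂ) 1, f z ≠ 0

/-- `H^∞(D)`: bounded holomorphic functions on the open unit disk. -/
def Hinf : Set (ℂ → ℂ) :=
  {f | DifferentiableOn ℂ f (Metric.ball (0 : ℂ) 1) ∧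
    ∃ C : ℝ, ∀ z ∈ Metric.ball (0 : ℂ) 1, ‖f z‖ ≤ C}

/-- An inner function: a bounded-by-one holomorphic function on the unit disk whose
radial limits have modulus `1` at almost every boundary point. -/
def IsInnerFunction (u : ℂ → ℂ) : Prop :=
  DifferentiableOn ℂ u (Metric.ball (0 : ℂ) 1) ∧
  (∀ z ∈ Metric.ball (0 : ℂ) 1, ‖u z‖ ≤ 1) ∧
  ∀ᵐ (θ : ℝ) ∂(MeasureTheory.volume.restrict (Set.Ioc (0 : ℝ) (2 * Real.pi))),
    Filter.Tendsto (fun r : ℝ => ‖u ((r : ℂ) * Complex.exp ((θ : ℂ) * Complex.I))‖)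
      (nhdsWithin 1 (Set.Iio 1)) (nhds 1)

/-- `S` divides (the inner factor of) `f`, i.e. `f ∈ S·H^∞`. -/
def InnerDivides (S f : ℂ → ℂ) : Prop :=
  ∃ g ∈ Hinf, ∀ z ∈ Metric.ball (0 : ℂ) 1, f z = S z * g z

/-- `S` is a greatest common divisor of the inner factors of the nonzero elements of `I`:
`S` is inner, divides every nonzero element of `I`, and every inner function with this
property divides `S`. -/
def IsGcdInner (I : Set (ℂ → ℂ)) (S : ℂ → ℂ) : Prop :=
  IsInnerFunction S ∧
  (∀ f ∈ I, (∃ z ∈ Metric.ball (0 : ℂ) 1, f z ≠ 0) → InnerDivides S f) ∧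
  ∀ S' : ℂ → ℂ, IsInnerFunction S' →
    (∀ f ∈ I, (∃ z ∈ Metric.ball (0 : ℂ) 1, f z ≠ 0) → InnerDivides S' f) →
    InnerDivides S' S

/-- The perfect symmetric set `E_ξ` of constant ratio `ξ` on the unit circle. -/
def Eset (ξ : ℝ) : Set ℂ :=
  {z | ∃ ε : ℕ → ℕ, (∀ k, ε k ≤ 1) ∧
    z = Complex.exp (2 * Real.pi * Complex.I *
      (((1 - ξ) * ∑' k : ℕ, (ε k : ℝ) * ξ ^ k : ℝ) : ℂ))}

/-- A Carleson set: a closed subset of the unit circle with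
`∫_{-π}^{π} log (2 / dist(e^{iθ}, E)) dθ < ∞`. -/
def IsCarleson (E : Set ℂ) : Prop :=
  IsClosed E ∧ E ⊆ Metric.sphere (0 : ℂ) 1 ∧
  MeasureTheory.IntegrableOn
    (fun θ : ℝ => Real.log (2 / Metric.infDist (Complex.exp ((θ : ℂ) * Complex.I)) E))
    (Set.Ioc (-Real.pi) Real.pi)

/-- The division ideal `I(f) = {g ∈ A⁺ : fg ∈ I}`. -/
def Idiv (I : Set (ℂ → ℂ)) (f : ℂ → ℂ) : Set (ℂ → ℂ) := {g ∈ APlus | f * g ∈ I}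

/-- `f` belongs to `A^∞(D)` and vanishes on `E` together with all its derivatives:
`f` is holomorphic on the disk, and each derivative extends continuously to the closed
disk with the extension vanishing on `E`. -/
def VanishAllDeriv (E : Set ℂ) (f : ℂ → ℂ) : Prop :=
  ContinuousOn f (Metric.closedBall (0 : ℂ) 1) ∧
  DifferentiableOn ℂ f (Metric.ball (0 : ℂ) 1) ∧
  (∀ z ∈ E, f z = 0) ∧
  ∀ n : ℕ, ∃ g : ℂ → ℂ, ContinuousOn g (Metric.closedBall (0 : ℂ) 1) ∧
    Set.EqOn g (iteratedDeriv n f) (Metric.ball (0 : ℂ) 1) ∧ ∀ z ∈ E, g z = 0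

/-- `J₀⁺(E)`: the closure in `A⁺` of the set of elements of `A^∞(D)` vanishing on `E`
together with all their derivatives. -/
def J0Plus (E : Set ℂ) : Set (ℂ → ℂ) :=
  {f | f ∈ APlus ∧ ∀ ε > 0, ∃ g ∈ APlus, VanishAllDeriv E g ∧ APlusNorm (f - g) < ε}

/-- `I⁺(E) = {f ∈ A⁺ : f ≡ 0 on E}`. -/
def IPlus (E : Set ℂ) : Set (ℂ → ℂ) := {f ∈ APlus | ∀ z ∈ E, f z = 0}

/-- The pairing of `f ∈ A⁺ ≅ ℓ¹(ℕ)` with an element `c ∈ c₀`. -/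
def pairing (f : ℂ → ℂ) (c : ℕ → ℂ) : ℂ := ∑' n : ℕ, taylorCoeff f n * c n

/-- `S` is dense in `A⁺` for the weak-star topology `σ(ℓ¹, c₀)`. -/
def WStarDense (S : Set (ℂ → ℂ)) : Prop :=
  ∀ f ∈ APlus, ∀ (m : ℕ) (c : Fin m → ℕ → ℂ),
    (∀ i, Filter.Tendsto (c i) Filter.atTop (nhds 0)) →
    ∀ ε > 0, ∃ g ∈ S, ∀ i, ‖pairing f (c i) - pairing g (c i)‖ < ε

/-- `S` is closed in `A⁺` for the weak-star topology `σ(ℓ¹, c₀)`. -/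
def WStarClosed (S : Set (ℂ → ℂ)) : Prop :=
  S ⊆ APlus ∧
  ∀ f ∈ APlus,
    (∀ (m : ℕ) (c : Fin m → ℕ → ℂ),
      (∀ i, Filter.Tendsto (c i) Filter.atTop (nhds 0)) →
      ∀ ε > 0, ∃ g ∈ S, ∀ i, ‖pairing f (c i) - pairing g (c i)‖ < ε) → f ∈ S

/-- A Kronecker set: a compact subset of the unit circle on which every continuous
unimodular function is a uniform limit of characters `z ↦ zⁿ`, `n ∈ ℤ`. -/
def IsKronecker (K : Set ℂ) : Prop :=
  IsCompact K ∧ K ⊆ Metric.sphere (0 : ℂ) 1 ∧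
  ∀ f : ℂ → ℂ, ContinuousOn f K → (∀ z ∈ K, ‖f z‖ = 1) →
    ∀ ε > 0, ∃ n : ℤ, ∀ z ∈ K, ‖f z - z ^ n‖ < ε

/-- A Helson set: a compact subset of the unit circle on which every continuous function
is the restriction of an element of the Wiener algebra. -/
def IsHelson (K : Set ℂ) : Prop :=
  IsCompact K ∧ K ⊆ Metric.sphere (0 : ℂ) 1 ∧
  ∀ f : ℂ → ℂ, ContinuousOn f K → ∃ g ∈ WienerAlg, ∀ z ∈ K, f z = g z

/-- The little Lipschitz class `Λ_α(D)`: disc-algebra functions with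
`|f(e^{it₁}) - f(e^{it₂})| / |t₁-t₂|^α → 0` uniformly as `|t₁-t₂| → 0`. -/
def LittleLip (α : ℝ) (f : ℂ → ℂ) : Prop :=
  ContinuousOn f (Metric.closedBall (0 : ℂ) 1) ∧
  DifferentiableOn ℂ f (Metric.ball (0 : ℂ) 1) ∧
  ∀ ε > 0, ∃ δ > 0, ∀ t₁ t₂ : ℝ, t₁ ≠ t₂ → |t₁ - t₂| < δ →
    ‖f (Complex.exp ((t₁ : ℂ) * Complex.I)) - f (Complex.exp ((t₂ : ℂ) * Complex.I))‖ ≤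
      ε * |t₁ - t₂| ^ α

/-- The perfect part of a set: the union of all its perfect subsets. -/
def perfectPart (C : Set ℂ) : Set ℂ := ⋃₀ {P | Perfect P ∧ P ⊆ C}

/-- A distribution on the unit circle, encoded by its sequence of Fourier coefficients
`μ̂(n) = μ(e^{-int})`, which has polynomial growth. -/
structure CircleDistribution where
  coeff : ℤ → ℂ
  growth : ∃ (C : ℝ) (k : ℕ), ∀ n : ℤ, ‖coeff n‖ ≤ C * (1 + (n.natAbs : ℝ)) ^ k

/-- A smooth `2π`-periodic function (test function on the circle). -/
def PeriodicSmooth (φ : ℝ → ℂ) : Prop :=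
  ContDiff ℝ (⊤ : ℕ∞) φ ∧ ∀ θ : ℝ, φ (θ + 2 * Real.pi) = φ θ

/-- Fourier coefficients of a test function. -/
def testCoeff (φ : ℝ → ℂ) (n : ℤ) : ℂ :=
  (1 / (2 * Real.pi)) * ∫ θ in (0:ℝ)..(2 * Real.pi),
    φ θ * Complex.exp (-(n : ℂ) * (θ : ℂ) * Complex.I)

/-- The action of a distribution on a test function: `μ(φ) = ∑ₙ μ̂(n) φ̂(-n)`. -/
def distAct (μ : CircleDistribution) (φ : ℝ → ℂ) : ℂ := ∑' n : ℤ, μ.coeff n * testCoeff φ (-n)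

/-- The support of a distribution on the circle: the points of the circle having no open
neighbourhood `U` such that `μ` kills every test function supported in `U`. -/
def distSupport (μ : CircleDistribution) : Set ℂ :=
  {z ∈ Metric.sphere (0 : ℂ) 1 | ∀ U : Set ℂ, IsOpen U → z ∈ U →
    ∃ φ : ℝ → ℂ, PeriodicSmooth φ ∧
      (∀ θ : ℝ, Complex.exp ((θ : ℂ) * Complex.I) ∉ U → φ θ = 0) ∧ distAct μ φ ≠ 0}

/-- A set of multiplicity: a closed subset of the circle supporting a nonzero
pseudofunction (distribution whose Fourier coefficients tend to `0` as `|n| → ∞`). -/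
def IsMSet (E : Set ℂ) : Prop :=
  IsClosed E ∧ E ⊆ Metric.sphere (0 : ℂ) 1 ∧
  ∃ μ : CircleDistribution, μ.coeff ≠ 0 ∧ distSupport μ ⊆ E ∧
    Filter.Tendsto μ.coeff Filter.cofinite (nhds 0)

/-- A Dirichlet set: `sup_{z ∈ E} |z^{n_k} - 1| → 0` for some sequence `n_k → ∞`. -/
def IsDirichletSet (E : Set ℂ) : Prop :=
  ∃ n : ℕ → ℕ, Filter.Tendsto n Filter.atTop Filter.atTop ∧
    ∀ ε > 0, ∀ᶠ k in Filter.atTop, ∀ z ∈ E, ‖z ^ (n k) - 1‖ < ε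



/-- The sum of the power series with coefficients `a`. -/
def powSum (a : ℕ → ℂ) (z : ℂ) : ℂ := ∑' n, a n * z ^ n

theorem summable_powSum_norm {a : ℕ → ℂ} {C : ℝ} (ha : ∀ n, ‖a n‖ ≤ C) {z : ℂ} (hz : ‖z‖ < 1) :
    Summable (fun n => ‖a n * z ^ n‖) := by
  refine Summable.of_nonneg_of_le (fun _ => norm_nonneg _) (fun n => ?_)
    ((summable_geometric_of_lt_one (norm_nonneg z) hz).mul_left C)
  rw [norm_mul, norm_pow]
  gcongr
  exact ha n

theorem summable_powSum_norm_of_summable {a : ℕ → ℂ} (ha : Summable (fun n => ‖a n‖)) {z : ℂ}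
    (hz : ‖z‖ ≤ 1) : Summable (fun n => ‖a n * z ^ n‖) := by
  refine Summable.of_nonneg_of_le (fun _ => norm_nonneg _) (fun n => ?_) ha
  rw [norm_mul, norm_pow]
  exact mul_le_of_le_one_right (norm_nonneg _) (pow_le_one₀ (norm_nonneg _) hz)

theorem hasSum_powSum {a : ℕ → ℂ} {C : ℝ} (ha : ∀ n, ‖a n‖ ≤ C) {z : ℂ} (hz : ‖z‖ < 1) :
    HasSum (fun n => a n * z ^ n) (powSum a z) :=
  (summable_powSum_norm ha hz).of_norm.hasSum

theorem hasSum_powSum_of_summable {a : ℕ → ℂ} (ha : Summable (fun n => ‖a n‖)) {z : ℂ}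
    (hz : ‖z‖ ≤ 1) : HasSum (fun n => a n * z ^ n) (powSum a z) :=
  (summable_powSum_norm_of_summable ha hz).of_norm.hasSum

theorem norm_le_tsum_of_summable {a : ℕ → ℂ} (ha : Summable (fun n => ‖a n‖)) (n : ℕ) :
    ‖a n‖ ≤ ∑' n, ‖a n‖ := ha.le_tsum n (fun _ _ => norm_nonneg _)

theorem norm_powSum_le {a : ℕ → ℂ} (ha : Summable (fun n => ‖a n‖)) {z : ℂ}
    (hz : ‖z‖ ≤ 1) : ‖powSum a z‖ ≤ ∑' n, ‖a n‖ := by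
  refine (norm_tsum_le_tsum_norm (summable_powSum_norm_of_summable ha hz)).trans ?_
  refine (summable_powSum_norm_of_summable ha hz).tsum_le_tsum (fun n => ?_) ha
  rw [norm_mul, norm_pow]
  exact mul_le_of_le_one_right (norm_nonneg _) (pow_le_one₀ (norm_nonneg _) hz)

theorem hasFPowerSeriesOnBall_of_hasSum {a : ℕ → ℂ} {C : ℝ} (ha : ∀ n, ‖a n‖ ≤ C) {f : ℂ → ℂ}
    (hf : ∀ z ∈ ball (0 : ℂ) 1, HasSum (fun n => a n * z ^ n) (f z)) :
    HasFPowerSeriesOnBall f (FormalMultilinearSeries.ofScalars ℂ a) 0 1 where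
  r_le := by
    refine ENNReal.le_of_forall_nnreal_lt fun r hr => ?_
    refine FormalMultilinearSeries.le_radius_of_bound _ C fun n => ?_
    rw [FormalMultilinearSeries.ofScalars_norm]
    have hr1 : (r : ℝ) ≤ 1 := by exact_mod_cast hr.le
    exact (mul_le_of_le_one_right (norm_nonneg _) (pow_le_one₀ r.2 hr1)).trans (ha n)
  r_pos := one_pos
  hasSum := by
    intro y hy
    have hy' : y ∈ ball (0 : ℂ) 1 := by
      rw [← ENNReal.ofReal_one, eball_ofReal] at hy; exact hy
    simpa [FormalMultilinearSeries.ofScalars_apply_eq, mul_comm] using hf y hy'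

theorem hasFPowerSeriesOnBall_powSum {a : ℕ → ℂ} {C : ℝ} (ha : ∀ n, ‖a n‖ ≤ C) :
    HasFPowerSeriesOnBall (powSum a) (FormalMultilinearSeries.ofScalars ℂ a) 0 1 :=
  hasFPowerSeriesOnBall_of_hasSum ha fun _ hz => hasSum_powSum ha (by simpa using hz)

theorem differentiableOn_powSum {a : ℕ → ℂ} {C : ℝ} (ha : ∀ n, ‖a n‖ ≤ C) :
    DifferentiableOn ℂ (powSum a) (ball 0 1) := by
  have := (hasFPowerSeriesOnBall_powSum ha).differentiableOn
  rwa [← ENNReal.ofReal_one, eball_ofReal] at this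

theorem taylorCoeff_eq_of_hasSum {a : ℕ → ℂ} {C : ℝ} (ha : ∀ n, ‖a n‖ ≤ C) {f : ℂ → ℂ}
    (hf : ∀ z ∈ ball (0 : ℂ) 1, HasSum (fun n => a n * z ^ n) (f z)) (n : ℕ) :
    taylorCoeff f n = a n := by
  have h1 := (hasFPowerSeriesOnBall_of_hasSum ha hf).hasFPowerSeriesAt
  have h2 := h1.analyticAt.hasFPowerSeriesAt
  have h3 := h2.eq_formalMultilinearSeries h1
  have := congrArg (fun p => FormalMultilinearSeries.coeff p n) h3
  simpa [FormalMultilinearSeries.coeff_ofScalars, taylorCoeff] using this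

theorem powSum_coeff_unique {a b : ℕ → ℂ} {C : ℝ} (ha : ∀ n, ‖a n‖ ≤ C) (hb : ∀ n, ‖b n‖ ≤ C)
    (h : ∀ z ∈ ball (0 : ℂ) 1, powSum a z = powSum b z) : a = b := by
  funext n
  rw [← taylorCoeff_eq_of_hasSum ha (f := powSum a)
      (fun z hz => hasSum_powSum ha (by simpa using hz)),
    ← taylorCoeff_eq_of_hasSum hb (f := powSum a)
      (fun z hz => by rw [h z hz]; exact hasSum_powSum hb (by simpa using hz))]

theorem powSum_mem_APlus {a : ℕ → ℂ} (ha : Summable (fun n => ‖a n‖)) : powSum a ∈ APlus :=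
  ⟨a, ha, fun _ hz => hasSum_powSum_of_summable ha (by simpa using hz)⟩

theorem mem_APlus_iff {f : ℂ → ℂ} : f ∈ APlus ↔ Summable (fun n => ‖taylorCoeff f n‖) ∧
    ∀ z ∈ closedBall (0 : ℂ) 1, f z = powSum (taylorCoeff f) z := by
  constructor
  · rintro ⟨a, ha, hf⟩
    have : taylorCoeff f = a := funext fun n =>
      taylorCoeff_eq_of_hasSum (norm_le_tsum_of_summable ha)
        (fun z hz => hf z (ball_subset_closedBall hz)) n
    rw [this]
    exact ⟨ha, fun z hz => (hf z hz).tsum_eq.symm⟩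
  · rintro ⟨ha, hf⟩
    exact ⟨_, ha, fun z hz => by
      rw [hf z hz]; exact hasSum_powSum_of_summable ha (by simpa using hz)⟩

theorem taylorCoeff_powSum {a : ℕ → ℂ} (ha : Summable (fun n => ‖a n‖)) :
    taylorCoeff (powSum a) = a :=
  funext fun n => taylorCoeff_eq_of_hasSum (norm_le_tsum_of_summable ha)
    (fun _ hz => hasSum_powSum_of_summable ha (by simpa using (mem_ball_zero_iff.1 hz).le)) n

theorem powSum_add {a b : ℕ → ℂ} (ha : Summable (fun n => ‖a n‖)) (hb : Summable (fun n => ‖b n‖))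
    {z : ℂ} (hz : ‖z‖ ≤ 1) : powSum (a + b) z = powSum a z + powSum b z := by
  rw [powSum, powSum, powSum, ← (hasSum_powSum_of_summable ha hz).summable.tsum_add
    (hasSum_powSum_of_summable hb hz).summable]
  simp [add_mul]

theorem powSum_smul (c : ℂ) (a : ℕ → ℂ) (z : ℂ) : powSum (c • a) z = c * powSum a z := by
  simp [powSum, ← tsum_mul_left, mul_assoc]

/-- Right shift of a sequence, corresponding to multiplication by `z`. -/
def shiftSeq (a : ℕ → ℂ) : ℕ → ℂ
  | 0 => 0
  | n + 1 => a n

theorem summable_shiftSeq {a : ℕ → ℂ} (ha : Summable (fun n => ‖a n‖)) :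
    Summable (fun n => ‖shiftSeq a n‖) := by
  rw [← summable_nat_add_iff 1]; simpa [shiftSeq] using ha

theorem powSum_shiftSeq {a : ℕ → ℂ} (ha : Summable (fun n => ‖a n‖)) {z : ℂ} (hz : ‖z‖ ≤ 1) :
    powSum (shiftSeq a) z = z * powSum a z := by
  rw [powSum, (hasSum_powSum_of_summable (summable_shiftSeq ha) hz).summable.tsum_eq_zero_add]
  simp only [shiftSeq, zero_mul, zero_add, powSum, ← tsum_mul_left]
  congr 1; ext n; ring

/-- The Taylor coefficient sequences of the elements of `I`. -/
def coeffSet (I : Set (ℂ → ℂ)) : Set (ℕ → ℂ) := {a | Summable (fun n => ‖a n‖) ∧ powSum a ∈ I}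

theorem mem_of_eqOn_closedBall {I : Set (ℂ → ℂ)} (hI : IsClosedIdealAPlus I) {f g : ℂ → ℂ}
    (hf : f ∈ I) (hg : ∀ z ∈ closedBall (0 : ℂ) 1, g z = f z) : g ∈ I := by
  obtain ⟨a, ha, hfa⟩ := hI.1 hf
  refine hI.2.2.2 g ⟨a, ha, fun z hz => by rw [hg z hz]; exact hfa z hz⟩ fun ε hε => ⟨f, hf, ?_⟩
  have : ∀ n, taylorCoeff (g - f) n = 0 := fun n =>
    taylorCoeff_eq_of_hasSum (a := fun _ => 0) (C := 0) (by simp) (fun z hz => by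
      simp [hg z (ball_subset_closedBall hz), hasSum_zero]) n
  simpa [APlusNorm, this] using hε

theorem mem_iff_coeffSet {I : Set (ℂ → ℂ)} (hI : IsClosedIdealAPlus I) {f : ℂ → ℂ}
    (hf : f ∈ APlus) : f ∈ I ↔ taylorCoeff f ∈ coeffSet I := by
  have hf' := mem_APlus_iff.1 hf
  exact ⟨fun h => ⟨hf'.1, mem_of_eqOn_closedBall hI h fun z hz => (hf'.2 z hz).symm⟩,
    fun h => mem_of_eqOn_closedBall hI h.2 hf'.2⟩

theorem coeffSet_add {I : Set (ℂ → ℂ)} (hI : IsClosedIdealAPlus I) {a b : ℕ → ℂ}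
    (ha : a ∈ coeffSet I) (hb : b ∈ coeffSet I) : a + b ∈ coeffSet I := by
  refine ⟨Summable.of_nonneg_of_le (fun _ => norm_nonneg _) (fun n => norm_add_le _ _)
    (ha.1.add hb.1), mem_of_eqOn_closedBall hI (hI.2.1 _ ha.2 _ hb.2) fun z hz => ?_⟩
  rw [powSum_add ha.1 hb.1 (by simpa using hz)]; rfl

theorem coeffSet_smul {I : Set (ℂ → ℂ)} (hI : IsClosedIdealAPlus I) (c : ℂ) {a : ℕ → ℂ}
    (ha : a ∈ coeffSet I) : c • a ∈ coeffSet I := by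
  have hc : (fun _ : ℂ => c) ∈ APlus := by
    refine ⟨fun n => if n = 0 then c else 0, ?_, fun z _ => ?_⟩
    · exact summable_of_ne_finset_zero (s := {0}) (by simp +contextual)
    · convert hasSum_single (f := fun n => (if n = 0 then c else 0) * z ^ n) 0
        (by simp +contextual) using 1
      simp
  refine ⟨by simpa [norm_mul] using ha.1.mul_left ‖c‖,
    mem_of_eqOn_closedBall hI (hI.2.2.1 _ hc _ ha.2) fun z _ => ?_⟩
  rw [powSum_smul]; rfl

theorem coeffSet_shift {I : Set (ℂ → ℂ)} (hI : IsClosedIdealAPlus I) {a : ℕ → ℂ}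
    (ha : a ∈ coeffSet I) : shiftSeq a ∈ coeffSet I := by
  have hc : (fun z : ℂ => z) ∈ APlus := by
    refine ⟨fun n => if n = 1 then 1 else 0, ?_, fun z _ => ?_⟩
    · exact summable_of_ne_finset_zero (s := {1}) (by simp +contextual)
    · convert hasSum_single (f := fun n => (if n = 1 then (1 : ℂ) else 0) * z ^ n) 1
        (by simp +contextual) using 1
      simp
  refine ⟨summable_shiftSeq ha.1,
    mem_of_eqOn_closedBall hI (hI.2.2.1 _ hc _ ha.2) fun z hz => ?_⟩
  rw [powSum_shiftSeq ha.1 (by simpa using hz)]; rfl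

theorem coeffSet_closed {I : Set (ℂ → ℂ)} (hI : IsClosedIdealAPlus I) {a : ℕ → ℂ}
    (ha : Summable (fun n => ‖a n‖))
    (h : ∀ ε > 0, ∃ b ∈ coeffSet I, ∑' n, ‖a n - b n‖ < ε) : a ∈ coeffSet I := by
  refine ⟨ha, hI.2.2.2 _ (powSum_mem_APlus ha) fun ε hε => ?_⟩
  obtain ⟨b, hb, hab⟩ := h ε hε
  refine ⟨_, hb.2, ?_⟩
  have hs : Summable (fun n => ‖a n - b n‖) := Summable.of_nonneg_of_le (fun _ => norm_nonneg _)
    (fun n => norm_sub_le _ _) (ha.add hb.1)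
  have : ∀ n, taylorCoeff (powSum a - powSum b) n = a n - b n := fun n =>
    taylorCoeff_eq_of_hasSum (norm_le_tsum_of_summable hs) (fun z hz => by
      have hz' : ‖z‖ ≤ 1 := by simpa using (mem_ball_zero_iff.1 hz).le
      simpa [sub_mul] using (hasSum_powSum_of_summable ha hz').sub
        (hasSum_powSum_of_summable hb.1 hz')) n
  simpa [APlusNorm, this] using hab

theorem memℓp_one_iff_summable_norm {a : ℕ → ℂ} :
    Memℓp a 1 ↔ Summable (fun n => ‖a n‖) := by
  rw [memℓp_gen_iff (by norm_num)]; simp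

theorem exists_annihilator {K : Set (ℕ → ℂ)} (hK : ∀ a ∈ K, Summable (fun n => ‖a n‖))
    (h0 : (0 : ℕ → ℂ) ∈ K) (hadd : ∀ a ∈ K, ∀ b ∈ K, a + b ∈ K)
    (hsmul : ∀ (c : ℂ), ∀ a ∈ K, c • a ∈ K)
    (hcl : ∀ a : ℕ → ℂ, Summable (fun n => ‖a n‖) →
      (∀ ε > 0, ∃ b ∈ K, ∑' n, ‖a n - b n‖ < ε) → a ∈ K)
    {a : ℕ → ℂ} (ha : Summable (fun n => ‖a n‖)) (haK : a ∉ K) :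
    ∃ (φ : ℕ → ℂ) (C : ℝ), (∀ n, ‖φ n‖ ≤ C) ∧ (∀ h ∈ K, ∑' n, h n * φ n = 0) ∧
      ∑' n, a n * φ n ≠ 0 := by
  let N : Submodule ℂ (lp (fun _ : ℕ => ℂ) 1) :=
    { carrier := {x | (x : ℕ → ℂ) ∈ K}
      add_mem' := fun {x y} hx hy => hadd _ hx _ hy
      zero_mem' := h0
      smul_mem' := fun c x hx => hsmul c _ hx }
  have hnorm : ∀ x : lp (fun _ : ℕ => ℂ) 1, ‖x‖ = ∑' n, ‖x n‖ := fun x => by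
    rw [lp.norm_eq_tsum_rpow (by norm_num)]; simp
  have hNc : IsClosed (N : Set (lp (fun _ : ℕ => ℂ) 1)) := by
    refine isClosed_of_closure_subset fun x hx => ?_
    refine hcl _ (memℓp_one_iff_summable_norm.1 x.2) fun ε hε => ?_
    obtain ⟨y, hy, hxy⟩ := Metric.mem_closure_iff.1 hx ε hε
    refine ⟨y, hy, ?_⟩
    rw [dist_eq_norm, hnorm] at hxy
    simpa using hxy
  let x : lp (fun _ : ℕ => ℂ) 1 := ⟨a, memℓp_one_iff_summable_norm.2 ha⟩
  obtain ⟨F, u, hF1, hF2⟩ := RCLike.geometric_hahn_banach_closed_point (𝕜 := ℂ)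
    (N.restrictScalars ℝ).convex hNc (x := x) haK
  have hu : 0 < u := by simpa using hF1 0 N.zero_mem
  have hFN : ∀ y ∈ N, F y = 0 := by
    intro y hy
    by_contra hne
    have := hF1 (((u / ‖F y‖ ^ 2 : ℝ) * (starRingEnd ℂ (F y)) : ℂ) • y) (N.smul_mem _ hy)
    have hpos : ‖F y‖ ^ 2 ≠ 0 := by positivity
    have h2 : F ((((u / ‖F y‖ ^ 2 : ℝ) : ℂ) * (starRingEnd ℂ (F y))) • y) = (u : ℂ) := by
      rw [map_smul, smul_eq_mul, mul_assoc, ← Complex.normSq_eq_conj_mul_self,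
        ← Complex.ofReal_mul, Complex.normSq_eq_norm_sq, div_mul_cancel₀ _ hpos]
    rw [h2] at this
    simp at this
  have hrep : ∀ y : lp (fun _ : ℕ => ℂ) 1,
      F y = ∑' n, y n * F (lp.single 1 n (1 : ℂ)) := by
    intro y
    have h1 := (lp.hasSum_single (by norm_num) y).mapL F
    rw [← h1.tsum_eq]
    congr 1; ext n
    have : lp.single (E := fun _ : ℕ => ℂ) 1 n (y n) = y n • lp.single 1 n (1 : ℂ) := by
      rw [← lp.single_smul]; simp
    rw [this, map_smul, smul_eq_mul]
  refine ⟨fun n => F (lp.single 1 n (1 : ℂ)), ‖F‖, fun n => ?_, fun h hh => ?_, ?_⟩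
  · refine (F.le_opNorm _).trans ?_
    rw [lp.norm_single (by norm_num)]; simp
  · have := hrep ⟨h, memℓp_one_iff_summable_norm.2 (hK h hh)⟩
    rw [hFN _ hh] at this
    exact this.symm
  · have := hrep x
    intro h0
    rw [show F x = 0 from this.trans h0] at hF2
    simp at hF2; linarith

theorem integral_exp_int_mul_I (k : ℤ) :
    ∫ θ in (0:ℝ)..(2 * Real.pi), Complex.exp ((k : ℂ) * θ * I) = if k = 0 then 2 * Real.pi else 0 := by
  split_ifs with h
  · simp [h]
  · have hk : (k : ℂ) * I ≠ 0 := by simp [h]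
    have : ∀ θ : ℝ, Complex.exp ((k : ℂ) * θ * I) = Complex.exp ((k : ℂ) * I * θ) := fun θ => by
      ring_nf
    simp_rw [this]
    rw [integral_exp_mul_complex hk]
    have h1 : Complex.exp ((k : ℂ) * I * ((2 * Real.pi : ℝ) : ℂ)) = 1 := by
      rw [Complex.exp_eq_one_iff]; exact ⟨k, by push_cast; ring⟩
    rw [h1]; simp

theorem fcoeff_eq_of_hasSum {c : ℤ → ℂ} (hc : Summable (fun n => ‖c n‖)) {g : ℂ → ℂ}
    (hg : ∀ z ∈ sphere (0 : ℂ) 1, HasSum (fun n : ℤ => c n * z ^ n) (g z)) (n : ℤ) :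
    fcoeff g n = c n := by
  let F : ℤ → C(ℝ, ℂ) := fun k => ⟨fun θ => c k * Complex.exp (((k - n : ℤ) : ℂ) * θ * I), by fun_prop⟩
  have hF : ∀ k (θ : ℝ), F k θ = c k * Complex.exp (((k - n : ℤ) : ℂ) * θ * I) := fun k θ => rfl
  have hbd : ∀ k (θ : ℝ), ‖F k θ‖ = ‖c k‖ := fun k θ => by
    rw [hF, norm_mul, show (((k - n : ℤ) : ℂ) * θ * I) = (((k - n : ℤ) * θ : ℝ) : ℂ) * I by
      push_cast; ring, Complex.norm_exp_ofReal_mul_I, mul_one]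
  have h := intervalIntegral.hasSum_intervalIntegral_of_summable_norm (a := 0) (b := 2 * Real.pi) (f := F) (by
    refine Summable.of_nonneg_of_le (fun _ => norm_nonneg _) (fun k => ?_) hc
    refine (ContinuousMap.norm_le _ (norm_nonneg _)).2 fun x => ?_
    simpa using (hbd k x).le)
  have h2 : ∀ k, ∫ θ in (0:ℝ)..(2 * Real.pi), F k θ = if k = n then c n * (2 * Real.pi) else 0 := by
    intro k
    simp_rw [hF]
    rw [intervalIntegral.integral_const_mul, integral_exp_int_mul_I]
    by_cases hk : k = n
    · simp [hk]
    · simp [hk, sub_eq_zero]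
  simp_rw [h2] at h
  have h3 := h.unique (hasSum_ite_eq n (c n * (2 * Real.pi)))
  have h4 : ∀ θ : ℝ, g (Complex.exp ((θ : ℂ) * I)) * Complex.exp (-(n : ℂ) * (θ : ℂ) * I) =
      ∑' k, F k θ := by
    intro θ
    have := (hg (Complex.exp ((θ : ℂ) * I)) (by simp [Complex.norm_exp_ofReal_mul_I])).mul_right
      (Complex.exp (-(n : ℂ) * (θ : ℂ) * I))
    rw [← this.tsum_eq]
    congr 1; ext k
    rw [hF, mul_assoc, ← Complex.exp_int_mul, ← Complex.exp_add]
    congr 2; push_cast; ring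
  unfold fcoeff
  simp_rw [h4]
  rw [h3]
  have : (Real.pi : ℂ) ≠ 0 := by exact_mod_cast Real.pi_ne_zero
  field_simp

theorem mem_WienerAlg_of_hasSum {c : ℤ → ℂ} (hc : Summable (fun n => ‖c n‖)) {g : ℂ → ℂ}
    (hg : ∀ z ∈ sphere (0 : ℂ) 1, HasSum (fun n : ℤ => c n * z ^ n) (g z)) : g ∈ WienerAlg := by
  have h : fcoeff g = c := funext fun n => fcoeff_eq_of_hasSum hc hg n
  rw [WienerAlg, Set.mem_ofPred_eq, h]
  exact ⟨hc, hg⟩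

/-- Extension of a sequence by zero to the integers. -/
def extZ (a : ℕ → ℂ) : ℤ → ℂ
  | Int.ofNat n => a n
  | Int.negSucc _ => 0

@[simp] theorem extZ_natCast (a : ℕ → ℂ) (n : ℕ) : extZ a (n : ℤ) = a n := rfl

theorem extZ_of_notMem_range (a : ℕ → ℂ) (k : ℤ) (hk : k ∉ Set.range ((↑) : ℕ → ℤ)) :
    extZ a k = 0 := by
  cases k with
  | ofNat n => exact absurd ⟨n, rfl⟩ hk
  | negSucc n => rfl

theorem norm_extZ_le {a : ℕ → ℂ} {C : ℝ} (ha : ∀ n, ‖a n‖ ≤ C) (n : ℤ) : ‖extZ a n‖ ≤ C := by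
  cases n with
  | ofNat n => exact ha n
  | negSucc n => simpa [extZ] using (norm_nonneg _).trans (ha 0)

theorem summable_extZ {a : ℕ → ℂ} (ha : Summable (fun n => ‖a n‖)) :
    Summable (fun n => ‖extZ a n‖) := by
  refine (Function.Injective.summable_iff (f := fun n => ‖extZ a n‖) Nat.cast_injective
    fun k hk => ?_).1 ha
  rw [extZ_of_notMem_range a k hk, norm_zero]

theorem hasSum_extZ {a : ℕ → ℂ} {g : ℤ → ℂ} {s : ℂ} (h : HasSum (fun n : ℕ => a n * g n) s) :
    HasSum (fun n : ℤ => extZ a n * g n) s := by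
  refine (Function.Injective.hasSum_iff (f := fun n : ℤ => extZ a n * g n) Nat.cast_injective
    fun k hk => ?_).1 h
  rw [extZ_of_notMem_range a k hk, zero_mul]

theorem fcoeff_of_mem_APlus {h : ℂ → ℂ} (hh : h ∈ APlus) : fcoeff h = extZ (taylorCoeff h) := by
  have h' := mem_APlus_iff.1 hh
  refine funext fun n => fcoeff_eq_of_hasSum (summable_extZ h'.1) (fun z hz => ?_) n
  refine hasSum_extZ (g := fun n => z ^ n) ?_
  simp only [zpow_natCast]
  rw [h'.2 z (sphere_subset_closedBall hz)]
  exact hasSum_powSum_of_summable h'.1 (by simpa using (mem_sphere_zero_iff_norm.1 hz).le)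

theorem APlus_subset_WienerAlg : APlus ⊆ WienerAlg := fun h hh => by
  have h' := mem_APlus_iff.1 hh
  refine mem_WienerAlg_of_hasSum (summable_extZ h'.1) (fun z hz => ?_)
  refine hasSum_extZ (g := fun n => z ^ n) ?_
  simp only [zpow_natCast]
  rw [h'.2 z (sphere_subset_closedBall hz)]
  exact hasSum_powSum_of_summable h'.1 (by simpa using (mem_sphere_zero_iff_norm.1 hz).le)

/-- The correlation `m ↦ ∑ₙ c n * φ (n + m)`. -/
def corrZ (φ c : ℤ → ℂ) (m : ℤ) : ℂ := ∑' n, c n * φ (n + m)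

theorem summable_corrZ {φ c : ℤ → ℂ} {C : ℝ} (hφ : ∀ n, ‖φ n‖ ≤ C)
    (hc : Summable (fun n => ‖c n‖)) (m : ℤ) : Summable (fun n => ‖c n * φ (n + m)‖) := by
  refine Summable.of_nonneg_of_le (fun _ => norm_nonneg _) (fun n => ?_) (hc.mul_right C)
  rw [norm_mul]; gcongr; exact hφ _

theorem norm_corrZ_le {φ c : ℤ → ℂ} {C : ℝ} (hφ : ∀ n, ‖φ n‖ ≤ C)
    (hc : Summable (fun n => ‖c n‖)) (m : ℤ) : ‖corrZ φ c m‖ ≤ (∑' n, ‖c n‖) * C := by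
  refine (norm_tsum_le_tsum_norm (summable_corrZ hφ hc m)).trans ?_
  rw [← tsum_mul_right]
  refine (summable_corrZ hφ hc m).tsum_le_tsum (fun n => ?_) (hc.mul_right C)
  rw [norm_mul]; gcongr; exact hφ _

theorem corrZ_add {φ c d : ℤ → ℂ} {C : ℝ} (hφ : ∀ n, ‖φ n‖ ≤ C)
    (hc : Summable (fun n => ‖c n‖)) (hd : Summable (fun n => ‖d n‖)) (m : ℤ) :
    corrZ φ (c + d) m = corrZ φ c m + corrZ φ d m := by
  rw [corrZ, corrZ, corrZ, ← (summable_corrZ hφ hc m).of_norm.tsum_add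
    (summable_corrZ hφ hd m).of_norm]
  simp [add_mul]

/-- Convolution of bilateral sequences. -/
def convZ (c d : ℤ → ℂ) (n : ℤ) : ℂ := ∑' k, c k * d (n - k)

/-- The equivalence `(n, k) ↦ (k, n - k)`. -/
def convEquiv : ℤ × ℤ ≃ ℤ × ℤ where
  toFun x := (x.2, x.1 - x.2)
  invFun y := (y.1 + y.2, y.1)
  left_inv x := by simp
  right_inv y := by simp

theorem summable_conv_prod {c d : ℤ → ℂ} (hc : Summable (fun n => ‖c n‖))
    (hd : Summable (fun n => ‖d n‖)) {φ : ℤ → ℂ} {C : ℝ} (hφ : ∀ n, ‖φ n‖ ≤ C) :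
    Summable (fun x : ℤ × ℤ => ‖c x.2 * d (x.1 - x.2) * φ x.1‖) := by
  have h1 : Summable (fun y : ℤ × ℤ => ‖c y.1‖ * ‖d y.2‖) :=
    hc.mul_of_nonneg hd (fun _ => norm_nonneg _) (fun _ => norm_nonneg _)
  have h2 := (convEquiv.summable_iff (f := fun y : ℤ × ℤ => ‖c y.1‖ * ‖d y.2‖)).2 h1
  refine Summable.of_nonneg_of_le (fun _ => norm_nonneg _) (fun x => ?_) (h2.mul_right C)
  rw [norm_mul, norm_mul]
  simp only [Function.comp, convEquiv, Equiv.coe_fn_mk]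
  gcongr
  exact hφ _

theorem summable_convZ {c d : ℤ → ℂ} (hc : Summable (fun n => ‖c n‖))
    (hd : Summable (fun n => ‖d n‖)) : Summable (fun n => ‖convZ c d n‖) := by
  have h := summable_conv_prod hc hd (φ := fun _ => 1) (C := 1) (by simp)
  simp only [mul_one] at h
  refine Summable.of_nonneg_of_le (fun _ => norm_nonneg _) (fun n => ?_) h.prod
  exact norm_tsum_le_tsum_norm (h.prod_factor n)

theorem tsum_convZ_mul {c d : ℤ → ℂ} (hc : Summable (fun n => ‖c n‖))
    (hd : Summable (fun n => ‖d n‖)) {φ : ℤ → ℂ} {C : ℝ} (hφ : ∀ n, ‖φ n‖ ≤ C) :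
    ∑' n, convZ c d n * φ n = ∑' k, c k * ∑' l, d l * φ (k + l) := by
  have h := (summable_conv_prod hc hd hφ).of_norm
  have e1 : ∑' x : ℤ × ℤ, c x.2 * d (x.1 - x.2) * φ x.1 = ∑' n, convZ c d n * φ n := by
    rw [h.tsum_prod]
    congr 1; ext n
    rw [convZ, ← tsum_mul_right]
  have h' : Summable (fun y : ℤ × ℤ => c y.1 * d y.2 * φ (y.1 + y.2)) := by
    refine (convEquiv.summable_iff (f := fun y : ℤ × ℤ => c y.1 * d y.2 * φ (y.1 + y.2))).1 ?_
    simpa [Function.comp_def, convEquiv] using h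
  have e2 : ∑' x : ℤ × ℤ, c x.2 * d (x.1 - x.2) * φ x.1 =
      ∑' y : ℤ × ℤ, c y.1 * d y.2 * φ (y.1 + y.2) := by
    rw [← convEquiv.tsum_eq (fun y : ℤ × ℤ => c y.1 * d y.2 * φ (y.1 + y.2))]
    simp [convEquiv]
  rw [← e1, e2, h'.tsum_prod]
  congr 1; ext k
  rw [← tsum_mul_left]
  simp only [mul_assoc]

theorem norm_zpow_of_mem_sphere {z : ℂ} (hz : z ∈ sphere (0 : ℂ) 1) (n : ℤ) : ‖z ^ n‖ = 1 := by
  rw [norm_zpow, mem_sphere_zero_iff_norm.1 hz, one_zpow]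

theorem summable_mul_zpow {c : ℤ → ℂ} (hc : Summable (fun n => ‖c n‖)) {z : ℂ}
    (hz : z ∈ sphere (0 : ℂ) 1) : Summable (fun n : ℤ => c n * z ^ n) := by
  refine Summable.of_norm ?_
  simpa [norm_mul, norm_zpow_of_mem_sphere hz] using hc

theorem hasSum_convZ {f g : ℂ → ℂ} {c d : ℤ → ℂ} (hc : Summable (fun n => ‖c n‖))
    (hd : Summable (fun n => ‖d n‖)) {z : ℂ} (hz : z ∈ sphere (0 : ℂ) 1)
    (hf : HasSum (fun n : ℤ => c n * z ^ n) (f z)) (hg : HasSum (fun n : ℤ => d n * z ^ n) (g z)) :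
    HasSum (fun n : ℤ => convZ c d n * z ^ n) ((f * g) z) := by
  have h1 := (summable_mul_zpow (summable_convZ hc hd) hz).hasSum
  rw [tsum_convZ_mul hc hd (φ := fun n => z ^ n) (C := 1)
    (fun n => (norm_zpow_of_mem_sphere hz n).le)] at h1
  convert h1 using 1
  have hz0 : z ≠ 0 := by rintro rfl; simp at hz
  simp_rw [zpow_add₀ hz0, mul_left_comm (d _), tsum_mul_left, hg.tsum_eq, ← mul_assoc]
  rw [tsum_mul_right, hf.tsum_eq]; rfl

theorem fcoeff_mul {f g : ℂ → ℂ} (hf : f ∈ WienerAlg) (hg : g ∈ WienerAlg) :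
    fcoeff (f * g) = convZ (fcoeff f) (fcoeff g) :=
  funext fun n => fcoeff_eq_of_hasSum (summable_convZ hf.1 hg.1)
    (fun z hz => hasSum_convZ hf.1 hg.1 hz (hf.2 z hz) (hg.2 z hz)) n

theorem mul_mem_WienerAlg {f g : ℂ → ℂ} (hf : f ∈ WienerAlg) (hg : g ∈ WienerAlg) :
    f * g ∈ WienerAlg :=
  mem_WienerAlg_of_hasSum (summable_convZ hf.1 hg.1)
    (fun z hz => hasSum_convZ hf.1 hg.1 hz (hf.2 z hz) (hg.2 z hz))

theorem summable_norm_add {ι : Type*} {c d : ι → ℂ} (hc : Summable (fun n => ‖c n‖))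
    (hd : Summable (fun n => ‖d n‖)) : Summable (fun n => ‖(c + d) n‖) :=
  Summable.of_nonneg_of_le (fun _ => norm_nonneg _) (fun _ => norm_add_le _ _) (hc.add hd)

theorem summable_norm_sub {ι : Type*} {c d : ι → ℂ} (hc : Summable (fun n => ‖c n‖))
    (hd : Summable (fun n => ‖d n‖)) : Summable (fun n => ‖(c - d) n‖) :=
  Summable.of_nonneg_of_le (fun _ => norm_nonneg _) (fun _ => norm_sub_le _ _) (hc.add hd)

theorem hasSum_add_zpow {f g : ℂ → ℂ} (hf : f ∈ WienerAlg) (hg : g ∈ WienerAlg) :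
    ∀ z ∈ sphere (0 : ℂ) 1, HasSum (fun n : ℤ => (fcoeff f + fcoeff g) n * z ^ n) ((f + g) z) :=
  fun z hz => by simpa [add_mul] using (hf.2 z hz).add (hg.2 z hz)

theorem hasSum_sub_zpow {f g : ℂ → ℂ} (hf : f ∈ WienerAlg) (hg : g ∈ WienerAlg) :
    ∀ z ∈ sphere (0 : ℂ) 1, HasSum (fun n : ℤ => (fcoeff f - fcoeff g) n * z ^ n) ((f - g) z) :=
  fun z hz => by simpa [sub_mul] using (hf.2 z hz).sub (hg.2 z hz)

/-- Elements of the Wiener algebra whose correlation with `φ` vanishes at `+∞`. -/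
def vanishingCorr (φ : ℤ → ℂ) : Set (ℂ → ℂ) :=
  {g ∈ WienerAlg | Tendsto (corrZ φ (fcoeff g)) atTop (nhds 0)}

theorem isClosedIdealW_vanishingCorr {φ : ℤ → ℂ} {C : ℝ} (hφ : ∀ n, ‖φ n‖ ≤ C) :
    IsClosedIdealW (vanishingCorr φ) := by
  refine ⟨fun _ h => h.1, fun f hf g hg => ?_, fun f hf g hg => ?_, fun f hf h => ?_⟩
  · have hs := summable_norm_add hf.1.1 hg.1.1
    have hh := hasSum_add_zpow hf.1 hg.1
    refine ⟨mem_WienerAlg_of_hasSum hs hh, ?_⟩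
    rw [show fcoeff (f + g) = fcoeff f + fcoeff g from
      funext fun n => fcoeff_eq_of_hasSum hs hh n]
    have := hf.2.add hg.2
    rw [add_zero] at this
    exact this.congr fun m => (corrZ_add hφ hf.1.1 hg.1.1 m).symm
  · refine ⟨mul_mem_WienerAlg hf hg.1, ?_⟩
    have key : ∀ m, corrZ φ (fcoeff (f * g)) m = ∑' k, fcoeff f k * corrZ φ (fcoeff g) (k + m) := by
      intro m
      rw [fcoeff_mul hf hg.1, corrZ,
        tsum_convZ_mul hf.1 hg.1.1 (φ := fun n => φ (n + m)) (fun n => hφ _)]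
      congr 1; ext k
      rw [corrZ]
      congr 2; ext l
      ring_nf
    simp_rw [funext key]
    rw [show (0 : ℂ) = ∑' k : ℤ, fcoeff f k * 0 by simp]
    refine tendsto_tsum_of_dominated_convergence
      (bound := fun k => ‖fcoeff f k‖ * ((∑' n, ‖fcoeff g n‖) * C)) (hf.1.mul_right _)
      (fun k => ?_) (Eventually.of_forall fun m k => ?_)
    · exact (hg.2.comp (tendsto_atTop_add_const_left _ k tendsto_id)).const_mul _
    · rw [norm_mul]
      gcongr
      exact norm_corrZ_le hφ hg.1.1 _
  · refine ⟨hf, ?_⟩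
    rw [Metric.tendsto_nhds]
    intro ε hε
    have hC : 0 ≤ C := (norm_nonneg _).trans (hφ 0)
    obtain ⟨g, hg, hfg⟩ := h (ε / (2 * (C + 1))) (by positivity)
    have hs := summable_norm_sub hf.1 hg.1.1
    have hh := hasSum_sub_zpow hf hg.1
    have e : fcoeff (f - g) = fcoeff f - fcoeff g := funext fun n => fcoeff_eq_of_hasSum hs hh n
    rw [WienerNorm, e] at hfg
    filter_upwards [(Metric.tendsto_nhds.1 hg.2) (ε / 2) (by positivity)] with m hm
    rw [dist_zero_right] at hm ⊢
    have e2 := corrZ_add hφ hs hg.1.1 m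
    rw [sub_add_cancel] at e2
    rw [e2]
    refine (norm_add_le _ _).trans_lt ?_
    have h3 := norm_corrZ_le hφ hs m
    have h4 : (∑' n, ‖(fcoeff f - fcoeff g) n‖) * C ≤ ε / (2 * (C + 1)) * (C + 1) := by
      gcongr; linarith
    have h5 : ε / (2 * (C + 1)) * (C + 1) = ε / 2 := by field_simp
    linarith

theorem tsum_shift_eq_zero {I : Set (ℂ → ℂ)} (hI : IsClosedIdealAPlus I) {φ : ℕ → ℂ}
    (hann : ∀ h ∈ coeffSet I, ∑' n, h n * φ n = 0) {h : ℕ → ℂ} {C : ℝ} (hφ : ∀ n, ‖φ n‖ ≤ C)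
    (hh : h ∈ coeffSet I) (m : ℕ) : ∑' k, h k * φ (k + m) = 0 := by
  induction m generalizing h with
  | zero => simpa using hann h hh
  | succ m ih =>
    have h1 := ih (coeffSet_shift hI hh)
    have hs : Summable (fun k => shiftSeq h k * φ (k + m)) := by
      refine Summable.of_norm (Summable.of_nonneg_of_le (fun _ => norm_nonneg _) (fun n => ?_)
        ((summable_shiftSeq hh.1).mul_right C))
      rw [norm_mul]; gcongr; exact hφ _
    rw [hs.tsum_eq_zero_add] at h1
    simpa [shiftSeq, add_assoc, add_comm 1 m] using h1

theorem tendsto_corr_of_mem_idealGenW {I : Set (ℂ → ℂ)} (hI : IsClosedIdealAPlus I) {φ : ℕ → ℂ}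
    {C : ℝ} (hφ : ∀ n, ‖φ n‖ ≤ C) (hann : ∀ h ∈ coeffSet I, ∑' n, h n * φ n = 0) {f : ℂ → ℂ}
    (hf : f ∈ APlus) (hfI : f ∈ IdealGenW I) :
    Tendsto (fun m : ℕ => ∑' k, taylorCoeff f k * φ (k + m)) atTop (nhds 0) := by
  have key : ∀ h ∈ APlus, ∀ m : ℕ, corrZ (extZ φ) (fcoeff h) m = ∑' k, taylorCoeff h k * φ (k + m) := by
    intro h hh m
    rw [fcoeff_of_mem_APlus hh]
    have hs : Summable (fun k => taylorCoeff h k * φ (k + m)) := by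
      refine Summable.of_norm (Summable.of_nonneg_of_le (fun _ => norm_nonneg _) (fun n => ?_)
        ((mem_APlus_iff.1 hh).1.mul_right C))
      rw [norm_mul]; gcongr; exact hφ _
    refine (hasSum_extZ (g := fun n => extZ φ (n + m)) ?_).tsum_eq
    exact_mod_cast hs.hasSum
  have hJ : f ∈ vanishingCorr (extZ φ) := by
    refine hfI _ ⟨isClosedIdealW_vanishingCorr (norm_extZ_le hφ), fun h hh => ?_⟩
    refine ⟨APlus_subset_WienerAlg (hI.1 hh), ?_⟩
    refine tendsto_const_nhds.congr' ?_
    filter_upwards [eventually_ge_atTop 0] with m hm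
    lift m to ℕ using hm
    rw [key h (hI.1 hh), tsum_shift_eq_zero hI hann hφ ((mem_iff_coeffSet hI (hI.1 hh)).1 hh) m]
  exact (hJ.2.comp tendsto_natCast_atTop_atTop).congr (key f hf)

/-- The Hilbert space of square-summable bilateral sequences. -/
abbrev L2Z : Type := lp (fun _ : ℤ => ℂ) 2

theorem memℓp_two_iff {ι : Type*} {x : ι → ℂ} : Memℓp x 2 ↔ Summable (fun n => ‖x n‖ ^ 2) := by
  rw [memℓp_gen_iff (by norm_num)]; norm_num

theorem summable_sq_L2Z (x : L2Z) : Summable (fun n => ‖x n‖ ^ 2) := memℓp_two_iff.1 x.2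

theorem norm_sq_L2Z (x : L2Z) : ‖x‖ ^ 2 = ∑' n, ‖x n‖ ^ 2 := by
  have := lp.norm_rpow_eq_tsum (p := 2) (by norm_num) x
  norm_num at this
  exact this

/-- Translation by `j` on bilateral sequences. -/
def shiftZ (j : ℤ) : L2Z →ₗᵢ[ℂ] L2Z where
  toFun x := ⟨fun n => x (n - j), memℓp_two_iff.2
    ((Equiv.subRight j).summable_iff.2 (summable_sq_L2Z x))⟩
  map_add' x y := rfl
  map_smul' c x := rfl
  norm_map' x := by
    rw [← sq_eq_sq₀ (norm_nonneg _) (norm_nonneg _), norm_sq_L2Z, norm_sq_L2Z]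
    exact (Equiv.subRight j).tsum_eq (fun n => ‖x n‖ ^ 2)

@[simp] theorem shiftZ_apply (j : ℤ) (x : L2Z) (n : ℤ) : shiftZ j x n = x (n - j) := rfl

theorem shiftZ_shiftZ (i j : ℤ) (x : L2Z) : shiftZ i (shiftZ j x) = shiftZ (i + j) x := by
  ext n; simp only [shiftZ_apply, sub_sub]

theorem shiftZ_zero (x : L2Z) : shiftZ 0 x = x := by ext n; simp

theorem inner_shiftZ_shiftZ (i j : ℤ) (x y : L2Z) :
    inner ℂ (shiftZ i x) (shiftZ j y) = inner ℂ x (shiftZ (j - i) y) := by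
  rw [show shiftZ j y = shiftZ i (shiftZ (j - i) y) by rw [shiftZ_shiftZ]; congr 2; ring]
  exact (shiftZ i).inner_map_map _ _

theorem memℓp_two_extZ {a : ℕ → ℂ} (ha : Summable (fun n => ‖a n‖)) : Memℓp (extZ a) 2 := by
  have h1 : Memℓp (extZ a) 1 := by
    rw [memℓp_gen_iff (by norm_num)]; simpa using summable_extZ ha
  exact h1.of_exponent_ge (by norm_num)

/-- The square-summable bilateral sequence attached to an absolutely summable sequence. -/
def toL2Z (a : ℕ → ℂ) (ha : Summable (fun n => ‖a n‖)) : L2Z := ⟨extZ a, memℓp_two_extZ ha⟩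

theorem shiftZ_one_toL2Z {a : ℕ → ℂ} (ha : Summable (fun n => ‖a n‖)) :
    shiftZ 1 (toL2Z a ha) = toL2Z (shiftSeq a) (summable_shiftSeq ha) := by
  ext n
  change extZ a (n - 1) = extZ (shiftSeq a) n
  rcases n with (_ | n) | n
  · rfl
  · change extZ a (((n + 1 : ℕ) : ℤ) - 1) = a n
    simp
  · rw [show Int.negSucc n - 1 = Int.negSucc (n + 1) by omega]; rfl

/-- A linear shift-invariant set of absolutely summable sequences, not reduced to zero. -/
structure IsShiftIdeal (K : Set (ℕ → ℂ)) : Prop where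
  summable : ∀ a ∈ K, Summable (fun n => ‖a n‖)
  zero_mem : (0 : ℕ → ℂ) ∈ K
  add_mem : ∀ a ∈ K, ∀ b ∈ K, a + b ∈ K
  smul_mem : ∀ (c : ℂ), ∀ a ∈ K, c • a ∈ K
  shift_mem : ∀ a ∈ K, shiftSeq a ∈ K
  exists_ne : ∃ a ∈ K, a ≠ 0

theorem extZ_add (a b : ℕ → ℂ) : extZ (a + b) = extZ a + extZ b := by
  ext n; cases n <;> simp [extZ]

theorem extZ_smul (c : ℂ) (a : ℕ → ℂ) : extZ (c • a) = c • extZ a := by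
  ext n; cases n <;> simp [extZ]

theorem extZ_zero : extZ 0 = 0 := by
  ext n; cases n <;> rfl

/-- The elements of `K` as a subspace of the Hilbert space. -/
def IsShiftIdeal.sub {K : Set (ℕ → ℂ)} (hK : IsShiftIdeal K) : Submodule ℂ L2Z where
  carrier := {x | ∃ a ∈ K, (x : ℤ → ℂ) = extZ a}
  add_mem' := by
    rintro x y ⟨a, ha, hx⟩ ⟨b, hb, hy⟩
    exact ⟨a + b, hK.add_mem _ ha _ hb, by rw [lp.coeFn_add, hx, hy, extZ_add]⟩
  zero_mem' := ⟨0, hK.zero_mem, by rw [extZ_zero]; rfl⟩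
  smul_mem' := by
    rintro c x ⟨a, ha, hx⟩
    exact ⟨c • a, hK.smul_mem c _ ha, by rw [lp.coeFn_smul, hx, extZ_smul]⟩

theorem IsShiftIdeal.toL2Z_mem {K : Set (ℕ → ℂ)} (hK : IsShiftIdeal K) {a : ℕ → ℂ} (ha : a ∈ K) :
    toL2Z a (hK.summable a ha) ∈ hK.sub := ⟨a, ha, rfl⟩

theorem continuous_apply_L2Z (n : ℤ) : Continuous (fun x : L2Z => x n) :=
  LipschitzWith.continuous (K := 1) <| LipschitzWith.of_dist_le_mul fun x y => by
    simpa [dist_eq_norm] using lp.norm_apply_le_norm (p := 2) (by norm_num) (x - y) n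

theorem IsShiftIdeal.shift_mem_closure {K : Set (ℕ → ℂ)} (hK : IsShiftIdeal K) (m : ℕ) {x : L2Z}
    (hx : x ∈ hK.sub.topologicalClosure) : shiftZ m x ∈ hK.sub.topologicalClosure := by
  have h1 : ∀ x ∈ hK.sub.topologicalClosure, shiftZ 1 x ∈ hK.sub.topologicalClosure := by
    intro x hx
    refine map_mem_closure (shiftZ 1).continuous hx ?_
    rintro y ⟨a, ha, hy⟩
    have : y = toL2Z a (hK.summable a ha) := by ext n; rw [hy]; rfl
    rw [this, shiftZ_one_toL2Z]
    exact ⟨_, hK.shift_mem a ha, rfl⟩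
  induction m with
  | zero => simpa [shiftZ_zero] using hx
  | succ m ih =>
    have := h1 _ ih
    rw [shiftZ_shiftZ] at this
    convert this using 3
    push_cast; ring

/-- A wandering unit vector for the closure of `K`. -/
structure IsWandering {K : Set (ℕ → ℂ)} (hK : IsShiftIdeal K) (S : L2Z) : Prop where
  mem : S ∈ hK.sub.topologicalClosure
  norm_eq : ‖S‖ = 1
  orth : ∀ x ∈ hK.sub.topologicalClosure, ∀ m : ℕ, 0 < m → inner ℂ S (shiftZ m x) = 0

theorem IsShiftIdeal.apply_eq_zero_of_mem_closure {K : Set (ℕ → ℂ)} (hK : IsShiftIdeal K) {n : ℤ}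
    (hn : ∀ a ∈ K, extZ a n = 0) {x : L2Z} (hx : x ∈ hK.sub.topologicalClosure) : x n = 0 := by
  have hc : IsClosed {y : L2Z | y n = 0} := isClosed_eq (continuous_apply_L2Z n) continuous_const
  refine hc.closure_subset_iff.2 ?_ hx
  rintro y ⟨a, ha, hy⟩
  change y n = 0
  rw [hy]; exact hn a ha

theorem IsShiftIdeal.exists_wandering {K : Set (ℕ → ℂ)} (hK : IsShiftIdeal K) :
    ∃ S, IsWandering hK S := by
  classical
  have hex : ∃ n : ℕ, ∃ a ∈ K, a n ≠ 0 := by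
    obtain ⟨a, ha, hne⟩ := hK.exists_ne
    obtain ⟨n, hn⟩ := Function.ne_iff.1 hne
    exact ⟨n, a, ha, hn⟩
  set n0 := Nat.find hex with hn0
  obtain ⟨a, ha, hane⟩ := Nat.find_spec hex
  have hmin : ∀ m : ℕ, m < n0 → ∀ b ∈ K, b m = 0 := by
    intro m hm b hb
    by_contra h
    exact Nat.find_min hex hm ⟨b, hb, h⟩
  set M := hK.sub.topologicalClosure
  have : CompleteSpace M := (Submodule.isClosed_topologicalClosure _).completeSpace_coe
  set e : L2Z := lp.single 2 (n0 : ℤ) (1 : ℂ)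
  set P := M.starProjection e with hP
  have hPM : P ∈ M := Submodule.starProjection_apply_mem _ _
  have hinner : ∀ x ∈ M, inner ℂ P x = x n0 := by
    intro x hx
    have h1 := M.starProjection_inner_eq_zero e x hx
    rw [inner_sub_left, sub_eq_zero, lp.inner_single_left] at h1
    rw [hP, ← h1]; simp
  have hP0 : ‖P‖ ≠ 0 := by
    intro h
    rw [norm_eq_zero] at h
    have := hinner _ (Submodule.le_topologicalClosure _ (hK.toL2Z_mem ha))
    rw [h, inner_zero_left] at this
    exact hane this.symm
  refine ⟨((‖P‖⁻¹ : ℝ) : ℂ) • P, M.smul_mem _ hPM, ?_, fun x hx m hm => ?_⟩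
  · rw [norm_smul, Complex.norm_real, norm_inv, norm_norm, inv_mul_cancel₀ hP0]
  · rw [inner_smul_left, hinner _ (hK.shift_mem_closure m hx), shiftZ_apply,
      hK.apply_eq_zero_of_mem_closure (fun b hb => ?_) hx, mul_zero]
    by_cases h : m ≤ n0
    · rw [← Nat.cast_sub h, extZ_natCast]
      exact hmin _ (by omega) b hb
    · refine extZ_of_notMem_range _ _ ?_
      rintro ⟨k, hk⟩
      omega

theorem inner_L2Z (x y : L2Z) : inner ℂ x y = ∑' n, y n * (starRingEnd ℂ) (x n) := by
  rw [lp.inner_eq_tsum]; simp [RCLike.inner_apply]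

/-- The Szegő kernel at `w`. -/
def szego (w : ℂ) (hw : ‖w‖ < 1) : L2Z :=
  toL2Z (fun n => (starRingEnd ℂ) w ^ n) (by
    simpa using summable_geometric_of_lt_one (norm_nonneg w) hw)

theorem tsum_int_eq_tsum_nat {f : ℤ → ℂ} (hf : ∀ n < 0, f n = 0) : ∑' n, f n = ∑' n : ℕ, f n := by
  refine (Function.Injective.tsum_eq (f := f) Nat.cast_injective ?_).symm
  intro n hn
  by_contra h
  refine hn (hf n ?_)
  by_contra h2
  exact h ⟨n.toNat, by simp; omega⟩

theorem inner_szego {w : ℂ} (hw : ‖w‖ < 1) (y : L2Z) :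
    inner ℂ (szego w hw) y = powSum (fun n => y n) w := by
  rw [inner_L2Z, tsum_int_eq_tsum_nat]
  · simp [powSum, szego, toL2Z]
  · intro n hn
    have : (szego w hw) n = 0 := extZ_of_notMem_range _ _ (by rintro ⟨k, rfl⟩; omega)
    rw [this]; simp

theorem powSum_shiftZ {w : ℂ} (hw : ‖w‖ < 1) {y : L2Z} (hy : ∀ n < 0, y n = 0) (k : ℕ) :
    powSum (fun n => shiftZ k y n) w = w ^ k * powSum (fun n => y n) w := by
  have hb : ∀ n : ℕ, ‖(fun n : ℕ => shiftZ k y n) n‖ ≤ ‖shiftZ k y‖ := fun n =>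
    lp.norm_apply_le_norm (by norm_num) _ _
  rw [powSum, ← (hasSum_powSum hb hw).summable.sum_add_tsum_nat_add k, Finset.sum_eq_zero, zero_add,
    powSum, ← tsum_mul_left]
  · congr 1; ext n
    simp [pow_add]; ring
  · intro i hi
    rw [shiftZ_apply, hy _ (by simp at hi; omega), zero_mul]

theorem inner_szego_self {w : ℂ} (hw : ‖w‖ < 1) :
    inner ℂ (szego w hw) (szego w hw) = (1 - (‖w‖ : ℂ) ^ 2)⁻¹ := by
  have h1 : ‖(starRingEnd ℂ) w * w‖ < 1 := by
    rw [norm_mul, RCLike.norm_conj]; nlinarith [norm_nonneg w]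
  rw [inner_szego, powSum, ← Complex.conj_mul', ← tsum_geometric_of_norm_lt_one h1]
  congr 1; ext n
  rw [mul_pow]
  rfl

/-- The unit vector at index `0`. -/
def deltaZ : L2Z := lp.single 2 (0 : ℤ) (1 : ℂ)

theorem deltaZ_apply (n : ℤ) : deltaZ n = if n = 0 then 1 else 0 := by
  simp [deltaZ, lp.single_apply, Pi.single_apply]

theorem inner_shiftZ_deltaZ (n : ℤ) (x : L2Z) : inner ℂ (shiftZ n deltaZ) x = x n := by
  rw [inner_L2Z, tsum_eq_single n]
  · simp [deltaZ_apply]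
  · intro b hb; simp [deltaZ_apply, sub_eq_zero, hb]

/-- Convolution of an absolutely summable bilateral sequence with a square-summable one. -/
def convL2 (a : ℤ → ℂ) (x : L2Z) : L2Z := ∑' k, a k • shiftZ k x

theorem summable_convL2 {a : ℤ → ℂ} (ha : Summable (fun n => ‖a n‖)) (x : L2Z) :
    Summable (fun k => a k • shiftZ k x) := by
  refine Summable.of_norm ?_
  simpa [norm_smul] using ha.mul_right ‖x‖

theorem norm_convL2_le {a : ℤ → ℂ} (ha : Summable (fun n => ‖a n‖)) (x : L2Z) :
    ‖convL2 a x‖ ≤ (∑' n, ‖a n‖) * ‖x‖ := by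
  refine tsum_of_norm_bounded (ha.hasSum.mul_right ‖x‖) fun k => ?_
  simp [norm_smul]

theorem map_convL2 {a : ℤ → ℂ} (ha : Summable (fun n => ‖a n‖)) (x : L2Z) (L : L2Z →L[ℂ] L2Z)
    (hL : ∀ k x, L (shiftZ k x) = shiftZ k (L x)) : L (convL2 a x) = convL2 a (L x) := by
  rw [convL2, L.map_tsum (summable_convL2 ha x), convL2]
  simp [hL]

theorem convL2_apply {a : ℤ → ℂ} (ha : Summable (fun n => ‖a n‖)) (x : L2Z) (n : ℤ) :
    convL2 a x n = ∑' k, a k * x (n - k) := by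
  rw [← inner_shiftZ_deltaZ]
  change innerSL ℂ (E := L2Z) _ _ = _
  rw [convL2, (innerSL ℂ _).map_tsum (summable_convL2 ha x)]
  simp only [innerSL_apply_apply, inner_smul_right, inner_shiftZ_deltaZ, shiftZ_apply]

theorem convL2_comm {a b : ℤ → ℂ} (ha : Summable (fun n => ‖a n‖))
    (hb : Summable (fun n => ‖b n‖)) (x y : L2Z) (hx : (x : ℤ → ℂ) = a) (hy : (y : ℤ → ℂ) = b) :
    convL2 a y = convL2 b x := by
  ext n
  rw [convL2_apply ha, convL2_apply hb, hx, hy, ← (Equiv.subLeft n).tsum_eq]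
  simp [mul_comm]

theorem convL2_deltaZ (x : L2Z) (hx : Summable (fun n => ‖x n‖)) : convL2 x deltaZ = x := by
  ext n
  rw [convL2_apply hx, tsum_eq_single n]
  · simp [deltaZ_apply]
  · intro b hb; simp [deltaZ_apply, sub_eq_zero, hb.symm]

theorem inner_szego_convL2 {w : ℂ} (hw : ‖w‖ < 1) {a : ℕ → ℂ} (ha : Summable (fun n => ‖a n‖))
    {x : L2Z} (hx : ∀ n < 0, x n = 0) :
    inner ℂ (szego w hw) (convL2 (extZ a) x) = powSum a w * powSum (fun n => x n) w := by
  change innerSL ℂ (E := L2Z) _ _ = _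
  rw [convL2, (innerSL ℂ _).map_tsum (summable_convL2 (summable_extZ ha) x), tsum_int_eq_tsum_nat,
    powSum, ← tsum_mul_right]
  · congr 1; ext n
    rw [innerSL_apply_apply, inner_smul_right, extZ_natCast, inner_szego, powSum_shiftZ hw hx]; ring
  · intro n hn
    rw [extZ_of_notMem_range _ _ (by rintro ⟨k, rfl⟩; omega)]; simp

section Wandering

variable {K : Set (ℕ → ℂ)} {hK : IsShiftIdeal K} {S : L2Z}

theorem IsWandering.inner_shiftZ (hS : IsWandering hK S) (n : ℤ) :
    inner ℂ S (shiftZ n S) = if n = 0 then 1 else 0 := by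
  rcases lt_trichotomy n 0 with h | h | h
  · rw [← inner_conj_symm, show S = shiftZ 0 S from (shiftZ_zero S).symm, shiftZ_shiftZ,
      inner_shiftZ_shiftZ, if_neg h.ne]
    have := hS.orth S hS.mem (n.natAbs) (by omega)
    rw [show 0 - (n + 0) = (n.natAbs : ℤ) by omega, this, map_zero]
  · subst h; simp [shiftZ_zero, inner_self_eq_norm_sq_to_K, hS.norm_eq]
  · have := hS.orth S hS.mem n.natAbs (by omega)
    rw [show ((n.natAbs : ℕ) : ℤ) = n by omega] at this
    rw [this, if_neg h.ne']

theorem IsWandering.orthonormal (hS : IsWandering hK S) :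
    Orthonormal ℂ (fun j : ℤ => shiftZ j S) := by
  rw [orthonormal_iff_ite]
  intro i j
  rw [inner_shiftZ_shiftZ, hS.inner_shiftZ]
  simp [sub_eq_zero, eq_comm]

/-- The isometry sending the canonical basis to the translates of the wandering vector. -/
def IsWandering.V (hS : IsWandering hK S) : L2Z →ₗᵢ[ℂ] L2Z :=
  hS.orthonormal.orthogonalFamily.linearIsometry

theorem IsWandering.hasSum_V (hS : IsWandering hK S) (x : L2Z) :
    HasSum (fun n => x n • shiftZ n S) (hS.V x) := by
  have := hS.orthonormal.orthogonalFamily.hasSum_linearIsometry x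
  simp only [LinearIsometry.toSpanSingleton_apply] at this
  exact this

/-- The adjoint of the isometry `V`. -/
def IsWandering.T (hS : IsWandering hK S) : L2Z →L[ℂ] L2Z :=
  ContinuousLinearMap.adjoint hS.V.toContinuousLinearMap

theorem IsWandering.V_eq_convL2 (hS : IsWandering hK S) (x : L2Z) : hS.V x = convL2 x S :=
  (hS.hasSum_V x).tsum_eq.symm

theorem IsWandering.V_shiftZ_deltaZ (hS : IsWandering hK S) (n : ℤ) :
    hS.V (shiftZ n deltaZ) = shiftZ n S := by
  rw [hS.V_eq_convL2, convL2, tsum_eq_single n]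
  · simp [deltaZ_apply]
  · intro b hb; simp [deltaZ_apply, sub_eq_zero, hb]

theorem IsWandering.T_apply (hS : IsWandering hK S) (x : L2Z) (n : ℤ) :
    hS.T x n = inner ℂ (shiftZ n S) x := by
  rw [← inner_shiftZ_deltaZ, IsWandering.T, ContinuousLinearMap.adjoint_inner_right]
  congr 1
  exact hS.V_shiftZ_deltaZ n

theorem IsWandering.norm_T_le (hS : IsWandering hK S) (x : L2Z) : ‖hS.T x‖ ≤ ‖x‖ := by
  refine (hS.T.le_opNorm x).trans ?_
  have : ‖hS.T‖ ≤ 1 := by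
    rw [IsWandering.T, LinearIsometryEquiv.norm_map]
    exact hS.V.norm_toContinuousLinearMap_le
  nlinarith [norm_nonneg x]

theorem IsWandering.T_shiftZ (hS : IsWandering hK S) (k : ℤ) (x : L2Z) :
    hS.T (shiftZ k x) = shiftZ k (hS.T x) := by
  ext n
  rw [hS.T_apply, shiftZ_apply, hS.T_apply,
    show shiftZ n S = shiftZ k (shiftZ (n - k) S) by rw [shiftZ_shiftZ]; congr 2; ring,
    (shiftZ k).inner_map_map]

theorem IsWandering.V_shiftZ (hS : IsWandering hK S) (k : ℤ) (x : L2Z) :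
    hS.V (shiftZ k x) = shiftZ k (hS.V x) := by
  refine (hS.hasSum_V _).unique ?_
  have := (shiftZ k).toContinuousLinearMap.hasSum (hS.hasSum_V x)
  have h2 := (Equiv.subRight k).hasSum_iff.2 this
  convert h2 using 1
  · ext1 n
    simp [shiftZ_shiftZ]
  · rfl

theorem IsWandering.T_self (hS : IsWandering hK S) : hS.T S = deltaZ := by
  ext n
  rw [hS.T_apply, ← inner_conj_symm, hS.inner_shiftZ, deltaZ_apply]
  split_ifs <;> simp

theorem IsWandering.T_apply_neg (hS : IsWandering hK S) {x : L2Z}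
    (hx : x ∈ hK.sub.topologicalClosure) {n : ℤ} (hn : n < 0) : hS.T x n = 0 := by
  have h := hS.orth x hx n.natAbs (by omega)
  rw [hS.T_apply, show x = shiftZ n (shiftZ n.natAbs x) by
    rw [shiftZ_shiftZ, show n + (n.natAbs : ℤ) = 0 by omega, shiftZ_zero], (shiftZ n).inner_map_map]
  exact h

theorem IsWandering.apply_neg (hS : IsWandering hK S) {n : ℤ} (hn : n < 0) : S n = 0 :=
  hK.apply_eq_zero_of_mem_closure (fun a _ => extZ_of_notMem_range _ _ (by rintro ⟨k, rfl⟩; omega))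
    hS.mem

theorem IsWandering.V_T_deltaZ (hS : IsWandering hK S) : hS.V (hS.T deltaZ) = deltaZ := by
  have hδ : ‖deltaZ‖ ^ 2 = 1 := by
    rw [norm_sq_L2Z, tsum_eq_single 0] <;> simp +contextual [deltaZ_apply]
  have hT : ‖hS.T deltaZ‖ ^ 2 = 1 := by
    have h1 : ∀ n, ‖hS.T deltaZ n‖ ^ 2 = ‖S ((Equiv.neg ℤ) n)‖ ^ 2 := by
      intro n
      rw [hS.T_apply, ← inner_conj_symm, show deltaZ = shiftZ 0 deltaZ from (shiftZ_zero _).symm,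
        inner_shiftZ_deltaZ]
      simp
    rw [norm_sq_L2Z, tsum_congr h1, (Equiv.neg ℤ).tsum_eq (fun n => ‖S n‖ ^ 2), ← norm_sq_L2Z,
      hS.norm_eq, one_pow]
  rw [← sub_eq_zero, ← norm_eq_zero, ← sq_eq_zero_iff, @norm_sub_sq ℂ, hS.V.norm_map, hT, hδ]
  have : inner ℂ (hS.V (hS.T deltaZ)) deltaZ = inner ℂ (hS.T deltaZ) (hS.T deltaZ) := by
    nth_rw 3 [IsWandering.T]
    rw [ContinuousLinearMap.adjoint_inner_right]
    rfl
  rw [this, inner_self_eq_norm_sq, hT]; norm_num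

theorem IsWandering.V_T (hS : IsWandering hK S) (x : L2Z) (hx : Summable (fun n => ‖x n‖)) :
    hS.V (hS.T x) = x := by
  conv_lhs => rw [← convL2_deltaZ x hx, map_convL2 hx _ _ hS.T_shiftZ]
  have := map_convL2 hx (hS.T deltaZ) hS.V.toContinuousLinearMap hS.V_shiftZ
  simp only [LinearIsometry.coe_toContinuousLinearMap] at this
  rw [this, hS.V_T_deltaZ, convL2_deltaZ x hx]

theorem IsWandering.inner_szego_V (hS : IsWandering hK S) {w : ℂ} (hw : ‖w‖ < 1) {x : L2Z}
    (hx : ∀ n < 0, x n = 0) : inner ℂ (szego w hw) (hS.V x) =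
      powSum (fun n => x n) w * powSum (fun n => S n) w := by
  change innerSL ℂ (E := L2Z) _ _ = _
  rw [← ((innerSL ℂ (szego w hw)).hasSum (hS.hasSum_V x)).tsum_eq, tsum_int_eq_tsum_nat,
    powSum, ← tsum_mul_right]
  · congr 1; ext n
    simp only
    rw [innerSL_apply_apply, inner_smul_right, inner_szego, powSum_shiftZ hw (fun n => hS.apply_neg)]
    ring
  · intro n hn
    simp [hx n hn]

theorem szego_apply_neg {w : ℂ} (hw : ‖w‖ < 1) {n : ℤ} (hn : n < 0) : szego w hw n = 0 :=
  extZ_of_notMem_range _ _ (by rintro ⟨k, rfl⟩; omega)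

theorem le_of_szego {w : ℂ} (hw : ‖w‖ < 1) {x : L2Z} {u : ℂ} {C : ℝ}
    (h1 : inner ℂ (szego w hw) x = powSum (fun n : ℕ => szego w hw n) w * u)
    (h2 : ‖x‖ ≤ C * ‖szego w hw‖) : ‖u‖ ≤ C := by
  rw [← inner_szego hw] at h1
  have hpos : 0 < ‖szego w hw‖ ^ 2 := by
    have := inner_szego_self hw
    rw [inner_self_eq_norm_sq_to_K] at this
    have h3 : (1 - (‖w‖ : ℂ) ^ 2) ≠ 0 := by
      norm_cast
      have : ‖w‖ ^ 2 < 1 := by nlinarith [norm_nonneg w]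
      linarith
    have h4 : ‖szego w hw‖ ≠ 0 := by
      intro h; rw [h] at this
      simp at this
      exact h3 this.symm
    positivity
  have h3 := norm_inner_le_norm (𝕜 := ℂ) (szego w hw) x
  rw [h1, norm_mul, inner_self_eq_norm_sq_to_K] at h3
  simp only [norm_pow, RCLike.norm_ofReal, abs_norm] at h3
  have h4 : ‖szego w hw‖ * ‖x‖ ≤ ‖szego w hw‖ ^ 2 * C := by nlinarith [norm_nonneg (szego w hw)]
  exact le_of_mul_le_mul_left (h3.trans h4) hpos

theorem IsWandering.norm_powSum_le_one (hS : IsWandering hK S) {w : ℂ} (hw : ‖w‖ < 1) :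
    ‖powSum (fun n => S n) w‖ ≤ 1 :=
  le_of_szego hw (hS.inner_szego_V hw fun _ => szego_apply_neg hw) (by simp)

theorem IsWandering.exists_quotient (hS : IsWandering hK S) {h : ℕ → ℂ} (hh : h ∈ K) {w : ℂ}
    (hw : ‖w‖ < 1) :
    powSum h w = powSum (fun n => S n) w *
      powSum (fun n => hS.T (toL2Z h (hK.summable h hh)) n) w ∧
    ‖powSum (fun n => hS.T (toL2Z h (hK.summable h hh)) n) w‖ ≤ ∑' n, ‖h n‖ := by
  set x := toL2Z h (hK.summable h hh)
  have hxs : Summable (fun n => ‖x n‖) := summable_extZ (hK.summable h hh)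
  have hxm : x ∈ hK.sub.topologicalClosure :=
    Submodule.le_topologicalClosure _ (hK.toL2Z_mem hh)
  have hneg := fun n hn => hS.T_apply_neg hxm (n := n) hn
  constructor
  · have h1 := hS.inner_szego_V hw hneg
    rw [hS.V_T x hxs, inner_szego] at h1
    rw [mul_comm, ← h1]; congr 1
  · have hv : Summable (fun n => ‖szego w hw n‖) :=
      summable_extZ (a := fun n => (starRingEnd ℂ) w ^ n)
        (by simpa using summable_geometric_of_lt_one (norm_nonneg w) hw)
    have h1 : inner ℂ (szego w hw) (convL2 (szego w hw) (hS.T x)) = _ :=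
      inner_szego_convL2 hw (a := fun n => (starRingEnd ℂ) w ^ n)
        (by simpa using summable_geometric_of_lt_one (norm_nonneg w) hw) hneg
    refine le_of_szego hw h1 ?_
    rw [← map_convL2 hv _ _ hS.T_shiftZ, convL2_comm hv hxs _ _ rfl rfl]
    refine (hS.norm_T_le _).trans ((norm_convL2_le hxs _).trans ?_)
    gcongr
    have : ∑' n, ‖x n‖ = ∑' n : ℕ, ‖h n‖ := by
      rw [show (fun n => ‖x n‖) = fun n => ‖extZ h n‖ from rfl]
      refine (Function.Injective.tsum_eq (f := fun n : ℤ => ‖extZ h n‖)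
        Nat.cast_injective ?_).symm.trans ?_
      · intro n hn
        by_contra h2
        exact hn (by simp only [extZ_of_notMem_range _ _ h2, norm_zero])
      · simp
    exact this.le

theorem IsWandering.exists_approx (hS : IsWandering hK S) {ε : ℝ} (hε : 0 < ε) :
    ∃ h, ∃ hh : h ∈ K, ‖hS.T (toL2Z h (hK.summable h hh)) - deltaZ‖ < ε := by
  obtain ⟨y, ⟨h, hh, hy⟩, hd⟩ := Metric.mem_closure_iff.1 hS.mem ε hε
  refine ⟨h, hh, ?_⟩
  have : y = toL2Z h (hK.summable h hh) := by ext n; rw [hy]; rfl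
  rw [← hS.T_self, ← map_sub]
  refine (hS.norm_T_le _).trans_lt ?_
  rw [← this, ← dist_eq_norm, dist_comm]; exact hd

end Wandering

/-- The greatest inner divisor of a shift-invariant set of absolutely summable sequences. -/
theorem IsShiftIdeal.exists_inner {K : Set (ℕ → ℂ)} (hK : IsShiftIdeal K) : ∃ S : ℕ → ℂ,
    HasSum (fun n => ‖S n‖ ^ 2) 1 ∧ (∀ w : ℂ, ‖w‖ < 1 → ‖powSum S w‖ ≤ 1) ∧
    (∀ h ∈ K, ∃ c : ℕ → ℂ, Summable (fun n => ‖c n‖ ^ 2) ∧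
      ∀ w : ℂ, ‖w‖ < 1 → powSum h w = powSum S w * powSum c w ∧ ‖powSum c w‖ ≤ ∑' n, ‖h n‖) ∧
    ∀ ε > 0, ∃ h ∈ K, ∃ c : ℕ → ℂ, Summable (fun n => ‖c n‖ ^ 2) ∧
      (∀ w : ℂ, ‖w‖ < 1 → powSum h w = powSum S w * powSum c w ∧ ‖powSum c w‖ ≤ ∑' n, ‖h n‖) ∧
      ‖c 0 - 1‖ ^ 2 + ∑' n, ‖c (n + 1)‖ ^ 2 < ε := by
  obtain ⟨S, hS⟩ := hK.exists_wandering
  have hnat : ∀ x : L2Z, (∀ n < 0, x n = 0) → HasSum (fun n : ℕ => ‖x n‖ ^ 2) (‖x‖ ^ 2) := by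
    intro x hx
    have h1 := (summable_sq_L2Z x).hasSum
    rw [← norm_sq_L2Z] at h1
    refine (Function.Injective.hasSum_iff Nat.cast_injective (f := fun n : ℤ => ‖x n‖ ^ 2) ?_).2 h1
    intro n hn
    rw [hx n (by by_contra h; exact hn ⟨n.toNat, by simp; omega⟩)]; simp
  have hx0 : ∀ h (hh : h ∈ K), ∀ n < 0, hS.T (toL2Z h (hK.summable h hh)) n = 0 := fun h hh n hn =>
    hS.T_apply_neg (Submodule.le_topologicalClosure _ (hK.toL2Z_mem hh)) hn
  refine ⟨fun n => S n, ?_, fun w hw => hS.norm_powSum_le_one hw, fun h hh => ?_, fun ε hε => ?_⟩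
  · simpa [hS.norm_eq] using hnat S fun n hn => hS.apply_neg hn
  · exact ⟨_, (hnat _ (hx0 h hh)).summable, fun w hw => hS.exists_quotient hh hw⟩
  · obtain ⟨h, hh, hlt⟩ := hS.exists_approx (Real.sqrt_pos.2 hε)
    refine ⟨h, hh, _, (hnat _ (hx0 h hh)).summable, fun w hw => hS.exists_quotient hh hw, ?_⟩
    have h1 := hnat (hS.T (toL2Z h (hK.summable h hh)) - deltaZ) (fun n hn => by
      rw [lp.coeFn_sub, Pi.sub_apply, hx0 h hh n hn, deltaZ_apply, if_neg hn.ne, sub_zero])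
    rw [Real.lt_sqrt (norm_nonneg _)] at hlt
    rw [← h1.tsum_eq, h1.summable.tsum_eq_zero_add] at hlt
    refine lt_of_eq_of_lt ?_ hlt
    have h2 : ∀ n : ℕ, ((n : ℤ) + 1) ≠ 0 := fun n => by omega
    simp [deltaZ_apply, h2]

theorem norm_le_near_one {Y : ℂ → ℂ} (hY : DiffContOnCl ℂ Y (ball 0 1)) {M η ρ : ℝ} (hη : 0 < η)
    (hρ : 0 < ρ) (hM : ∀ z ∈ closedBall (0 : ℂ) 1, ‖Y z‖ ≤ M * ‖z - 1‖)
    (hs : ∀ z ∈ sphere (0 : ℂ) 1, ‖z - 1‖ < ρ → ‖Y z‖ ≤ η * ‖z - 1‖) :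
    ∃ r > 0, ∀ z ∈ ball (0 : ℂ) 1, ‖z - 1‖ < r → ‖Y z‖ ≤ 2 * η * ‖z - 1‖ := by
  have hM0 : 0 ≤ M := by
    have := (norm_nonneg _).trans (hM 0 (by simp))
    simpa using this
  obtain ⟨A, hA0, hA⟩ : ∃ A : ℝ, 0 < A ∧ M * Real.exp (-(A * ρ ^ 2 / 2)) ≤ η := by
    have h1 : Tendsto (fun A : ℝ => M * Real.exp (-(A * (ρ ^ 2 / 2)))) atTop (nhds (M * 0)) :=
      (Real.tendsto_exp_neg_atTop_nhds_zero.comp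
        (tendsto_id.atTop_mul_const (by positivity))).const_mul M
    rw [mul_zero] at h1
    obtain ⟨A, hA, hA0⟩ := ((h1.eventually_le_const hη).and (eventually_gt_atTop 0)).exists
    exact ⟨A, hA0, by rwa [mul_div_assoc]⟩
  set H : ℂ → ℂ := fun z => Y z / (z - 1) * Complex.exp (A * (z - 1)) with hH
  have hcl : closure (ball (0 : ℂ) 1) = closedBall 0 1 := closure_ball _ one_ne_zero
  have hre : ∀ z ∈ closedBall (0 : ℂ) 1, z.re - 1 ≤ 0 := fun z hz => by
    have := (Complex.re_le_norm z).trans (mem_closedBall_zero_iff.1 hz)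
    linarith
  have hnH : ∀ z, ‖H z‖ = ‖Y z‖ / ‖z - 1‖ * Real.exp (A * (z.re - 1)) := fun z => by
    rw [hH]; simp [Complex.norm_exp]
  have hHM : ∀ z ∈ closedBall (0 : ℂ) 1, ‖H z‖ ≤ M := by
    intro z hz
    rw [hnH]
    have h1 : ‖Y z‖ / ‖z - 1‖ ≤ M := div_le_of_le_mul₀ (norm_nonneg _) hM0 (hM z hz)
    have h2 : Real.exp (A * (z.re - 1)) ≤ 1 := by
      rw [Real.exp_le_one_iff]; nlinarith [hre z hz]
    calc _ ≤ M * 1 := mul_le_mul h1 h2 (Real.exp_pos _).le hM0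
      _ = M := mul_one M
  have hHs : ∀ z ∈ sphere (0 : ℂ) 1, ‖H z‖ ≤ η := by
    intro z hz
    rw [hnH]
    have hzc : z ∈ closedBall (0 : ℂ) 1 := sphere_subset_closedBall hz
    by_cases h : ‖z - 1‖ < ρ
    · have h1 : ‖Y z‖ / ‖z - 1‖ ≤ η := div_le_of_le_mul₀ (norm_nonneg _) hη.le (hs z hz h)
      have h2 : Real.exp (A * (z.re - 1)) ≤ 1 := by
        rw [Real.exp_le_one_iff]; nlinarith [hre z hzc]
      calc _ ≤ η * 1 := mul_le_mul h1 h2 (Real.exp_pos _).le hη.le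
        _ = η := mul_one η
    · have h1 : ‖Y z‖ / ‖z - 1‖ ≤ M := div_le_of_le_mul₀ (norm_nonneg _) hM0 (hM z hzc)
      have h3 : ‖z - 1‖ ^ 2 = 2 * (1 - z.re) := by
        have h4 : ‖z‖ ^ 2 = 1 := by rw [mem_sphere_zero_iff_norm.1 hz]; norm_num
        rw [← Complex.normSq_eq_norm_sq, Complex.normSq_apply] at h4 ⊢
        simp; nlinarith
      have h2 : Real.exp (A * (z.re - 1)) ≤ Real.exp (-(A * ρ ^ 2 / 2)) := by
        rw [Real.exp_le_exp]
        have : ρ ^ 2 ≤ ‖z - 1‖ ^ 2 := by nlinarith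
        nlinarith
      calc _ ≤ M * Real.exp (-(A * ρ ^ 2 / 2)) := mul_le_mul h1 h2 (Real.exp_pos _).le hM0
        _ ≤ η := hA
  have hball1 : ∀ z ∈ ball (0 : ℂ) 1, z - 1 ≠ 0 := fun z hz h => by
    rw [sub_eq_zero] at h; simp [h] at hz
  have hk : ∀ k : ℕ, ∀ z ∈ ball (0 : ℂ) 1, ‖H z ^ k * (z - 1)‖ ≤ 2 * η ^ k := by
    intro k z hz
    refine Complex.norm_le_of_forall_mem_frontier_norm_le (f := fun z => H z ^ k * (z - 1))
      isBounded_ball ⟨?_, ?_⟩ ?_ (subset_closure hz)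
    · refine DifferentiableOn.mul (DifferentiableOn.pow ?_ k) (by fun_prop)
      exact (hY.1.div (by fun_prop) hball1).mul (by fun_prop)
    · rw [hcl]
      intro x hx
      by_cases h1 : x = 1
      · subst h1
        rw [ContinuousWithinAt, sub_self, mul_zero]
        refine squeeze_zero_norm' (a := fun z => M ^ k * ‖z - 1‖) ?_ ?_
        · filter_upwards [self_mem_nhdsWithin] with y hy
          rw [norm_mul, norm_pow]
          gcongr
          exact hHM y hy
        · have : ContinuousAt (fun z : ℂ => M ^ k * ‖z - 1‖) 1 := by fun_prop
          simpa using this.tendsto.mono_left nhdsWithin_le_nhds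
      · have hc : ContinuousWithinAt Y (closedBall 0 1) x := by
          rw [← hcl]; exact hY.2 x (hcl ▸ hx)
        have hd1 : ContinuousWithinAt (fun z : ℂ => z - 1) (closedBall 0 1) x :=
          (continuous_sub_right 1).continuousWithinAt
        have he : ContinuousWithinAt (fun z : ℂ => Complex.exp (A * (z - 1))) (closedBall 0 1) x :=
          (Continuous.continuousWithinAt (by fun_prop))
        have hHc : ContinuousWithinAt H (closedBall 0 1) x :=
          (hc.div hd1 (sub_ne_zero.2 h1)).mul he
        exact (hHc.pow k).mul hd1
    · rw [frontier_ball _ one_ne_zero]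
      intro x hx
      rw [norm_mul, norm_pow]
      have h2 : ‖x - 1‖ ≤ 2 := (norm_sub_le _ _).trans (by
        rw [mem_sphere_zero_iff_norm.1 hx]; norm_num)
      rw [mul_comm 2]
      gcongr
      exact hHs x hx
  have hHb : ∀ z ∈ ball (0 : ℂ) 1, ‖H z‖ ≤ η := by
    intro z hz
    by_contra! hlt
    have h1 : 1 < ‖H z‖ / η := (one_lt_div hη).2 hlt
    have hz1 : 0 < ‖z - 1‖ := norm_pos_iff.2 (hball1 z hz)
    obtain ⟨k, hk1⟩ := (((tendsto_pow_atTop_atTop_of_one_lt h1).eventually_gt_atTop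
      (2 / ‖z - 1‖)).exists)
    have := hk k z hz
    rw [norm_mul, norm_pow] at this
    rw [div_pow, div_lt_div_iff₀ hz1 (by positivity)] at hk1
    linarith
  refine ⟨Real.log 2 / A, div_pos (Real.log_pos (by norm_num)) hA0, fun z hz hr => ?_⟩
  have hz1 : 0 < ‖z - 1‖ := norm_pos_iff.2 (hball1 z hz)
  have h1 := hHb z hz
  rw [hnH, div_mul_eq_mul_div, div_le_iff₀ hz1] at h1
  have h2 : (1 / 2 : ℝ) ≤ Real.exp (A * (z.re - 1)) := by
    rw [show (1 / 2 : ℝ) = Real.exp (-Real.log 2) by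
      rw [Real.exp_neg, Real.exp_log (by norm_num)]; norm_num, Real.exp_le_exp]
    have h3 : 1 - z.re ≤ ‖z - 1‖ := by
      have := Complex.abs_re_le_norm (z - 1)
      simp at this
      have := neg_abs_le (z.re - 1)
      linarith
    rw [lt_div_iff₀ hA0] at hr
    nlinarith
  nlinarith [norm_nonneg (Y z)]

theorem tendsto_deriv_of_hasDerivAt {V : ℂ → ℂ} (hV : DiffContOnCl ℂ V (ball 0 1)) {M : ℝ}
    (hM : ∀ z ∈ closedBall (0 : ℂ) 1, ‖V z - V 1‖ ≤ M * ‖z - 1‖) {c : ℂ}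
    (hc : HasDerivAt (fun t : ℝ => V (Complex.exp (t * I))) (I * c) 0) :
    Tendsto (fun r : ℝ => deriv V r) (nhdsWithin 1 (Set.Iio 1)) (nhds c) := by
  set Y : ℂ → ℂ := fun z => V z - V 1 - c * (z - 1) with hYdef
  have hY : DiffContOnCl ℂ Y (ball 0 1) := by
    refine (hV.sub diffContOnCl_const).sub (Differentiable.diffContOnCl ?_)
    fun_prop
  have hYM : ∀ z ∈ closedBall (0 : ℂ) 1, ‖Y z‖ ≤ (M + ‖c‖) * ‖z - 1‖ := by
    intro z hz
    refine (norm_sub_le _ _).trans ?_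
    rw [norm_mul, add_mul]
    exact add_le_add_left (hM z hz) _
  have hYd : HasDerivAt (fun t : ℝ => Y (Complex.exp (t * I))) 0 0 := by
    have h1 : HasDerivAt (fun t : ℝ => Complex.exp (t * I)) I 0 := by
      have := ((hasDerivAt_id (0 : ℝ)).ofReal_comp.mul_const I).cexp
      simpa using this
    have h2 := (hc.sub_const (V 1)).sub ((h1.sub_const 1).const_mul c)
    rw [mul_comm I c, sub_self] at h2
    exact h2
  rw [Metric.tendsto_nhdsWithin_nhds]
  intro ε hε
  set η := ε / 8 with hη
  have hη0 : 0 < η := by positivity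
  have h1 := hYd.isLittleO.def (c := η / (Real.pi / 2)) (by positivity)
  simp only [Complex.ofReal_zero, zero_mul, Complex.exp_zero, sub_zero, smul_zero] at h1
  have hY1 : Y 1 = 0 := by simp [hYdef]
  rw [hY1] at h1
  obtain ⟨δ, hδ, h2⟩ := Metric.eventually_nhds_iff.1 h1
  obtain ⟨r, hr, h3⟩ := norm_le_near_one hY (ρ := δ / (Real.pi / 2)) hη0 (by positivity) hYM (by
    intro z hz hzr
    have h4 := Complex.angle_le_mul_norm_sub (x := z) (y := 1) (mem_sphere_zero_iff_norm.1 hz) (by simp)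
    rw [Complex.angle_one_right (by rintro rfl; simp at hz)] at h4
    have h5 := h2 (y := z.arg) (by
      rw [lt_div_iff₀ (by positivity)] at hzr
      rw [Real.dist_eq, sub_zero]; linarith)
    rw [sub_zero] at h5
    have h6 : Complex.exp (z.arg * I) = z := by
      have := Complex.norm_mul_exp_arg_mul_I z
      rwa [mem_sphere_zero_iff_norm.1 hz, Complex.ofReal_one, one_mul] at this
    rw [h6, Real.norm_eq_abs, div_mul_eq_mul_div, le_div_iff₀ (by positivity)] at h5
    have hpi := Real.pi_pos
    have : ‖Y z‖ * (Real.pi / 2) ≤ (η * ‖z - 1‖) * (Real.pi / 2) := by nlinarith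
    exact le_of_mul_le_mul_right this (by positivity))
  refine ⟨min (r / 2) 1, by positivity, fun x hx hd => ?_⟩
  rw [Real.dist_eq, lt_min_iff, abs_lt, abs_lt] at hd
  have hx1 : x < 1 := hx
  set d := (1 - x) / 2 with hd2
  have hd0 : 0 < d := by simp only [hd2]; linarith
  have hsub : closedBall (x : ℂ) d ⊆ ball 0 1 := by
    intro z hz
    rw [mem_closedBall, dist_eq_norm] at hz
    rw [mem_ball_zero_iff]
    calc ‖z‖ = ‖(z - x) + x‖ := by rw [sub_add_cancel]
      _ ≤ ‖z - x‖ + ‖(x : ℂ)‖ := norm_add_le _ _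
      _ < 1 := by
        rw [Complex.norm_real, Real.norm_eq_abs, abs_of_pos (by linarith)]
        linarith
  have hxb : (x : ℂ) ∈ ball (0 : ℂ) 1 := hsub (mem_closedBall_self hd0.le)
  have h7 : ‖deriv Y x‖ ≤ (6 * η * d) / d := by
    refine Complex.norm_deriv_le_of_forall_mem_sphere_norm_le hd0 ?_ ?_
    · refine (hY.1.mono ?_).diffContOnCl
      rw [closure_ball _ hd0.ne']; exact hsub
    · intro z hz
      have h8 : ‖z - 1‖ ≤ 3 * d := by
        calc ‖z - 1‖ = ‖(z - x) + ((x - 1 : ℝ) : ℂ)‖ := by push_cast; congr 1; ring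
          _ ≤ d + |x - 1| := by
            refine (norm_add_le _ _).trans ?_
            rw [Complex.norm_real, ← dist_eq_norm, mem_sphere.1 hz, Real.norm_eq_abs]
          _ = 3 * d := by rw [abs_of_neg (by linarith)]; ring
      have := h3 z (hsub (sphere_subset_closedBall hz)) (by linarith)
      nlinarith
  have h9 : deriv Y x = deriv V x - c := by
    have hVd : DifferentiableAt ℂ V x := hV.1.differentiableAt (isOpen_ball.mem_nhds hxb)
    have := (hVd.hasDerivAt.sub_const (V 1)).sub (((hasDerivAt_id (x : ℂ)).sub_const 1).const_mul c)
    rw [mul_one] at this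
    exact this.deriv
  rw [h9, mul_div_assoc, div_self hd0.ne', ← dist_eq_norm] at h7
  linarith

theorem continuousOn_powSum {a : ℕ → ℂ} (ha : Summable (fun n => ‖a n‖)) :
    ContinuousOn (powSum a) (closedBall 0 1) := by
  refine continuousOn_tsum (fun n => by fun_prop) ha fun n x hx => ?_
  rw [norm_mul, norm_pow]
  exact mul_le_of_le_one_right (norm_nonneg _)
    (pow_le_one₀ (norm_nonneg _) (mem_closedBall_zero_iff.1 hx))

theorem continuous_powSum_exp {a : ℕ → ℂ} (ha : Summable (fun n => ‖a n‖)) :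
    Continuous (fun θ : ℝ => powSum a (Complex.exp (θ * I))) := by
  refine (continuousOn_powSum ha).comp_continuous (by fun_prop) fun θ => ?_
  simp [Complex.norm_exp_ofReal_mul_I]

theorem integral_norm_sq_powSum {b : ℕ → ℂ} (hb : Summable (fun n => ‖b n‖)) :
    ∫ θ in (0:ℝ)..(2 * Real.pi), ‖powSum b (Complex.exp (θ * I))‖ ^ 2 =
      2 * Real.pi * ∑' n, ‖b n‖ ^ 2 := by
  have hfc : ∀ n : ℕ, fcoeff (powSum b) n = b n := fun n => by
    rw [fcoeff_of_mem_APlus (powSum_mem_APlus hb), taylorCoeff_powSum hb, extZ_natCast]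
  set B := ∑' n, ‖b n‖
  let F : ℕ → C(ℝ, ℂ) := fun n => ⟨fun θ => (starRingEnd ℂ) (b n) *
    (powSum b (Complex.exp (θ * I)) * Complex.exp (-((n : ℤ) : ℂ) * (θ : ℂ) * I)), by
      have := continuous_powSum_exp hb
      fun_prop⟩
  have he : ∀ (n : ℕ) (θ : ℝ), Complex.exp (-((n : ℤ) : ℂ) * (θ : ℂ) * I) =
      (starRingEnd ℂ) (Complex.exp (θ * I) ^ n) := fun n θ => by
    rw [← Complex.exp_nat_mul, ← Complex.exp_conj]
    simp only [map_mul, Complex.conj_I, Complex.conj_ofReal, map_natCast]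
    congr 1; push_cast; ring
  have hFb : ∀ n (θ : ℝ), ‖F n θ‖ ≤ ‖b n‖ * B := fun n θ => by
    change ‖(starRingEnd ℂ) (b n) * _‖ ≤ _
    rw [he, norm_mul, norm_mul, RCLike.norm_conj, RCLike.norm_conj, norm_pow,
      Complex.norm_exp_ofReal_mul_I, one_pow, mul_one]
    gcongr
    exact norm_powSum_le hb (by rw [Complex.norm_exp_ofReal_mul_I])
  have h := intervalIntegral.hasSum_intervalIntegral_of_summable_norm (a := 0) (b := 2 * Real.pi)
    (f := F) (by
    refine Summable.of_nonneg_of_le (fun _ => norm_nonneg _) (fun k => ?_) (hb.mul_right B)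
    refine (ContinuousMap.norm_le _ (by positivity)).2 fun x => ?_
    exact hFb k x)
  have h2 : ∀ n, ∫ θ in (0:ℝ)..(2 * Real.pi), F n θ = ((2 * Real.pi * ‖b n‖ ^ 2 : ℝ) : ℂ) := by
    intro n
    have h3 := hfc n
    rw [fcoeff] at h3
    change ∫ θ in (0:ℝ)..(2 * Real.pi), (starRingEnd ℂ) (b n) * (powSum b (Complex.exp (θ * I)) *
      Complex.exp (-((n : ℤ) : ℂ) * (θ : ℂ) * I)) = _
    rw [intervalIntegral.integral_const_mul]
    have hpi : (Real.pi : ℂ) ≠ 0 := by exact_mod_cast Real.pi_ne_zero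
    rw [one_div, inv_mul_eq_iff_eq_mul₀ (by simp [hpi])] at h3
    rw [h3]
    push_cast
    rw [← Complex.conj_mul']; ring
  have h4 : ∀ θ : ℝ, ∑' n, F n θ = ((‖powSum b (Complex.exp (θ * I))‖ ^ 2 : ℝ) : ℂ) := by
    intro θ
    change ∑' n, (starRingEnd ℂ) (b n) * (powSum b (Complex.exp (θ * I)) *
      Complex.exp (-((n : ℤ) : ℂ) * (θ : ℂ) * I)) = _
    simp_rw [he]
    have h5 : (starRingEnd ℂ) (powSum b (Complex.exp (θ * I))) =
        ∑' n, (starRingEnd ℂ) (b n * (Complex.exp (θ * I)) ^ n) := by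
      rw [powSum, Complex.conj_tsum]
    push_cast
    rw [← Complex.conj_mul', h5, ← tsum_mul_right]
    congr 1; ext n; rw [map_mul]; ring
  simp_rw [h2, h4] at h
  have h5 := h.tsum_eq
  rw [intervalIntegral.integral_ofReal, ← Complex.ofReal_tsum] at h5
  have h6 := Complex.ofReal_injective h5
  rw [← h6, tsum_mul_left]

theorem exists_primitive {S : ℕ → ℂ} (hS : Summable (fun n => ‖S n‖ ^ 2))
    (h1 : ∀ w : ℂ, ‖w‖ < 1 → ‖powSum S w‖ ≤ 1) : ∃ W : ℂ → ℂ,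
      ContinuousOn W (closedBall 0 1) ∧ LipschitzOnWith 1 W (closedBall 0 1) ∧
      ∀ z ∈ ball (0 : ℂ) 1, HasDerivAt W (powSum S z) z := by
  obtain ⟨C, hC⟩ : ∃ C, ∀ n, ‖S n‖ ≤ C := by
    refine ⟨1 + ∑' n, ‖S n‖ ^ 2, fun n => ?_⟩
    have := hS.le_tsum n (fun _ _ => by positivity)
    nlinarith [sq_nonneg (‖S n‖ - 1)]
  have hs : Summable (fun n : ℕ => ‖S n / ((n : ℂ) + 1)‖) := by
    have h2 : Summable (fun n : ℕ => (1 / ((n : ℝ) + 1)) ^ 2) := by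
      have := (summable_nat_add_iff 1).2 (Real.summable_one_div_nat_pow.2 (by norm_num : 1 < 2))
      simpa using this
    refine Summable.of_nonneg_of_le (fun _ => norm_nonneg _) (fun n => ?_) (hS.add h2)
    rw [norm_div, show ((n : ℂ) + 1) = ((n + 1 : ℝ) : ℂ) by push_cast; rfl, Complex.norm_real,
      Real.norm_eq_abs, abs_of_pos (by positivity), div_eq_mul_one_div]
    nlinarith [sq_nonneg (‖S n‖ - 1 / ((n : ℝ) + 1)), sq_nonneg (‖S n‖), sq_nonneg (1 / ((n : ℝ) + 1))]
  set a : ℕ → ℂ := fun n => S n / ((n : ℂ) + 1) with ha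
  have hW : ContinuousOn (fun z => z * powSum a z) (closedBall 0 1) :=
    continuousOn_id.mul (continuousOn_powSum hs)
  have hd : ∀ z ∈ ball (0 : ℂ) 1, HasDerivAt (fun z => z * powSum a z) (powSum S z) z := by
    intro z hz
    obtain ⟨ρ, hρ1, hρ2⟩ := exists_between (mem_ball_zero_iff.1 hz)
    have hρ0 : 0 < ρ := (norm_nonneg z).trans_lt hρ1
    have h3 := hasDerivAt_tsum_of_isPreconnected (𝕜 := ℂ) (u := fun n => C * ρ ^ n)
      (t := ball (0 : ℂ) ρ) (g := fun n z => a n * z ^ (n + 1)) (g' := fun n z => S n * z ^ n)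
      (y₀ := 0) (y := z) ((summable_geometric_of_lt_one hρ0.le hρ2).mul_left C) isOpen_ball
      (convex_ball _ _).isPreconnected (fun n y _ => by
        have := (hasDerivAt_pow (n + 1) y).const_mul (a n)
        refine this.congr_deriv ?_
        have hn : ((n : ℂ) + 1) ≠ 0 := by exact_mod_cast n.succ_ne_zero
        simp only [ha, Nat.add_sub_cancel]
        push_cast
        field_simp) (fun n y hy => by
        rw [norm_mul, norm_pow]
        have := mem_ball_zero_iff.1 hy
        have h0 := (norm_nonneg (S n)).trans (hC n)
        gcongr
        exact hC n) (mem_ball_self hρ0) (by simp) (by simpa using hρ1)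
    have h4 : (fun z => z * powSum a z) = fun z => ∑' n, a n * z ^ (n + 1) := by
      funext y
      rw [powSum, ← tsum_mul_left]
      congr 1; ext n; ring
    rw [h4]; exact h3
  refine ⟨_, hW, ?_, hd⟩
  have hl : LipschitzOnWith 1 (fun z => z * powSum a z) (ball 0 1) :=
    (convex_ball (0 : ℂ) 1).lipschitzOnWith_of_nnnorm_hasDerivWithin_le (𝕜 := ℂ)
      (fun x hx => (hd x hx).hasDerivWithinAt) (fun x hx => h1 x (mem_ball_zero_iff.1 hx))
  rw [← closure_ball (0 : ℂ) one_ne_zero] at hW ⊢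
  exact hl.closure hW

theorem ae_exists_radial_limit {S : ℕ → ℂ} (hS : Summable (fun n => ‖S n‖ ^ 2))
    (h1 : ∀ w : ℂ, ‖w‖ < 1 → ‖powSum S w‖ ≤ 1) : ∀ᵐ θ : ℝ, ∃ c : ℂ,
      Tendsto (fun r : ℝ => powSum S (r * Complex.exp (θ * I))) (nhdsWithin 1 (Set.Iio 1))
        (nhds c) := by
  obtain ⟨W, hWc, hWl, hWd⟩ := exists_primitive hS h1
  have hE : ∀ θ : ℝ, Complex.exp (θ * I) ∈ closedBall (0 : ℂ) 1 := fun θ => by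
    simp [Complex.norm_exp_ofReal_mul_I]
  have hElip : LipschitzWith 1 (fun θ : ℝ => Complex.exp (θ * I)) := by
    refine LipschitzWith.of_dist_le_mul fun x y => ?_
    rw [dist_eq_norm, show Complex.exp (x * I) - Complex.exp (y * I) =
      Complex.exp (y * I) * (Complex.exp (I * ((x - y : ℝ) : ℂ)) - 1) by
        rw [mul_sub, ← Complex.exp_add, mul_one]; congr 2; push_cast; ring, norm_mul,
      Complex.norm_exp_ofReal_mul_I, one_mul, NNReal.coe_one, one_mul, dist_eq_norm]
    exact Real.norm_exp_I_mul_ofReal_sub_one_le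
  have hlip : LipschitzWith 1 (fun θ : ℝ => W (Complex.exp (θ * I))) := by
    have := (hWl.comp (hElip.lipschitzOnWith (s := univ)) (fun θ _ => hE θ))
    rw [lipschitzOnWith_univ, one_mul] at this
    exact this
  filter_upwards [hlip.ae_differentiableAt_real] with θ hθ
  set ζ := Complex.exp (θ * I) with hζ
  have hζ0 : ζ ≠ 0 := Complex.exp_ne_zero _
  have hζ1 : ‖ζ‖ = 1 := Complex.norm_exp_ofReal_mul_I θ
  set d := deriv (fun θ : ℝ => W (Complex.exp (θ * I))) θ
  refine ⟨d * ζ⁻¹ * I⁻¹, ?_⟩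
  set V : ℂ → ℂ := fun z => W (ζ * z) * ζ⁻¹ with hVdef
  have hmap : ∀ z ∈ closedBall (0 : ℂ) 1, ζ * z ∈ closedBall (0 : ℂ) 1 := fun z hz => by
    simpa [hζ1] using hz
  have hmapb : ∀ z ∈ ball (0 : ℂ) 1, ζ * z ∈ ball (0 : ℂ) 1 := fun z hz => by
    simpa [hζ1] using hz
  have hVd : ∀ z ∈ ball (0 : ℂ) 1, HasDerivAt V (powSum S (ζ * z)) z := fun z hz => by
    have := ((hWd _ (hmapb z hz)).comp z ((hasDerivAt_id z).const_mul ζ)).mul_const ζ⁻¹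
    refine this.congr_deriv ?_
    rw [mul_one, mul_assoc, mul_inv_cancel₀ hζ0, mul_one]
  have hV : DiffContOnCl ℂ V (ball 0 1) := by
    refine ⟨fun z hz => (hVd z hz).differentiableAt.differentiableWithinAt, ?_⟩
    rw [closure_ball _ one_ne_zero]
    exact (hWc.comp (by fun_prop) hmap).mul continuousOn_const
  have hVM : ∀ z ∈ closedBall (0 : ℂ) 1, ‖V z - V 1‖ ≤ 1 * ‖z - 1‖ := fun z hz => by
    rw [hVdef]
    simp only
    rw [← sub_mul, norm_mul, norm_inv, hζ1, inv_one, mul_one, ← dist_eq_norm]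
    refine (hWl.dist_le_mul _ (hmap z hz) _ (hmap 1 (by simp))).trans ?_
    rw [dist_eq_norm, ← mul_sub, norm_mul, hζ1]; simp
  have hc : HasDerivAt (fun t : ℝ => V (Complex.exp (t * I))) (I * (d * ζ⁻¹ * I⁻¹)) 0 := by
    have h2 : HasDerivAt (fun t : ℝ => W (Complex.exp ((t + θ : ℝ) * I))) d 0 := by
      have := hθ.hasDerivAt
      refine HasDerivAt.comp_add_const (f := fun θ : ℝ => W (Complex.exp (θ * I))) 0 θ ?_
      rw [zero_add]; exact this
    have h3 := h2.mul_const ζ⁻¹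
    have h4 : (fun t : ℝ => V (Complex.exp (t * I))) =
        fun t : ℝ => W (Complex.exp ((t + θ : ℝ) * I)) * ζ⁻¹ := by
      funext t
      simp only [hVdef, hζ]
      rw [← Complex.exp_add]
      push_cast
      rw [add_mul, add_comm]
    rw [h4]
    refine h3.congr_deriv ?_
    rw [mul_comm I, mul_assoc, inv_mul_cancel₀ I_ne_zero, mul_one]
  refine (tendsto_deriv_of_hasDerivAt hV hVM hc).congr' ?_
  have : Ioo (0 : ℝ) 1 ∈ nhdsWithin (1 : ℝ) (Set.Iio 1) := Ioo_mem_nhdsLT one_pos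
  filter_upwards [this] with r hr
  rw [(hVd r (by simp [abs_of_pos hr.1, hr.2])).deriv, mul_comm]

theorem isInnerFunction_powSum {S : ℕ → ℂ} (hS : HasSum (fun n => ‖S n‖ ^ 2) 1)
    (h1 : ∀ w : ℂ, ‖w‖ < 1 → ‖powSum S w‖ ≤ 1) : IsInnerFunction (powSum S) := by
  have hC : ∀ n, ‖S n‖ ≤ 1 := fun n => by
    have := le_hasSum hS n (fun _ _ => by positivity)
    have h3 := norm_nonneg (S n)
    nlinarith
  refine ⟨differentiableOn_powSum hC, fun z hz => h1 z (mem_ball_zero_iff.1 hz), ?_⟩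
  set μ := volume.restrict (Set.Ioc (0 : ℝ) (2 * Real.pi))
  set r : ℕ → ℝ := fun n => 1 - 1 / ((n : ℝ) + 1) with hr
  have hr0 : ∀ n, 0 ≤ r n := fun n => by
    rw [hr, sub_nonneg, div_le_one (by positivity)]; simp
  have hr1 : ∀ n, r n < 1 := fun n => by
    have : 0 < 1 / ((n : ℝ) + 1) := by positivity
    simp only [hr]; linarith
  have hrt : Tendsto r atTop (nhdsWithin 1 (Set.Iio 1)) := by
    refine tendsto_nhdsWithin_iff.2 ⟨?_, Eventually.of_forall hr1⟩
    simpa [hr] using tendsto_one_div_add_atTop_nhds_zero_nat.const_sub (1 : ℝ)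
  have hrn : Tendsto r atTop (nhds 1) := hrt.mono_right nhdsWithin_le_nhds
  set b : ℕ → ℕ → ℂ := fun n k => S k * (r n : ℂ) ^ k
  have hb : ∀ n, Summable (fun k => ‖b n k‖) := fun n =>
    summable_powSum_norm hC (by simpa [abs_of_nonneg (hr0 n)] using hr1 n)
  have hbp : ∀ n (θ : ℝ), powSum (b n) (Complex.exp (θ * I)) =
      powSum S (r n * Complex.exp (θ * I)) := fun n θ => by
    simp only [powSum, b, mul_pow, mul_assoc]
  have hlt : ∀ n (θ : ℝ), ‖(r n : ℂ) * Complex.exp (θ * I)‖ < 1 := fun n θ => by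
    rw [norm_mul, Complex.norm_exp_ofReal_mul_I, mul_one, Complex.norm_real, Real.norm_eq_abs,
      abs_of_nonneg (hr0 n)]; exact hr1 n
  set F : ℕ → ℝ → ℝ := fun n θ => 1 - ‖powSum S (r n * Complex.exp (θ * I))‖ ^ 2 with hF
  have hFc : ∀ n, Continuous (F n) := fun n => by
    have := continuous_powSum_exp (hb n)
    simp_rw [hbp] at this
    fun_prop
  have hF0 : ∀ n θ, 0 ≤ F n θ := fun n θ => by
    have := h1 _ (hlt n θ)
    simp only [hF]
    nlinarith [norm_nonneg (powSum S (r n * Complex.exp (θ * I)))]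
  have hinteg : ∀ n, ∫⁻ θ, ENNReal.ofReal (F n θ) ∂μ =
      ENNReal.ofReal (2 * Real.pi - 2 * Real.pi * ∑' k, ‖b n k‖ ^ 2) := fun n => by
    rw [← ofReal_integral_eq_lintegral_ofReal ((hFc n).integrableOn_Ioc)
      (Eventually.of_forall (hF0 n)), ← intervalIntegral.integral_of_le (by positivity)]
    congr 1
    rw [hF, intervalIntegral.integral_sub (by simp) (by
      refine Continuous.intervalIntegrable ?_ _ _
      have := continuous_powSum_exp (hb n)
      simp_rw [hbp] at this
      fun_prop), ← integral_norm_sq_powSum (hb n)]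
    simp [hbp]
  have hsum : Tendsto (fun n => ∑' k, ‖b n k‖ ^ 2) atTop (nhds 1) := by
    rw [← hS.tsum_eq]
    refine tendsto_tsum_of_dominated_convergence (bound := fun k => ‖S k‖ ^ 2) hS.summable
      (fun k => ?_) (Eventually.of_forall fun n k => ?_)
    · have h2 : ContinuousAt (fun x : ℝ => ‖S k * (x : ℂ) ^ k‖ ^ 2) 1 := by fun_prop
      simpa [b, Function.comp_def] using h2.tendsto.comp hrn
    · rw [norm_pow, norm_norm]
      gcongr
      rw [norm_mul, norm_pow, Complex.norm_real, Real.norm_eq_abs, abs_of_nonneg (hr0 n)]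
      exact mul_le_of_le_one_right (norm_nonneg _) (pow_le_one₀ (hr0 n) (hr1 n).le)
  have hlim : Tendsto (fun n => ∫⁻ θ, ENNReal.ofReal (F n θ) ∂μ) atTop (nhds 0) := by
    simp_rw [hinteg]
    have := ENNReal.tendsto_ofReal ((hsum.const_mul (2 * Real.pi)).const_sub (2 * Real.pi))
    simpa using this
  have hfat := lintegral_liminf_le (μ := μ) (u := atTop) (f := fun n θ => ENNReal.ofReal (F n θ))
    (fun n => (hFc n).measurable.ennreal_ofReal)
  rw [hlim.liminf_eq, nonpos_iff_eq_zero, lintegral_eq_zero_iff (Measurable.liminf fun n =>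
    (hFc n).measurable.ennreal_ofReal)] at hfat
  filter_upwards [hfat, ae_restrict_of_ae (ae_exists_radial_limit hS.summable h1)] with θ h2 ⟨c, hc⟩
  have h3 : Tendsto (fun n => ENNReal.ofReal (F n θ)) atTop (nhds (ENNReal.ofReal (1 - ‖c‖ ^ 2))) :=
    ENNReal.tendsto_ofReal (((hc.comp hrt).norm.pow 2).const_sub 1)
  have h4 : ENNReal.ofReal (1 - ‖c‖ ^ 2) = 0 := by rw [← h3.liminf_eq]; exact h2
  rw [ENNReal.ofReal_eq_zero] at h4
  have h5 : ‖c‖ ≤ 1 := le_of_tendsto (hc.comp hrt).norm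
    (Eventually.of_forall fun n => h1 _ (hlt n θ))
  have h6 : ‖c‖ = 1 := by nlinarith [norm_nonneg c]
  have h7 := hc.norm
  rwa [h6] at h7

/-! ### Estimates for the Cauchy kernel near the circle -/

theorem re_kernel_denom_ge {R : ℝ} (h1 : 1 ≤ R) (h3 : R ≤ 3) {v : ℂ}
    (hv : ‖v‖ ≤ 1 + ‖v - 1‖ ^ 2 / 100) :
    24 / 25 * (R - 1) - ‖(R : ℂ) - v‖ ^ 2 / 50 ≤ ((R : ℂ) - v).re := by
  have h2 : ‖v - 1‖ ≤ ‖(R : ℂ) - v‖ + (R - 1) := by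
    have : v - 1 = -((R : ℂ) - v) + ((R - 1 : ℝ) : ℂ) := by push_cast; ring
    rw [this]
    refine (norm_add_le _ _).trans ?_
    rw [norm_neg, Complex.norm_real, Real.norm_of_nonneg (by linarith)]
  have h4 : v.re ≤ ‖v‖ := Complex.re_le_norm v
  simp only [Complex.sub_re, Complex.ofReal_re]
  set x := ‖(R : ℂ) - v‖
  have hx : 0 ≤ x := norm_nonneg _
  have h5 : ‖v - 1‖ ^ 2 ≤ (x + (R - 1)) ^ 2 := by gcongr
  nlinarith [sq_nonneg (x - (R - 1))]

theorem kernel_denom_ne_zero {R : ℝ} (h1 : 1 < R) (h3 : R ≤ 3) {v : ℂ}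
    (hv : ‖v‖ ≤ 1 + ‖v - 1‖ ^ 2 / 100) : (R : ℂ) - v ≠ 0 := by
  intro h
  have := re_kernel_denom_ge h1.le h3 hv
  rw [h] at this
  simp at this
  linarith

theorem norm_sub_one_le_kernel_denom {R : ℝ} (h1 : 1 ≤ R) (h3 : R ≤ 3) {v : ℂ}
    (hv : ‖v‖ ≤ 1 + ‖v - 1‖ ^ 2 / 100) (hv2 : ‖v‖ ≤ 2) :
    ‖v - 1‖ ≤ 11 / 5 * ‖(R : ℂ) - v‖ := by
  have h2 : ‖v - 1‖ ≤ ‖(R : ℂ) - v‖ + (R - 1) := by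
    have : v - 1 = -((R : ℂ) - v) + ((R - 1 : ℝ) : ℂ) := by push_cast; ring
    rw [this]
    refine (norm_add_le _ _).trans ?_
    rw [norm_neg, Complex.norm_real, Real.norm_of_nonneg (by linarith)]
  have h4 := re_kernel_denom_ge h1 h3 hv
  have h5 : ((R : ℂ) - v).re ≤ ‖(R : ℂ) - v‖ := Complex.re_le_norm _
  have h6 : ‖(R : ℂ) - v‖ ≤ 5 := by
    refine (norm_sub_le _ _).trans ?_
    rw [Complex.norm_real, Real.norm_of_nonneg (by linarith)]
    linarith
  nlinarith [norm_nonneg ((R : ℂ) - v)]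

theorem re_div_eq (R : ℝ) (u : ℂ) : ((R : ℂ) / u).re = R * (u.re / ‖u‖ ^ 2) := by
  rw [div_eq_mul_inv, Complex.re_ofReal_mul, Complex.inv_re, Complex.normSq_eq_norm_sq]

theorem re_kernel_ge {R : ℝ} (h1 : 1 ≤ R) (h3 : R ≤ 3) {v : ℂ}
    (hv : ‖v‖ ≤ 1 + ‖v - 1‖ ^ 2 / 100) :
    -(3 / 50) ≤ ((R : ℂ) / ((R : ℂ) - v)).re := by
  rw [re_div_eq]
  have h4 := re_kernel_denom_ge h1 h3 hv
  by_cases h0 : (R : ℂ) - v = 0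
  · rw [h0]; norm_num
  have h5 : 0 < ‖(R : ℂ) - v‖ ^ 2 := by positivity
  have : -(1 / 50) ≤ ((R : ℂ) - v).re / ‖(R : ℂ) - v‖ ^ 2 := by
    rw [le_div_iff₀ h5]; linarith
  nlinarith

theorem re_kernel_ge_of_near {R t : ℝ} (ht0 : 0 < t) (ht1 : t ≤ 1) (h1 : 1 + t ≤ R)
    (h2 : R ≤ 1 + 2 * t) {v : ℂ} (hv : ‖v‖ ≤ 1 + ‖v - 1‖ ^ 2 / 100) (hvt : ‖v - 1‖ ≤ 8 * t) :
    9 / 2500 ≤ t * ((R : ℂ) / ((R : ℂ) - v)).re := by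
  rw [re_div_eq]
  have h4 : ‖(R : ℂ) - v‖ ≤ 10 * t := by
    have : (R : ℂ) - v = -(v - 1) + ((R - 1 : ℝ) : ℂ) := by push_cast; ring
    rw [this]
    refine (norm_add_le _ _).trans ?_
    rw [norm_neg, Complex.norm_real, Real.norm_of_nonneg (by linarith)]
    linarith
  have h5 : 9 / 25 * t ≤ ((R : ℂ) - v).re := by
    have h6 : v.re ≤ ‖v‖ := Complex.re_le_norm v
    simp only [Complex.sub_re, Complex.ofReal_re]
    have : ‖v - 1‖ ^ 2 ≤ (8 * t) ^ 2 := by gcongr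
    nlinarith
  have h0 : 0 < ‖(R : ℂ) - v‖ := by
    have := Complex.re_le_norm ((R : ℂ) - v)
    nlinarith
  have h7 : 9 / 2500 ≤ t * (((R : ℂ) - v).re / ‖(R : ℂ) - v‖ ^ 2) := by
    rw [← mul_div_assoc, le_div_iff₀ (by positivity)]
    have : ‖(R : ℂ) - v‖ ^ 2 ≤ (10 * t) ^ 2 := by gcongr
    nlinarith
  have h8 : 0 ≤ t * (((R : ℂ) - v).re / ‖(R : ℂ) - v‖ ^ 2) := by linarith
  nlinarith

theorem re_kernel_le_reflect {R : ℝ} (h1 : 1 < R) (h3 : R ≤ 3) {v : ℂ}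
    (hv : ‖v‖ ≤ 1 + ‖v - 1‖ ^ 2 / 100) (hv1 : 1 < ‖v‖) (hv2 : ‖v‖ ≤ 11 / 10) :
    ((R : ℂ) / ((R : ℂ) - v)).re ≤
      2 * ((R : ℂ) / ((R : ℂ) - v / ((‖v‖ : ℂ)) ^ 2)).re + 1 := by
  rw [re_div_eq, re_div_eq]
  set ρ := ‖v‖ with hρ
  set u := (R : ℂ) - v with hu
  set u' := (R : ℂ) - v / (ρ : ℂ) ^ 2 with hu'
  have hρ0 : (ρ : ℂ) ≠ 0 := by
    rw [Complex.ofReal_ne_zero]; linarith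
  have h4 := norm_sub_one_le_kernel_denom h1.le h3 hv (by linarith)
  have h0 : 0 < ‖u‖ := norm_pos_iff.mpr (kernel_denom_ne_zero h1 h3 hv)
  have hd : ‖u - u'‖ ≤ 2 * (ρ - 1) := by
    have : u - u' = v * (((1 / ρ ^ 2 - 1 : ℝ)) : ℂ) := by
      rw [hu, hu']; push_cast; field_simp; ring
    rw [this, norm_mul, Complex.norm_real, ← hρ, Real.norm_of_nonpos, neg_sub]
    · have : ρ * (1 - 1 / ρ ^ 2) = ρ - 1 / ρ := by
        field_simp
      rw [this]
      have : 1 - (ρ - 1) ≤ 1 / ρ := by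
        rw [le_div_iff₀ (by linarith)]; nlinarith
      linarith
    · rw [sub_nonpos, div_le_one (by positivity)]; nlinarith
  have h5 : ‖v - 1‖ ≤ 21 / 10 := (norm_sub_le _ _).trans (by rw [norm_one]; linarith)
  have h6 : ‖u - u'‖ ≤ ‖u‖ / 10 := by
    nlinarith [norm_nonneg (v - 1)]
  have h7 : ‖u - u'‖ ≤ ‖u‖ ^ 2 / 10 := by
    nlinarith [norm_nonneg (v - 1)]
  have h8 : ‖u'‖ ≤ 11 / 10 * ‖u‖ := by
    have : u' = u - (u - u') := by ring
    rw [this]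
    refine (norm_sub_le _ _).trans ?_
    linarith
  have h9 : u.re ≤ u'.re + ‖u‖ ^ 2 / 10 := by
    have := Complex.re_le_norm (u - u')
    rw [Complex.sub_re] at this
    linarith
  have h10 : 0 < u'.re := by
    have hn : ‖v / (ρ : ℂ) ^ 2‖ ≤ 1 := by
      rw [norm_div, norm_pow, Complex.norm_real, Real.norm_of_nonneg (by linarith), ← hρ,
        div_le_one (by positivity)]
      nlinarith
    have := Complex.re_le_norm (v / (ρ : ℂ) ^ 2)
    rw [hu', Complex.sub_re, Complex.ofReal_re]
    linarith
  have h11 : 0 < ‖u'‖ := by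
    have := Complex.re_le_norm u'
    linarith
  have h12 : u.re / ‖u‖ ^ 2 ≤ 2 * (u'.re / ‖u'‖ ^ 2) + 1 / 10 := by
    rw [div_le_iff₀ (by positivity)]
    have : u'.re ≤ 2 * (u'.re / ‖u'‖ ^ 2) * ‖u‖ ^ 2 := by
      rw [mul_assoc, div_mul_eq_mul_div, ← mul_div_assoc, le_div_iff₀ (by positivity)]
      have : ‖u'‖ ^ 2 ≤ (11 / 10 * ‖u‖) ^ 2 := by gcongr
      nlinarith
    nlinarith
  nlinarith

theorem re_one_div_one_sub_pos {y : ℂ} (hy : ‖y‖ < 1) : 0 ≤ (1 / (1 - y)).re := by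
  have := re_div_eq 1 (1 - y)
  rw [Complex.ofReal_one] at this
  rw [this]
  have := Complex.re_le_norm y
  have : 0 ≤ (1 - y).re := by simp; linarith
  positivity

theorem sum_one_div_one_sub_root {n : ℕ} {ω : ℂ} (hω : IsPrimitiveRoot ω n) (hn : 0 < n)
    {y : ℂ} (hy : ‖y‖ < 1) :
    ∑ j ∈ Finset.range n, 1 / (1 - ω ^ j * y) = n / (1 - y ^ n) := by
  have hω1 : ‖ω‖ = 1 := Complex.norm_eq_one_of_pow_eq_one hω.pow_eq_one hn.ne'
  have hne : ∀ j, 1 - ω ^ j * y ≠ 0 := fun j h => by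
    have h2 : ω ^ j * y = 1 := (sub_eq_zero.mp h).symm
    have : ‖ω ^ j * y‖ = ‖y‖ := by rw [norm_mul, norm_pow, hω1, one_pow, one_mul]
    rw [h2, norm_one] at this
    linarith
  have hne' : 1 - y ^ n ≠ 0 := fun h => by
    have h2 : y ^ n = 1 := (sub_eq_zero.mp h).symm
    have : ‖y ^ n‖ < 1 := by rw [norm_pow]; exact pow_lt_one₀ (norm_nonneg _) hy hn.ne'
    rw [h2, norm_one] at this
    linarith
  have h1 : ∀ j, 1 / (1 - ω ^ j * y) =
      (∑ k ∈ Finset.range n, (ω ^ j * y) ^ k) / (1 - y ^ n) := fun j => by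
    rw [div_eq_div_iff (hne j) hne', one_mul, mul_comm, mul_neg_geom_sum, mul_pow, ← pow_mul,
      mul_comm j, pow_mul, hω.pow_eq_one, one_pow, one_mul]
  simp_rw [h1]
  rw [← Finset.sum_div, Finset.sum_comm]
  congr 1
  have h2 : ∀ k ∈ Finset.range n, ∑ j ∈ Finset.range n, (ω ^ j * y) ^ k =
      if k = 0 then (n : ℂ) else 0 := fun k hk => by
    split_ifs with h0
    · simp [h0]
    · have h3 : ω ^ k ≠ 1 := hω.pow_ne_one_of_pos_of_lt h0 (Finset.mem_range.mp hk)
      have h4 : ∑ j ∈ Finset.range n, (ω ^ k) ^ j = 0 := by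
        have := mul_neg_geom_sum (ω ^ k) n
        rw [← pow_mul, mul_comm k, pow_mul, hω.pow_eq_one, one_pow, sub_self] at this
        exact (mul_eq_zero.mp this).resolve_left (sub_ne_zero.mpr h3.symm)
      simp_rw [mul_pow, ← pow_mul]
      rw [← Finset.sum_mul]
      simp_rw [mul_comm _ k, pow_mul]
      rw [h4, zero_mul]
  rw [Finset.sum_congr rfl h2, Finset.sum_ite_eq']
  simp [hn.ne']

/-! ### Truncated distance and the cusped neighbourhoods of the disk -/

/-- The distance to `E` truncated at `1`. -/
def cdist (E : Set ℂ) (z : ℂ) : ℝ := min 1 (infDist z E)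

theorem cdist_nonneg (E : Set ℂ) (z : ℂ) : 0 ≤ cdist E z := le_min zero_le_one infDist_nonneg

theorem cdist_le_one (E : Set ℂ) (z : ℂ) : cdist E z ≤ 1 := min_le_left _ _

theorem cdist_le_dist {E : Set ℂ} {a : ℂ} (ha : a ∈ E) (z : ℂ) : cdist E z ≤ ‖z - a‖ := by
  rw [← dist_eq_norm]
  exact (min_le_right _ _).trans (infDist_le_dist_of_mem ha)

theorem cdist_le_add (E : Set ℂ) (z w : ℂ) : cdist E z ≤ cdist E w + ‖z - w‖ := by
  have h := infDist_le_infDist_add_dist (s := E) (x := z) (y := w)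
  rw [dist_eq_norm] at h
  rw [cdist, cdist, min_add]
  exact le_min ((min_le_left _ _).trans (by linarith [norm_nonneg (z - w)]))
    ((min_le_right _ _).trans h)

theorem continuous_cdist (E : Set ℂ) : Continuous (cdist E) :=
  continuous_const.min (continuous_infDist_pt E)

/-- The cusped neighbourhood `{|z| < 1 + d(z)² / 100 - τ}`. -/
def cuspNhd (E : Set ℂ) (τ : ℝ) : Set ℂ := {z | ‖z‖ < 1 + cdist E z ^ 2 / 100 - τ}

theorem isOpen_cuspNhd (E : Set ℂ) (τ : ℝ) : IsOpen (cuspNhd E τ) :=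
  isOpen_lt continuous_norm
    ((continuous_const.add (((continuous_cdist E).pow 2).div_const _)).sub continuous_const)

theorem ball_subset_cuspNhd (E : Set ℂ) : ball (0 : ℂ) 1 ⊆ cuspNhd E 0 := fun z hz => by
  rw [mem_ball_zero_iff] at hz
  have : 0 ≤ cdist E z ^ 2 := sq_nonneg _
  show ‖z‖ < _
  linarith

theorem cuspNhd_mono (E : Set ℂ) {τ τ' : ℝ} (h : τ ≤ τ') : cuspNhd E τ' ⊆ cuspNhd E τ :=
  fun z hz => by
    have : ‖z‖ < 1 + cdist E z ^ 2 / 100 - τ' := hz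
    show ‖z‖ < _
    linarith

theorem norm_le_of_mem_cuspNhd {E : Set ℂ} {z : ℂ} (hz : z ∈ cuspNhd E 0) : ‖z‖ ≤ 101 / 100 := by
  have : ‖z‖ < 1 + cdist E z ^ 2 / 100 - 0 := hz
  have h2 := cdist_le_one E z
  have h3 := cdist_nonneg E z
  nlinarith

theorem norm_le_of_cuspNhd {E : Set ℂ} {z a : ℂ} (hz : z ∈ cuspNhd E 0) (ha : a ∈ E) :
    ‖z‖ ≤ 1 + ‖z - a‖ ^ 2 / 100 := by
  have : ‖z‖ < 1 + cdist E z ^ 2 / 100 - 0 := hz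
  have h2 := cdist_le_dist ha z
  have h3 := cdist_nonneg E z
  nlinarith

theorem cdist_pos_of_norm_ne_one {E : Set ℂ} (hE : E ⊆ sphere 0 1) (hne : E.Nonempty) {z : ℂ}
    (hz : ‖z‖ ≠ 1) : 0 < cdist E z := by
  obtain ⟨a, ha⟩ := hne
  refine lt_min one_pos ?_
  have : |‖z‖ - 1| ≤ infDist z E := by
    refine (le_infDist ⟨a, ha⟩).mpr fun b hb => ?_
    have hb1 : ‖b‖ = 1 := by simpa using hE hb
    rw [dist_eq_norm, ← hb1]
    exact abs_norm_sub_norm_le z b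
  exact (abs_pos.mpr (sub_ne_zero.mpr hz)).trans_le this

theorem min_abs_norm_sub_one_le_cdist {E : Set ℂ} (hE : E ⊆ sphere 0 1) (hne : E.Nonempty)
    (z : ℂ) : min 1 |‖z‖ - 1| ≤ cdist E z := by
  refine min_le_min le_rfl ?_
  refine (le_infDist hne).mpr fun b hb => ?_
  have hb1 : ‖b‖ = 1 := by simpa using hE hb
  rw [dist_eq_norm, ← hb1]
  exact abs_norm_sub_norm_le z b

theorem cdist_pos_of_mem_cuspNhd {E : Set ℂ} (hE : E ⊆ sphere 0 1) (hne : E.Nonempty) {z : ℂ}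
    (hz : z ∈ cuspNhd E 0) : 0 < cdist E z := by
  by_cases h : ‖z‖ = 1
  · have : ‖z‖ < 1 + cdist E z ^ 2 / 100 - 0 := hz
    rcases (cdist_nonneg E z).eq_or_lt with h2 | h2
    · rw [← h2] at this; norm_num at this; linarith
    · exact h2
  · exact cdist_pos_of_norm_ne_one hE hne h

/-! ### Endpoints of the construction of the perfect symmetric set -/

/-- The left endpoint of the interval of the `m`-th step coded by `ε`. -/
def digitSum (p : ℕ) {m : ℕ} (ε : Fin m → Bool) : ℝ :=
  (1 - 1 / (p : ℝ)) * ∑ k, (if ε k then 1 else 0) * (1 / (p : ℝ)) ^ (k : ℕ)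

/-- The corresponding point of the circle. -/
def digitPt (p : ℕ) {m : ℕ} (ε : Fin m → Bool) : ℂ :=
  Complex.exp ((2 * Real.pi * digitSum p ε : ℝ) * I)

theorem norm_digitPt (p : ℕ) {m : ℕ} (ε : Fin m → Bool) : ‖digitPt p ε‖ = 1 :=
  Complex.norm_exp_ofReal_mul_I _

theorem Eset_subset_sphere (ξ : ℝ) : Eset ξ ⊆ sphere 0 1 := by
  rintro z ⟨ε, -, rfl⟩
  rw [mem_sphere_zero_iff_norm]
  rw [show (2 * (Real.pi : ℂ) * I * (((1 - ξ) * ∑' k : ℕ, (ε k : ℝ) * ξ ^ k : ℝ) : ℂ)) =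
    ((2 * Real.pi * ((1 - ξ) * ∑' k : ℕ, (ε k : ℝ) * ξ ^ k) : ℝ) : ℂ) * I by push_cast; ring]
  exact Complex.norm_exp_ofReal_mul_I _

theorem digitPt_mem_Eset (p : ℕ) {m : ℕ} (ε : Fin m → Bool) :
    digitPt p ε ∈ Eset (1 / (p : ℝ)) := by
  refine ⟨fun k => if h : k < m then (if ε ⟨k, h⟩ then 1 else 0) else 0, fun k => ?_, ?_⟩
  · dsimp only
    split_ifs <;> simp
  · rw [digitPt, digitSum]
    congr 1
    rw [tsum_eq_sum (s := Finset.range m), Finset.sum_range]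
    · push_cast
      have : ∀ k : Fin m, (if h : (k : ℕ) < m then (if ε ⟨k, h⟩ then (1 : ℕ) else 0) else 0)
          = if ε k then 1 else 0 := fun k => by
        simp
      simp only [this, apply_ite Complex.ofReal, apply_ite (Nat.cast : ℕ → ℂ), Complex.ofReal_one,
        Complex.ofReal_zero, Nat.cast_one, Nat.cast_zero]
      ring
    · intro k hk
      rw [Finset.mem_range] at hk
      simp [hk]

theorem exists_digitPt_near {p : ℕ} (hp : 2 ≤ p) (m : ℕ) {a : ℂ} (ha : a ∈ Eset (1 / (p : ℝ))) :
    ∃ ε : Fin m → Bool, ‖a - digitPt p ε‖ ≤ 7 * (1 / (p : ℝ)) ^ m := by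
  obtain ⟨δ, hδ, rfl⟩ := ha
  have hp0 : (2 : ℝ) ≤ p := by exact_mod_cast hp
  set ξ : ℝ := 1 / (p : ℝ) with hξ
  have hξ0 : 0 < ξ := by positivity
  have hξ1 : ξ < 1 := by rw [hξ, div_lt_one (by linarith)]; linarith
  refine ⟨fun k => decide (δ k = 1), ?_⟩
  have hs : Summable fun k => (δ k : ℝ) * ξ ^ k := by
    refine Summable.of_nonneg_of_le (fun k => by positivity) (fun k => ?_)
      (summable_geometric_of_lt_one hξ0.le hξ1)
    have : (δ k : ℝ) ≤ 1 := by exact_mod_cast hδ k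
    have h2 : 0 < ξ ^ k := by positivity
    nlinarith
  set x := (1 - ξ) * ∑' k : ℕ, (δ k : ℝ) * ξ ^ k with hx
  set x' := digitSum p (fun k : Fin m => decide (δ k = 1)) with hx'
  have hx'' : x' = (1 - ξ) * ∑ k ∈ Finset.range m, (δ k : ℝ) * ξ ^ k := by
    rw [hx', digitSum, Finset.sum_range]
    congr 1
    refine Finset.sum_congr rfl fun k _ => ?_
    have := hδ k
    interval_cases δ k <;> simp [hξ]
  have htail : x - x' = (1 - ξ) * ∑' k : ℕ, (δ (k + m) : ℝ) * ξ ^ (k + m) := by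
    rw [hx'', hx, ← mul_sub, ← hs.sum_add_tsum_nat_add m, add_sub_cancel_left]
  have hle : |x - x'| ≤ ξ ^ m := by
    rw [htail, abs_of_nonneg (mul_nonneg (by linarith) (tsum_nonneg fun k => by positivity))]
    have : ∑' k : ℕ, (δ (k + m) : ℝ) * ξ ^ (k + m) ≤ ∑' k : ℕ, ξ ^ k * ξ ^ m := by
      refine Summable.tsum_le_tsum (fun k => ?_) ((summable_nat_add_iff m).mpr hs)
        ((summable_geometric_of_lt_one hξ0.le hξ1).mul_right _)
      have : (δ (k + m) : ℝ) ≤ 1 := by exact_mod_cast hδ _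
      rw [← pow_add]
      have h2 : 0 < ξ ^ (k + m) := by positivity
      nlinarith
    rw [tsum_mul_right, tsum_geometric_of_lt_one hξ0.le hξ1] at this
    calc _ ≤ (1 - ξ) * ((1 - ξ)⁻¹ * ξ ^ m) := by gcongr
      _ = ξ ^ m := by rw [← mul_assoc, mul_inv_cancel₀ (by linarith), one_mul]
  rw [digitPt, ← hx', show (2 * (Real.pi : ℂ) * I * (x : ℂ)) =
    ((2 * Real.pi * x : ℝ) : ℂ) * I by push_cast; ring]
  have h1 : Complex.exp (((2 * Real.pi * x : ℝ) : ℂ) * I) -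
      Complex.exp (((2 * Real.pi * x' : ℝ) : ℂ) * I) =
      Complex.exp (((2 * Real.pi * x' : ℝ) : ℂ) * I) *
        (Complex.exp (I * ((2 * Real.pi * (x - x') : ℝ) : ℂ)) - 1) := by
    rw [mul_sub, ← Complex.exp_add, mul_one]
    congr 2
    push_cast; ring
  rw [h1, norm_mul, Complex.norm_exp_ofReal_mul_I, one_mul]
  refine (Real.norm_exp_I_mul_ofReal_sub_one_le).trans ?_
  rw [Real.norm_eq_abs, abs_mul, abs_of_pos (by positivity)]
  have : 2 * Real.pi ≤ 7 := by linarith [Real.pi_lt_d2]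
  gcongr

/-! ### The auxiliary function with positive real part -/

/-- The radius of the poles of the `m`-th layer. -/
def poleRadius (p m : ℕ) : ℝ := Real.exp ((1 / (p : ℝ)) ^ m)

/-- The kernel `R / (R - ā z)`. -/
def poleKernel (R : ℝ) (a z : ℂ) : ℂ := (R : ℂ) / ((R : ℂ) - (starRingEnd ℂ) a * z)

/-- The `m`-th layer of the auxiliary function. -/
def poleLayer (p m : ℕ) (z : ℂ) : ℂ :=
  ((1 / (p : ℝ)) ^ m : ℝ) * ∑ ε : Fin m → Bool, poleKernel (poleRadius p m) (digitPt p ε) z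

/-- The auxiliary function, a sum of Cauchy kernels with poles accumulating at `E_{1/p}`. -/
def poleSum (p : ℕ) (z : ℂ) : ℂ := ∑' m, poleLayer p m z

theorem norm_conj_mul_sub_one {a : ℂ} (ha : ‖a‖ = 1) (z : ℂ) :
    ‖(starRingEnd ℂ) a * z - 1‖ = ‖z - a‖ := by
  have h1 : (starRingEnd ℂ) a * a = 1 := by
    rw [mul_comm, Complex.mul_conj, Complex.normSq_eq_norm_sq, ha]; simp
  have : (starRingEnd ℂ) a * z - 1 = (starRingEnd ℂ) a * (z - a) := by rw [mul_sub, h1]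
  rw [this, norm_mul, Complex.norm_conj, ha, one_mul]

section
variable {p : ℕ}

theorem poleRadius_bounds (hp : 3 ≤ p) (m : ℕ) :
    1 + (1 / (p : ℝ)) ^ m ≤ poleRadius p m ∧ poleRadius p m ≤ 1 + 2 * (1 / (p : ℝ)) ^ m ∧
      0 < (1 / (p : ℝ)) ^ m ∧ (1 / (p : ℝ)) ^ m ≤ 1 := by
  have hp0 : (3 : ℝ) ≤ p := by exact_mod_cast hp
  have h0 : 0 < (1 / (p : ℝ)) ^ m := by positivity
  have h1 : (1 / (p : ℝ)) ^ m ≤ 1 := by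
    refine pow_le_one₀ (by positivity) ?_
    rw [div_le_one (by linarith)]; linarith
  refine ⟨?_, ?_, h0, h1⟩
  · rw [poleRadius, add_comm]; exact Real.add_one_le_exp _
  · have := (abs_le.mp (Real.abs_exp_sub_one_sub_id_le (abs_le.mpr ⟨by linarith, h1⟩))).2
    rw [poleRadius]
    nlinarith

theorem one_lt_poleRadius (hp : 3 ≤ p) (m : ℕ) : 1 < poleRadius p m := by
  obtain ⟨h1, -, h2, -⟩ := poleRadius_bounds hp m; linarith

theorem poleRadius_le (hp : 3 ≤ p) (m : ℕ) : poleRadius p m ≤ 3 := by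
  obtain ⟨-, h1, -, h2⟩ := poleRadius_bounds hp m; linarith

theorem digitPt_kernel_hyp {m : ℕ} (ε : Fin m → Bool) {z : ℂ} (hz : z ∈ cuspNhd (Eset (1 / (p : ℝ))) 0) :
    ‖(starRingEnd ℂ) (digitPt p ε) * z‖ ≤
      1 + ‖(starRingEnd ℂ) (digitPt p ε) * z - 1‖ ^ 2 / 100 := by
  rw [norm_conj_mul_sub_one (norm_digitPt p ε), norm_mul, Complex.norm_conj, norm_digitPt, one_mul]
  exact norm_le_of_cuspNhd hz (digitPt_mem_Eset p ε)

theorem Eset_nonempty (p : ℕ) : (Eset (1 / (p : ℝ))).Nonempty :=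
  ⟨_, digitPt_mem_Eset p (m := 0) Fin.elim0⟩

theorem norm_poleKernel_le (hp : 3 ≤ p) {m : ℕ} (ε : Fin m → Bool) {z : ℂ} (hz : z ∈ cuspNhd (Eset (1 / (p : ℝ))) 0) :
    ‖poleKernel (poleRadius p m) (digitPt p ε) z‖ ≤ 7 / cdist (Eset (1 / (p : ℝ))) z := by
  have hR := one_lt_poleRadius hp m
  have h0 := cdist_pos_of_mem_cuspNhd (Eset_subset_sphere _) (Eset_nonempty p) hz
  have h1 := norm_sub_one_le_kernel_denom hR.le (poleRadius_le hp m) (digitPt_kernel_hyp ε hz) (by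
    rw [norm_mul, Complex.norm_conj, norm_digitPt, one_mul]
    have := norm_le_of_mem_cuspNhd hz
    linarith)
  rw [norm_conj_mul_sub_one (norm_digitPt p ε)] at h1
  have h2 := cdist_le_dist (digitPt_mem_Eset p ε) z
  rw [poleKernel, norm_div, Complex.norm_real, Real.norm_of_nonneg (by linarith)]
  rw [div_le_div_iff₀ (by linarith) h0]
  have := poleRadius_le hp m
  nlinarith

theorem norm_poleLayer_le (hp : 3 ≤ p) (m : ℕ) {z : ℂ} (hz : z ∈ cuspNhd (Eset (1 / (p : ℝ))) 0) :
    ‖poleLayer p m z‖ ≤ (2 / 3) ^ m * (7 / cdist (Eset (1 / (p : ℝ))) z) := by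
  have hp0 : (3 : ℝ) ≤ p := by exact_mod_cast hp
  obtain ⟨-, -, h2, -⟩ := poleRadius_bounds hp m
  have hB : 0 ≤ 7 / cdist (Eset (1 / (p : ℝ))) z := div_nonneg (by norm_num) (cdist_nonneg _ _)
  rw [poleLayer, norm_mul, Complex.norm_real, Real.norm_of_nonneg h2.le]
  calc _ ≤ (1 / (p : ℝ)) ^ m * ∑ ε : Fin m → Bool, 7 / cdist (Eset (1 / (p : ℝ))) z := by
        gcongr
        exact norm_sum_le_of_le _ fun ε _ => norm_poleKernel_le hp ε hz
    _ = (2 * (1 / (p : ℝ))) ^ m * (7 / cdist (Eset (1 / (p : ℝ))) z) := by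
        simp [mul_pow]; ring
    _ ≤ _ := by
        gcongr
        rw [mul_one_div]
        exact div_le_div_of_nonneg_left (by norm_num) (by norm_num) hp0

theorem summable_poleLayer (hp : 3 ≤ p) {z : ℂ} (hz : z ∈ cuspNhd (Eset (1 / (p : ℝ))) 0) :
    Summable fun m => poleLayer p m z :=
  Summable.of_norm_bounded ((summable_geometric_of_lt_one (by norm_num) (by norm_num)).mul_right _)
    fun m => norm_poleLayer_le hp m hz

theorem hasSum_re_poleLayer (hp : 3 ≤ p) {z : ℂ} (hz : z ∈ cuspNhd (Eset (1 / (p : ℝ))) 0) :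
    HasSum (fun m => (poleLayer p m z).re) (poleSum p z).re :=
  Complex.hasSum_re (summable_poleLayer hp hz).hasSum

theorem differentiableOn_poleSum (hp : 3 ≤ p) : DifferentiableOn ℂ (poleSum p) (cuspNhd (Eset (1 / (p : ℝ))) 0) := by
  intro z hz
  have h0 := cdist_pos_of_mem_cuspNhd (Eset_subset_sphere _) (Eset_nonempty p) hz
  set δ := cdist (Eset (1 / (p : ℝ))) z / 2 with hδ
  have hδ0 : 0 < δ := by positivity
  set U := cuspNhd (Eset (1 / (p : ℝ))) 0 ∩ {w | δ < cdist (Eset (1 / (p : ℝ))) w} with hU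
  have hUo : IsOpen U := (isOpen_cuspNhd _ _).inter (isOpen_lt continuous_const (continuous_cdist _))
  have hzU : z ∈ U := ⟨hz, by show δ < _; linarith⟩
  have : DifferentiableOn ℂ (poleSum p) U := by
    refine differentiableOn_tsum_of_summable_norm (u := fun m => (2 / 3 : ℝ) ^ m * (7 / δ))
      ((summable_geometric_of_lt_one (by norm_num) (by norm_num)).mul_right _) (fun m => ?_) hUo ?_
    · refine DifferentiableOn.const_mul (DifferentiableOn.fun_sum fun ε _ => ?_) _
      refine DifferentiableOn.div (differentiableOn_const _) (by fun_prop) fun w hw => ?_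
      exact kernel_denom_ne_zero (one_lt_poleRadius hp m) (poleRadius_le hp m)
        (digitPt_kernel_hyp ε hw.1)
    · intro m w hw
      refine (norm_poleLayer_le hp m hw.1).trans ?_
      have : δ < cdist (Eset (1 / (p : ℝ))) w := hw.2
      gcongr
  exact (this.differentiableAt (hUo.mem_nhds hzU)).differentiableWithinAt

theorem geom_two_thirds_le (hp : 3 ≤ p) (m : ℕ) : (1 / (p : ℝ)) ^ m * 2 ^ m ≤ (2 / 3) ^ m := by
  have hp0 : (3 : ℝ) ≤ p := by exact_mod_cast hp
  rw [← mul_pow]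
  gcongr
  rw [one_div_mul_eq_div]
  exact div_le_div_of_nonneg_left (by norm_num) (by norm_num) hp0

theorem re_poleLayer (m : ℕ) (z : ℂ) : (poleLayer p m z).re =
    (1 / (p : ℝ)) ^ m * ∑ ε : Fin m → Bool, (poleKernel (poleRadius p m) (digitPt p ε) z).re := by
  rw [poleLayer, Complex.re_ofReal_mul, Complex.re_sum]

theorem re_poleLayer_ge (hp : 3 ≤ p) (m : ℕ) {z : ℂ} (hz : z ∈ cuspNhd (Eset (1 / (p : ℝ))) 0) :
    -(3 / 50) * (2 / 3) ^ m ≤ (poleLayer p m z).re := by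
  have h1 : (2 : ℝ) ^ m * -(3 / 50) ≤
      ∑ ε : Fin m → Bool, (poleKernel (poleRadius p m) (digitPt p ε) z).re := by
    have : ∑ ε : Fin m → Bool, (-(3 / 50) : ℝ) ≤ _ := Finset.sum_le_sum fun ε _ =>
      re_kernel_ge (one_lt_poleRadius hp m).le (poleRadius_le hp m) (digitPt_kernel_hyp ε hz)
    rw [Finset.sum_const, Finset.card_univ, Fintype.card_fun, Fintype.card_bool, Fintype.card_fin,
      nsmul_eq_mul] at this
    exact_mod_cast this
  rw [re_poleLayer]
  obtain ⟨-, -, h2, -⟩ := poleRadius_bounds hp m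
  have h3 := geom_two_thirds_le hp m
  have := mul_le_mul_of_nonneg_left h1 h2.le
  linarith

theorem re_poleLayer_ge_of_near (hp : 3 ≤ p) (m : ℕ) {z : ℂ} (hz : z ∈ cuspNhd (Eset (1 / (p : ℝ))) 0)
    (hd : infDist z (Eset (1 / (p : ℝ))) < (1 / (p : ℝ)) ^ m) :
    9 / 2500 - 3 / 50 * (2 / 3) ^ m ≤ (poleLayer p m z).re := by
  obtain ⟨a, ha, hza⟩ := (infDist_lt_iff (Eset_nonempty p)).mp hd
  obtain ⟨ε₀, hε₀⟩ := exists_digitPt_near (by omega) m ha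
  obtain ⟨hR1, hR2, h2, h2'⟩ := poleRadius_bounds hp m
  have hnear : ‖z - digitPt p ε₀‖ ≤ 8 * (1 / (p : ℝ)) ^ m := by
    have : z - digitPt p ε₀ = (z - a) + (a - digitPt p ε₀) := by ring
    rw [this]
    refine (norm_add_le _ _).trans ?_
    rw [dist_eq_norm] at hza
    linarith
  have hbig := re_kernel_ge_of_near h2 h2' hR1 hR2 (digitPt_kernel_hyp ε₀ hz)
    (by rw [norm_conj_mul_sub_one (norm_digitPt p ε₀)]; exact hnear)
  have hrest : (2 : ℝ) ^ m * -(3 / 50) ≤ ∑ ε ∈ Finset.univ.erase ε₀,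
      (poleKernel (poleRadius p m) (digitPt p ε) z).re := by
    have : ∑ ε ∈ Finset.univ.erase ε₀, (-(3 / 50) : ℝ) ≤ _ := Finset.sum_le_sum fun ε _ =>
      re_kernel_ge (one_lt_poleRadius hp m).le (poleRadius_le hp m) (digitPt_kernel_hyp ε hz)
    refine le_trans ?_ this
    rw [Finset.sum_const, nsmul_eq_mul]
    have hc : (((Finset.univ.erase ε₀).card : ℕ) : ℝ) ≤ 2 ^ m := by
      have : (Finset.univ.erase ε₀).card ≤ (Finset.univ : Finset (Fin m → Bool)).card :=
        Finset.card_le_card (Finset.erase_subset _ _)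
      have h3 : (Finset.univ : Finset (Fin m → Bool)).card = 2 ^ m := by simp
      rw [h3] at this
      exact_mod_cast this
    linarith
  rw [re_poleLayer, ← Finset.add_sum_erase _ _ (Finset.mem_univ ε₀), mul_add]
  have h3 := geom_two_thirds_le hp m
  have := mul_le_mul_of_nonneg_left hrest h2.le
  have h4 : 9 / 2500 ≤ (1 / (p : ℝ)) ^ m *
    (poleKernel (poleRadius p m) (digitPt p ε₀) z).re := hbig
  linarith

theorem hasSum_geom_two_thirds (c : ℝ) : HasSum (fun m : ℕ => c * (2 / 3 : ℝ) ^ m) (c * 3) := by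
  have := (hasSum_geometric_of_lt_one (r := (2 / 3 : ℝ)) (by norm_num) (by norm_num)).mul_left c
  norm_num at this
  exact this

theorem re_poleSum_ge (hp : 3 ≤ p) (M : ℕ) {z : ℂ} (hz : z ∈ cuspNhd (Eset (1 / (p : ℝ))) 0)
    (hd : ∀ m < M, infDist z (Eset (1 / (p : ℝ))) < (1 / (p : ℝ)) ^ m) :
    9 / 2500 * M - 1 ≤ (poleSum p z).re := by
  have h1 : HasSum (fun m : ℕ => (if m ∈ Finset.range M then (9 / 2500 : ℝ) else 0) +
      -(3 / 50) * (2 / 3) ^ m) (∑ m ∈ Finset.range M, (9 / 2500 : ℝ) + -(3 / 50) * 3) := by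
    refine HasSum.add ?_ (hasSum_geom_two_thirds _)
    have := hasSum_sum_of_ne_finset_zero (f := fun m : ℕ =>
      if m ∈ Finset.range M then (9 / 2500 : ℝ) else 0) (s := Finset.range M) (L := .unconditional ℕ)
      (fun b hb => if_neg hb)
    rwa [Finset.sum_congr rfl fun m hm => if_pos hm] at this
  have h2 := hasSum_le (fun m => ?_) h1 (hasSum_re_poleLayer hp hz)
  · rw [Finset.sum_const, Finset.card_range, nsmul_eq_mul] at h2
    linarith
  · split_ifs with hm
    · have := re_poleLayer_ge_of_near hp m hz (hd m (Finset.mem_range.mp hm))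
      linarith
    · rw [zero_add]; exact re_poleLayer_ge hp m hz

theorem re_poleSum_le_reflect (hp : 3 ≤ p) {z : ℂ} (hz : z ∈ cuspNhd (Eset (1 / (p : ℝ))) 0) (h1 : 1 < ‖z‖) :
    (poleSum p z).re ≤ 2 * (poleSum p (z / (‖z‖ : ℂ) ^ 2)).re + 3 := by
  have hz' : z / (‖z‖ : ℂ) ^ 2 ∈ cuspNhd (Eset (1 / (p : ℝ))) 0 := by
    refine ball_subset_cuspNhd _ ?_
    rw [mem_ball_zero_iff, norm_div, norm_pow, Complex.norm_real, norm_norm,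
      div_lt_one (by positivity)]
    nlinarith
  have h2 : ∀ m, (poleLayer p m z).re ≤
      2 * (poleLayer p m (z / (‖z‖ : ℂ) ^ 2)).re + 1 * (2 / 3) ^ m := fun m => by
    rw [re_poleLayer, re_poleLayer]
    obtain ⟨-, -, h2, -⟩ := poleRadius_bounds hp m
    have h3 : ∑ ε : Fin m → Bool, (poleKernel (poleRadius p m) (digitPt p ε) z).re ≤
        ∑ ε : Fin m → Bool, (2 * (poleKernel (poleRadius p m) (digitPt p ε)
          (z / (‖z‖ : ℂ) ^ 2)).re + 1) := by
      refine Finset.sum_le_sum fun ε _ => ?_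
      have hn : ‖(starRingEnd ℂ) (digitPt p ε) * z‖ = ‖z‖ := by
        rw [norm_mul, Complex.norm_conj, norm_digitPt, one_mul]
      have := re_kernel_le_reflect (one_lt_poleRadius hp m) (poleRadius_le hp m)
        (digitPt_kernel_hyp ε hz) (by rw [hn]; exact h1)
        (by rw [hn]; have := norm_le_of_mem_cuspNhd hz; linarith)
      rw [hn, mul_div_assoc] at this
      exact this
    rw [Finset.sum_add_distrib, ← Finset.mul_sum] at h3
    have h4 := mul_le_mul_of_nonneg_left h3 h2.le
    have h5 : ∑ ε : Fin m → Bool, (1 : ℝ) = 2 ^ m := by simp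
    rw [h5, mul_add] at h4
    have h6 := geom_two_thirds_le hp m
    linarith
  have := hasSum_le h2 (hasSum_re_poleLayer hp hz)
    (((hasSum_re_poleLayer hp hz').mul_left 2).add (hasSum_geom_two_thirds 1))
  linarith

theorem re_poleKernel_nonneg {R : ℝ} (hR : 1 < R) {a z : ℂ} (ha : ‖a‖ = 1) (hz : ‖z‖ < 1) :
    0 ≤ (poleKernel R a z).re := by
  have hR0 : (R : ℂ) ≠ 0 := by rw [Complex.ofReal_ne_zero]; linarith
  have : poleKernel R a z = 1 / (1 - (starRingEnd ℂ) a * z / R) := by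
    rw [poleKernel]
    rw [one_sub_div hR0, one_div_div]
  rw [this]
  refine re_one_div_one_sub_pos ?_
  rw [norm_div, norm_mul, Complex.norm_conj, ha, one_mul, Complex.norm_real,
    Real.norm_of_nonneg (by linarith), div_lt_one (by linarith)]
  linarith

theorem re_poleSum_nonneg (hp : 3 ≤ p) {z : ℂ} (hz : ‖z‖ < 1) : 0 ≤ (poleSum p z).re := by
  refine (hasSum_re_poleLayer hp (ball_subset_cuspNhd _ (mem_ball_zero_iff.mpr hz))).nonneg
    fun m => ?_
  rw [re_poleLayer]
  obtain ⟨-, -, h2, -⟩ := poleRadius_bounds hp m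
  exact mul_nonneg h2.le (Finset.sum_nonneg fun ε _ =>
    re_poleKernel_nonneg (one_lt_poleRadius hp m) (norm_digitPt p ε) hz)
end

section
variable {p : ℕ}

theorem digitSum_cons (b : Bool) {m : ℕ} (ε : Fin m → Bool) :
    digitSum p (Fin.cons b ε : Fin (m + 1) → Bool) =
      (1 - 1 / (p : ℝ)) * (if b then 1 else 0) + 1 / (p : ℝ) * digitSum p ε := by
  rw [digitSum, digitSum, Fin.sum_univ_succ]
  simp only [Fin.cons_zero, Fin.cons_succ, Fin.val_zero, Fin.val_succ, pow_zero, pow_succ]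
  simp_rw [← mul_assoc]
  rw [← Finset.sum_mul]
  ring

theorem re_poleKernel_pow_ge (hp : 3 ≤ p) {m : ℕ} (ε : Fin m → Bool) {z : ℂ} (hz : ‖z‖ < 1) :
    1 / (p : ℝ) * ∑ b : Bool, (poleKernel (poleRadius p (m + 1))
        (digitPt p (Fin.cons b ε : Fin (m + 1) → Bool)) z).re ≤
      (poleKernel (poleRadius p m) (digitPt p ε) (z ^ p)).re := by
  have hp0 : (p : ℂ) ≠ 0 := by exact_mod_cast (by omega : p ≠ 0)
  have hp0' : (p : ℝ) ≠ 0 := by exact_mod_cast (by omega : p ≠ 0)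
  have hpp : (0 : ℝ) < p := by exact_mod_cast (by omega : 0 < p)
  set R := poleRadius p m with hR
  set R' := poleRadius p (m + 1) with hR'
  have hRR : R' ^ p = R := by
    rw [hR, hR', poleRadius, poleRadius, ← Real.exp_nat_mul]
    congr 1
    rw [pow_succ]; field_simp
  have hR1 : 1 < R := one_lt_poleRadius hp m
  have hR'1 : 1 < R' := one_lt_poleRadius hp (m + 1)
  have hRc : (R : ℂ) ≠ 0 := by rw [Complex.ofReal_ne_zero]; linarith
  have hR'c : (R' : ℂ) ≠ 0 := by rw [Complex.ofReal_ne_zero]; linarith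
  set b₀ := digitPt p (Fin.cons false ε : Fin (m + 1) → Bool) with hb0
  set ω := Complex.exp (2 * Real.pi * I / p) with hω
  have hprim : IsPrimitiveRoot ω p := Complex.isPrimitiveRoot_exp p (by omega)
  set y := (starRingEnd ℂ) b₀ * z / R' with hy
  have hy1 : ‖y‖ < 1 := by
    rw [hy, norm_div, norm_mul, Complex.norm_conj, norm_digitPt, one_mul, Complex.norm_real,
      Real.norm_of_nonneg (by linarith), div_lt_one (by linarith)]
    linarith
  have hker : ∀ (S : ℝ) (a w : ℂ), (S : ℂ) ≠ 0 →
      poleKernel S a w = 1 / (1 - (starRingEnd ℂ) a * w / S) := fun S a w hS => by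
    rw [poleKernel, one_sub_div hS, one_div_div]
  have hb0p : b₀ ^ p = digitPt p ε := by
    rw [hb0, digitPt, digitPt, ← Complex.exp_nat_mul, digitSum_cons]
    congr 1
    push_cast
    field_simp
    simp
  have hbt : (starRingEnd ℂ) (digitPt p (Fin.cons true ε : Fin (m + 1) → Bool)) =
      ω * (starRingEnd ℂ) b₀ := by
    rw [hb0, digitPt, digitPt, ← Complex.exp_conj, ← Complex.exp_conj, hω, ← Complex.exp_add,
      digitSum_cons, digitSum_cons, Complex.exp_eq_exp_iff_exists_int]
    refine ⟨-1, ?_⟩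
    simp only [map_mul, Complex.conj_ofReal, Complex.conj_I]
    push_cast
    field_simp
    simp
    ring
  have h1 : poleKernel R (digitPt p ε) (z ^ p) =
      ((1 / (p : ℝ) : ℝ) : ℂ) * ∑ j ∈ Finset.range p, 1 / (1 - ω ^ j * y) := by
    rw [sum_one_div_one_sub_root hprim (by omega) hy1, hker _ _ _ hRc]
    have : y ^ p = (starRingEnd ℂ) (digitPt p ε) * z ^ p / R := by
      rw [hy, div_pow, mul_pow, ← map_pow, hb0p, ← hRR]; push_cast; rfl
    rw [this]
    push_cast
    field_simp
  rw [h1, Complex.re_ofReal_mul, Complex.re_sum]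
  refine mul_le_mul_of_nonneg_left ?_ (by positivity)
  have hω1 : ‖ω‖ = 1 := Complex.norm_eq_one_of_pow_eq_one hprim.pow_eq_one (by omega)
  have h2 : ∑ j ∈ Finset.range 2, (1 / (1 - ω ^ j * y)).re ≤
      ∑ j ∈ Finset.range p, (1 / (1 - ω ^ j * y)).re := by
    refine Finset.sum_le_sum_of_subset_of_nonneg (Finset.range_subset_range.mpr (by omega))
      fun j _ _ => re_one_div_one_sub_pos ?_
    rw [norm_mul, norm_pow, hω1, one_pow, one_mul]; exact hy1
  refine le_trans (le_of_eq ?_) h2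
  rw [Fintype.sum_bool, Finset.sum_range_succ, Finset.sum_range_one, hker _ _ _ hR'c,
    hker _ _ _ hR'c, hbt, ← hb0, hy, pow_zero, pow_one, one_mul, add_comm, mul_assoc, mul_div_assoc, mul_div_assoc,
    mul_div_assoc]

theorem sum_fin_succ_bool {m : ℕ} (f : (Fin (m + 1) → Bool) → ℝ) :
    ∑ ε, f ε = ∑ ε : Fin m → Bool, ∑ b : Bool, f (Fin.cons b ε : Fin (m + 1) → Bool) := by
  rw [Finset.sum_comm, ← Fintype.sum_prod_type']
  exact (Fintype.sum_equiv (Fin.consEquiv fun _ => Bool) _ _ fun x => rfl).symm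

theorem re_poleSum_le_pow (hp : 3 ≤ p) {z : ℂ} (hz : ‖z‖ < 1) :
    (poleSum p z).re ≤ (poleSum p (z ^ p)).re + 3 := by
  have hp0' : (p : ℝ) ≠ 0 := by exact_mod_cast (by omega : p ≠ 0)
  have hzp : ‖z ^ p‖ < 1 := by
    rw [norm_pow]; exact pow_lt_one₀ (norm_nonneg _) hz (by omega)
  have hs := hasSum_re_poleLayer hp (ball_subset_cuspNhd _ (mem_ball_zero_iff.mpr hz))
  have hsp := hasSum_re_poleLayer hp (ball_subset_cuspNhd _ (mem_ball_zero_iff.mpr hzp))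
  have h1 : ∀ m, (poleLayer p (m + 1) z).re ≤ (poleLayer p m (z ^ p)).re := fun m => by
    rw [re_poleLayer, re_poleLayer, sum_fin_succ_bool, pow_succ, mul_assoc]
    refine mul_le_mul_of_nonneg_left ?_ (by positivity)
    rw [Finset.mul_sum]
    exact Finset.sum_le_sum fun ε _ => re_poleKernel_pow_ge hp ε hz
  have h2 : (poleLayer p 0 z).re ≤ 3 := by
    rw [re_poleLayer]
    have h3 : (1 / (p : ℝ)) ^ 0 = 1 := pow_zero _
    have hR : (2.7 : ℝ) ≤ poleRadius p 0 := by
      rw [poleRadius, h3]; linarith [Real.exp_one_gt_d9]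
    have hR3 := poleRadius_le hp 0
    rw [h3, one_mul, Fintype.sum_unique]
    refine (Complex.re_le_norm _).trans ?_
    have h4 : ∀ a : ℂ, ‖a‖ = 1 → ‖poleKernel (poleRadius p 0) a z‖ ≤ 3 := fun a ha => by
      rw [poleKernel, norm_div, Complex.norm_real, Real.norm_of_nonneg (by linarith)]
      have h5 : 1.7 ≤ ‖(poleRadius p 0 : ℂ) - (starRingEnd ℂ) a * z‖ := by
        refine le_trans ?_ (norm_sub_norm_le _ _)
        rw [Complex.norm_real, Real.norm_of_nonneg (by linarith), norm_mul, Complex.norm_conj,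
          ha, one_mul]
        linarith
      rw [div_le_iff₀ (by linarith)]
      linarith
    exact h4 _ (norm_digitPt p _)
  have h3 := (hasSum_nat_add_iff' 1).mpr hs
  have := hasSum_le h1 h3 hsp
  simp only [Finset.range_one, Finset.sum_singleton] at this
  linarith

/-- The weight making the outer function vanish to fourth order on `E_{1/p}`. -/
def outerWeight (p : ℕ) : ℝ := 2500 / 9 * (4 * Real.log p)

/-- An outer function vanishing on `E_{1/p}`. -/
def outerFn (p : ℕ) (z : ℂ) : ℂ := Complex.exp (-(outerWeight p : ℂ) * poleSum p z)

theorem outerWeight_nonneg (p : ℕ) : 0 ≤ outerWeight p := by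
  have := Real.log_natCast_nonneg p
  unfold outerWeight
  positivity

theorem norm_outerFn (p : ℕ) (z : ℂ) :
    ‖outerFn p z‖ = Real.exp (-(outerWeight p * (poleSum p z).re)) := by
  rw [outerFn, Complex.norm_exp, ← Complex.ofReal_neg, Complex.re_ofReal_mul, neg_mul]

theorem differentiableOn_outerFn (hp : 3 ≤ p) :
    DifferentiableOn ℂ (outerFn p) (cuspNhd (Eset (1 / (p : ℝ))) 0) :=
  ((differentiableOn_poleSum hp).const_mul _).cexp

theorem norm_outerFn_le (hp : 3 ≤ p) {z : ℂ} (hz : z ∈ cuspNhd (Eset (1 / (p : ℝ))) 0) :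
    ‖outerFn p z‖ ≤ Real.exp (outerWeight p) * cdist (Eset (1 / (p : ℝ))) z ^ 4 := by
  have hp0 : (3 : ℝ) ≤ p := by exact_mod_cast hp
  have hd := cdist_pos_of_mem_cuspNhd (Eset_subset_sphere _) (Eset_nonempty p) hz
  have hd' : 0 < infDist z (Eset (1 / (p : ℝ))) := hd.trans_le (min_le_right _ _)
  have hex : ∃ M : ℕ, (1 / (p : ℝ)) ^ M ≤ infDist z (Eset (1 / (p : ℝ))) :=
    ((exists_pow_lt_of_lt_one hd') (by rw [div_lt_one (by linarith)]; linarith)).imp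
      fun _ h => h.le
  classical
  set M := Nat.find hex with hM
  have h1 := re_poleSum_ge hp M hz fun m hm => not_le.mp (Nat.find_min hex hm)
  have h2 : (1 / (p : ℝ)) ^ M ≤ cdist (Eset (1 / (p : ℝ))) z :=
    le_min (poleRadius_bounds hp M).2.2.2 (Nat.find_spec hex)
  rw [norm_outerFn]
  have h3 : -(outerWeight p * (poleSum p z).re) ≤
      outerWeight p + 4 * (M * (-Real.log p)) := by
    have := mul_le_mul_of_nonneg_left h1 (outerWeight_nonneg p)
    have h4 : outerWeight p * (9 / 2500 * M - 1) = 4 * (M * Real.log p) - outerWeight p := by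
      unfold outerWeight; ring
    linarith
  calc _ ≤ Real.exp (outerWeight p + 4 * (M * (-Real.log p))) := Real.exp_le_exp.mpr h3
    _ = Real.exp (outerWeight p) * ((1 / (p : ℝ)) ^ M) ^ 4 := by
      rw [Real.exp_add, mul_comm (4 : ℝ), Real.exp_mul, Real.exp_nat_mul, ← Real.log_inv,
        Real.exp_log (by positivity), one_div]
      norm_cast
    _ ≤ _ := by gcongr

theorem norm_outerFn_le_one (hp : 3 ≤ p) {z : ℂ} (hz : ‖z‖ < 1) : ‖outerFn p z‖ ≤ 1 := by
  rw [norm_outerFn, Real.exp_le_one_iff, neg_nonpos]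
  exact mul_nonneg (outerWeight_nonneg p) (re_poleSum_nonneg hp hz)

theorem norm_outerFn_pow_le (hp : 3 ≤ p) {z : ℂ} (hz : ‖z‖ < 1) :
    ‖outerFn p (z ^ p)‖ ≤ Real.exp (3 * outerWeight p) * ‖outerFn p z‖ := by
  rw [norm_outerFn, norm_outerFn, ← Real.exp_add, Real.exp_le_exp]
  nlinarith [mul_le_mul_of_nonneg_left (re_poleSum_le_pow hp hz) (outerWeight_nonneg p)]

theorem norm_outerFn_pow_pow_le (hp : 3 ≤ p) (n : ℕ) {z : ℂ} (hz : ‖z‖ < 1) :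
    ‖outerFn p (z ^ p ^ n)‖ ≤ Real.exp (3 * outerWeight p) ^ n * ‖outerFn p z‖ := by
  induction n with
  | zero => simp
  | succ n ih =>
    have hz' : ‖z ^ p ^ n‖ < 1 := by
      rw [norm_pow]; exact pow_lt_one₀ (norm_nonneg _) hz (pow_ne_zero _ (by omega))
    have := norm_outerFn_pow_le hp hz'
    rw [← pow_mul, ← pow_succ] at this
    refine this.trans ?_
    rw [pow_succ, mul_comm (_ ^ n), mul_assoc]
    gcongr

theorem norm_outerFn_reflect_le (hp : 3 ≤ p) {z : ℂ} (hz : z ∈ cuspNhd (Eset (1 / (p : ℝ))) 0)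
    (h1 : 1 < ‖z‖) :
    ‖outerFn p (z / (‖z‖ : ℂ) ^ 2)‖ ^ 2 ≤ Real.exp (3 * outerWeight p) * ‖outerFn p z‖ := by
  rw [norm_outerFn, norm_outerFn, ← Real.exp_add, ← Real.exp_nat_mul, Real.exp_le_exp]
  have := mul_le_mul_of_nonneg_left (re_poleSum_le_reflect hp hz h1) (outerWeight_nonneg p)
  push_cast
  linarith
end

/-- The logarithm of the modulus of an analytic function is at most its average over a circle. -/
theorem log_norm_le_circleAverage {f : ℂ → ℂ} {c : ℂ} {R : ℝ} (hR : 0 < R)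
    (hf : AnalyticOnNhd ℂ f (closedBall c R)) (h0 : f c ≠ 0) :
    Real.log ‖f c‖ ≤ Real.circleAverage (fun z => Real.log ‖f z‖) c R := by
  have habs : |R| = R := abs_of_pos hR
  rw [← habs] at hf
  rw [hf.circleAverage_log_norm hR.ne' h0]
  refine le_add_of_nonneg_left (finsum_nonneg fun u => ?_)
  by_cases hu : u ∈ closedBall c |R|
  · refine mul_nonneg (mod_cast MeromorphicOn.AnalyticOnNhd.divisor_nonneg hf u) ?_
    rcases eq_or_ne u c with rfl | hne
    · simp
    · have hpos : 0 < ‖c - u‖ := norm_pos_iff.2 (sub_ne_zero.2 hne.symm)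
      refine Real.log_nonneg ?_
      rw [← div_eq_mul_inv, one_le_div hpos]
      simpa [dist_eq_norm', habs] using hu
  · simp [hu]

theorem ofReal_log_le_lintegral_circle {f : ℂ → ℂ} {c : ℂ} {R : ℝ} (hR : 0 < R)
    (hf : AnalyticOnNhd ℂ f (closedBall c R)) (h0 : f c ≠ 0) {M : ℝ} (hM : 1 ≤ M) {σ : ℂ → ℝ}
    (hσm : Measurable σ) (hσ0 : ∀ z, 0 ≤ σ z) {Z : Set ℂ} (hZ : Z.Countable)
    (hb : ∀ z ∈ sphere c R, z ∉ Z → ‖f z‖ ≤ M * Real.exp (σ z)) :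
    ENNReal.ofReal (2 * Real.pi * (Real.log ‖f c‖ - Real.log M)) ≤
      ∫⁻ θ in Ioo (-Real.pi) Real.pi, ENNReal.ofReal (σ (circleMap c R θ)) := by
  have hmeas : Measurable fun θ : ℝ => σ (circleMap c R θ) :=
    hσm.comp (continuous_circleMap c R).measurable
  by_cases hinteg : IntegrableOn (fun θ : ℝ => σ (circleMap c R θ)) (Ioo (-Real.pi) Real.pi)
  swap
  · have : ∫⁻ θ in Ioo (-Real.pi) Real.pi, ENNReal.ofReal (σ (circleMap c R θ)) = ⊤ := by
      by_contra hne
      refine hinteg ⟨hmeas.aestronglyMeasurable, ?_⟩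
      rw [hasFiniteIntegral_iff_ofReal (Eventually.of_forall fun θ => hσ0 _)]
      exact lt_top_iff_ne_top.2 hne
    rw [this]; exact le_top
  rw [← ofReal_integral_eq_lintegral_ofReal hinteg (Eventually.of_forall fun θ => hσ0 _)]
  refine ENNReal.ofReal_le_ofReal ?_
  have hJ := log_norm_le_circleAverage hR hf h0
  rw [Real.circleAverage_eq_integral_add (-Real.pi), smul_eq_mul] at hJ
  have hshift : (∫ θ in (0:ℝ)..2 * Real.pi, Real.log ‖f (circleMap c R (θ + -Real.pi))‖) =
      ∫ θ in (-Real.pi)..Real.pi, Real.log ‖f (circleMap c R θ)‖ := by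
    rw [intervalIntegral.integral_comp_add_right (fun θ => Real.log ‖f (circleMap c R θ)‖)]
    congr 1 <;> ring
  rw [hshift] at hJ
  have hpi := Real.pi_pos
  have hle : -Real.pi ≤ Real.pi := by linarith
  have hlog : CircleIntegrable (fun z => Real.log ‖f z‖) c R := by
    apply MeromorphicOn.circleIntegrable_log_norm
    rw [abs_of_pos hR]
    exact (hf.mono sphere_subset_closedBall).meromorphicOn
  have hlogI : IntervalIntegrable (fun θ => Real.log ‖f (circleMap c R θ)‖) volume
      (-Real.pi) Real.pi := by
    have hper : Function.Periodic (fun θ => Real.log ‖f (circleMap c R θ)‖) (2 * Real.pi) :=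
      fun θ => by simp [periodic_circleMap c R θ]
    exact hper.intervalIntegrable₀ Real.two_pi_pos.ne' hlog _ _
  have hσI : IntervalIntegrable (fun θ => Real.log M + σ (circleMap c R θ)) volume
      (-Real.pi) Real.pi := by
    refine intervalIntegrable_const.add ?_
    rw [intervalIntegrable_iff_integrableOn_Ioo_of_le hle]
    exact hinteg
  have hmono : (∫ θ in (-Real.pi)..Real.pi, Real.log ‖f (circleMap c R θ)‖) ≤
      ∫ θ in (-Real.pi)..Real.pi, (Real.log M + σ (circleMap c R θ)) := by
    refine intervalIntegral.integral_mono_ae hle hlogI hσI ?_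
    have hnull := (hZ.preimage_circleMap c hR.ne').ae_notMem volume
    filter_upwards [hnull] with θ hθ
    rcases eq_or_ne (f (circleMap c R θ)) 0 with h | h
    · rw [h, norm_zero, Real.log_zero]
      exact add_nonneg (Real.log_nonneg hM) (hσ0 _)
    · rw [← Real.log_exp (σ (circleMap c R θ)), ← Real.log_mul (by positivity) (by positivity)]
      exact Real.log_le_log (norm_pos_iff.2 h)
        (hb _ (circleMap_mem_sphere c hR.le θ) hθ)
  rw [intervalIntegral.integral_add intervalIntegrable_const
    (by rw [intervalIntegrable_iff_integrableOn_Ioo_of_le hle]; exact hinteg),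
    intervalIntegral.integral_const, smul_eq_mul,
    intervalIntegral.integral_of_le hle (f := fun θ => σ (circleMap c R θ)),
    integral_Ioc_eq_integral_Ioo] at hmono
  have h2 : 2 * Real.pi * Real.log ‖f c‖ ≤
      ∫ θ in (-Real.pi)..Real.pi, Real.log ‖f (circleMap c R θ)‖ := by
    rw [inv_mul_eq_div, le_div_iff₀ Real.two_pi_pos] at hJ
    linarith
  nlinarith [h2, hmono]

theorem norm_sq_add_mul_add_one {u : ℂ} (hu : ‖u‖ = 1) (c : ℝ) :
    ‖u ^ 2 + c * u + 1‖ = |2 * u.re + c| := by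
  have h1 : u * (starRingEnd ℂ) u = 1 := by
    rw [Complex.mul_conj, Complex.normSq_eq_norm_sq, hu]; norm_num
  have h2 : u ^ 2 + c * u + 1 = u * ((2 * u.re + c : ℝ) : ℂ) := by
    have h3 : ((2 * u.re : ℝ) : ℂ) = u + (starRingEnd ℂ) u := (Complex.add_conj u).symm
    push_cast at h3 ⊢
    rw [h3, mul_add, mul_add, h1]; ring
  rw [h2, norm_mul, hu, one_mul, Complex.norm_real, Real.norm_eq_abs]

theorem ofReal_log_le_lintegral_of_growth {Q : ℂ → ℂ} {c : ℂ} {R C : ℝ} (hR : 0 < R)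
    (hR1 : R ≤ 1 / 4) (hc1 : 1 / 2 ≤ ‖c‖) (hc2 : ‖c‖ ≤ 2)
    (hQ : AnalyticOnNhd ℂ Q (closedBall c R)) (h0 : Q c ≠ 0) (hC : 1 ≤ C) {σ : ℂ → ℝ}
    (hσm : Measurable σ) (hσ0 : ∀ z, 0 ≤ σ z) {Z : Set ℂ} (hZ : Z.Countable)
    (hb : ∀ z ∈ closedBall c R, z ∉ Z → ‖Q z‖ * |‖z‖ - 1| ≤ C * Real.exp (σ z)) :
    ENNReal.ofReal (2 * Real.pi * (Real.log ‖Q c‖ - Real.log (8 * C / R))) ≤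
      ∫⁻ θ in Ioo (-Real.pi) Real.pi, ENNReal.ofReal (σ (circleMap c R θ)) := by
  set x : ℝ := ‖c‖ with hx
  have hx0 : 0 < x := by linarith
  have hcne : c ≠ 0 := norm_pos_iff.1 hx0
  set b : ℝ := (x ^ 2 + R ^ 2 - 1) / (x * R) with hbdef
  set q : ℂ → ℂ := fun z => ((z - c) * x / (R * c)) ^ 2 + b * ((z - c) * x / (R * c)) + 1 with hq
  have hqc : q c = 1 := by simp [hq]
  have hqd : Differentiable ℂ q := by fun_prop
  have hA : AnalyticOnNhd ℂ (fun z => Q z * q z) (closedBall c R) := fun z hz =>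
    (hQ z hz).mul (hqd.analyticAt z)
  have h8 : 1 ≤ 8 * C / R := by
    rw [le_div_iff₀ hR]; linarith
  have key := ofReal_log_le_lintegral_circle hR hA (by rw [hqc, mul_one]; exact h0) h8 hσm hσ0 hZ
    (fun z hz hzZ => ?_)
  · rwa [hqc, mul_one] at key
  have hzR : ‖z - c‖ = R := by rwa [mem_sphere_iff_norm] at hz
  set u : ℂ := (z - c) * x / (R * c) with hu
  have hRne : (R : ℂ) ≠ 0 := by exact_mod_cast hR.ne'
  have hxne : (x : ℂ) ≠ 0 := by exact_mod_cast hx0.ne'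
  have hu1 : ‖u‖ = 1 := by
    rw [hu, norm_div, norm_mul, norm_mul, hzR, Complex.norm_real, Complex.norm_real,
      Real.norm_of_nonneg hx0.le, Real.norm_of_nonneg hR.le, ← hx]
    exact div_self (by positivity)
  have hz2 : z = c * (1 + ((R / x : ℝ) : ℂ) * u) := by
    rw [hu]; push_cast; field_simp; ring
  have hzn : ‖z‖ ^ 2 = x ^ 2 + 2 * x * R * u.re + R ^ 2 := by
    have hun : u.re ^ 2 + u.im ^ 2 = 1 := by
      have := Complex.sq_norm u
      rw [hu1, Complex.normSq_apply] at this; nlinarith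
    have h1 : ‖1 + ((R / x : ℝ) : ℂ) * u‖ ^ 2 = 1 + 2 * (R / x) * u.re + (R / x) ^ 2 := by
      rw [Complex.sq_norm, Complex.normSq_apply]
      simp only [add_re, one_re, add_im, one_im, re_ofReal_mul, im_ofReal_mul]
      linear_combination (R / x) ^ 2 * hun
    rw [hz2, norm_mul, mul_pow, h1, ← hx]
    field_simp
  have hfac : 2 * u.re + b = (‖z‖ - 1) * (‖z‖ + 1) / (x * R) := by
    rw [hbdef]; field_simp; linarith [hzn]
  have hz3 : ‖z‖ ≤ 9 / 4 := by
    have : ‖z‖ ≤ ‖z - c‖ + ‖c‖ := by simpa using norm_add_le (z - c) c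
    linarith
  have hqz : ‖q z‖ ≤ |‖z‖ - 1| * (8 / R) := by
    have : q z = u ^ 2 + b * u + 1 := rfl
    rw [this, norm_sq_add_mul_add_one hu1, hfac, abs_div, abs_mul,
      abs_of_pos (by positivity : 0 < x * R), abs_of_nonneg (by positivity : 0 ≤ ‖z‖ + 1), mul_div_assoc]
    refine mul_le_mul_of_nonneg_left ?_ (abs_nonneg _)
    rw [div_le_div_iff₀ (by positivity) hR]
    nlinarith [norm_nonneg z]
  have := hb z (sphere_subset_closedBall hz) hzZ
  calc ‖Q z * q z‖ ≤ ‖Q z‖ * (|‖z‖ - 1| * (8 / R)) := by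
        rw [norm_mul]; exact mul_le_mul_of_nonneg_left hqz (norm_nonneg _)
    _ = (‖Q z‖ * |‖z‖ - 1|) * (8 / R) := by ring
    _ ≤ (C * Real.exp (σ z)) * (8 / R) := mul_le_mul_of_nonneg_right this (by positivity)
    _ = 8 * C / R * Real.exp (σ z) := by ring

/-- Integration in polar coordinates about an arbitrary centre. -/
theorem lintegral_eq_lintegral_circleMap (c : ℂ) {g : ℂ → ENNReal} (hg : Measurable g) :
    ∫⁻ z, g z = ∫⁻ ρ in Ioi (0 : ℝ), ENNReal.ofReal ρ *
      ∫⁻ θ in Ioo (-Real.pi) Real.pi, g (circleMap c ρ θ) := by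
  rw [← lintegral_add_left_eq_self g c, ← Complex.lintegral_comp_polarCoord_symm]
  have hsymm : ∀ p : ℝ × ℝ, c + Complex.polarCoord.symm p = circleMap c p.1 p.2 := fun p => by
    rw [Complex.polarCoord_symm_apply, circleMap, Complex.exp_mul_I]
    push_cast; ring
  simp_rw [hsymm, smul_eq_mul]
  have hm : Measurable fun p : ℝ × ℝ => ENNReal.ofReal p.1 * g (circleMap c p.1 p.2) := by
    refine (ENNReal.measurable_ofReal.comp measurable_fst).mul (hg.comp ?_)
    unfold circleMap
    fun_prop
  have ht : _root_.polarCoord.target = Ioi (0 : ℝ) ×ˢ Ioo (-Real.pi) Real.pi := rfl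
  rw [ht, Measure.volume_eq_prod, ← Measure.prod_restrict, lintegral_prod _ hm.aemeasurable]
  refine lintegral_congr fun ρ => ?_
  have hm2 : Measurable fun θ => g (circleMap c ρ θ) := hg.comp (continuous_circleMap c ρ).measurable
  exact lintegral_const_mul (ENNReal.ofReal ρ) hm2

theorem ofReal_le_lintegral_ball {c : ℂ} {r D : ℝ} (hr : 0 < r) {g : ℂ → ENNReal} (hg : Measurable g)
    (h : ∀ ρ ∈ Ioo (r / 2) r, ENNReal.ofReal D ≤ ∫⁻ θ in Ioo (-Real.pi) Real.pi, g (circleMap c ρ θ)) :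
    ENNReal.ofReal (D * (r ^ 2 / 4)) ≤ ∫⁻ z in ball c r, g z := by
  rw [← lintegral_indicator measurableSet_ball,
    lintegral_eq_lintegral_circleMap c (hg.indicator measurableSet_ball)]
  have hsub : Ioo (r / 2) r ⊆ Ioi (0 : ℝ) := fun x hx => lt_trans (by linarith) hx.1
  calc ENNReal.ofReal (D * (r ^ 2 / 4))
      = (ENNReal.ofReal (r / 2) * ENNReal.ofReal D) * volume (Ioo (r / 2) r) := by
        rw [Real.volume_Ioo, ← ENNReal.ofReal_mul (by positivity), mul_comm _ (ENNReal.ofReal (r - r/2)),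
          ← ENNReal.ofReal_mul (by linarith)]
        congr 1; ring
    _ = ∫⁻ ρ in Ioo (r / 2) r, (ENNReal.ofReal (r / 2) * ENNReal.ofReal D) := by
        rw [setLIntegral_const]
    _ ≤ ∫⁻ ρ in Ioo (r / 2) r, ENNReal.ofReal ρ * ∫⁻ θ in Ioo (-Real.pi) Real.pi,
          (ball c r).indicator g (circleMap c ρ θ) := by
        refine setLIntegral_mono' measurableSet_Ioo fun ρ hρ => ?_
        refine mul_le_mul' (ENNReal.ofReal_le_ofReal hρ.1.le) ((h ρ hρ).trans (le_of_eq ?_))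
        refine lintegral_congr fun θ => ?_
        rw [indicator_of_mem]
        rw [mem_ball, dist_eq_norm, circleMap_sub_center, norm_circleMap_zero,
          abs_of_pos (by linarith [hρ.1])]
        exact hρ.2
    _ ≤ _ := lintegral_mono_set hsub

/-- The mass of a thin annulus, in polar coordinates. -/
theorem lintegral_annulus_le {a : ℝ} {g : ℂ → ENNReal} (hg : Measurable g) {e : ENNReal}
    (h : ∀ ρ ∈ Ioo a 1, ∫⁻ θ in Ioo (-Real.pi) Real.pi, g (circleMap 0 ρ θ) ≤ e) :
    ∫⁻ z in {z : ℂ | a < ‖z‖ ∧ ‖z‖ < 1}, g z ≤ ENNReal.ofReal (1 - a) * e := by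
  have hms : MeasurableSet {z : ℂ | a < ‖z‖ ∧ ‖z‖ < 1} :=
    (measurableSet_lt measurable_const measurable_norm).inter
      (measurableSet_lt measurable_norm measurable_const)
  rw [← lintegral_indicator hms, lintegral_eq_lintegral_circleMap 0 (hg.indicator hms)]
  calc _ ≤ ∫⁻ ρ in Ioi (0 : ℝ), (Ioo a 1).indicator (fun _ => e) ρ := by
        refine setLIntegral_mono' measurableSet_Ioi fun ρ hρ => ?_
        have hn : ∀ θ, ‖circleMap 0 ρ θ‖ = ρ := fun θ => by
          rw [norm_circleMap_zero, abs_of_pos hρ]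
        by_cases hmem : ρ ∈ Ioo a 1
        · rw [indicator_of_mem hmem]
          have h1 : ENNReal.ofReal ρ ≤ 1 := by
            rw [← ENNReal.ofReal_one]; exact ENNReal.ofReal_le_ofReal hmem.2.le
          calc _ ≤ 1 * e := mul_le_mul' h1 (le_trans (lintegral_mono fun θ => indicator_le_self _ _ _) (h ρ hmem))
            _ = e := one_mul e
        · rw [indicator_of_notMem hmem]
          have : ∀ θ, {z : ℂ | a < ‖z‖ ∧ ‖z‖ < 1}.indicator g (circleMap 0 ρ θ) = 0 := fun θ => by
            refine indicator_of_notMem ?_ _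
            rw [Set.mem_ofPred_eq, hn]; exact hmem
          simp [this]
    _ ≤ ∫⁻ ρ : ℝ, (Ioo a 1).indicator (fun _ => e) ρ := setLIntegral_le_lintegral _ _
    _ = ENNReal.ofReal (1 - a) * e := by
        rw [lintegral_indicator measurableSet_Ioo, setLIntegral_const, Real.volume_Ioo, mul_comm]

/-- The denominator of the kernel used to majorize near the cusps; `ζ` is the radial projection. -/
def cuspDenom (E : Set ℂ) (l ζ : ℂ) : ℂ :=
  ((1 + 3 * (cdist E ζ ^ 2 / 100) : ℝ) : ℂ) - (starRingEnd ℂ) ζ * l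

/-- A kernel, holomorphic in `l`, with positive real part on the cusp neighbourhood. -/
def cuspKer (E : Set ℂ) (l z : ℂ) : ℂ := (cuspDenom E l (z / ‖z‖))⁻¹ + 1 / 25

section
variable {E : Set ℂ} {l ζ : ℂ} {τ : ℝ}

theorem norm_one_sub_conj_mul (hζ : ‖ζ‖ = 1) (l : ℂ) : ‖1 - (starRingEnd ℂ) ζ * l‖ = ‖l - ζ‖ := by
  rw [← norm_sub_rev, norm_conj_mul_sub_one hζ]

theorem re_cuspDenom_ge (hζ : ‖ζ‖ = 1) (hl : ‖l‖ ≤ 1 + cdist E l ^ 2 / 100 - τ) :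
    τ - 1 / 25 * ‖cuspDenom E l ζ‖ ^ 2 ≤ (cuspDenom E l ζ).re := by
  set d := cdist E ζ with hd
  have hd0 : 0 ≤ d := cdist_nonneg E ζ
  have hd1 : d ≤ 1 := cdist_le_one E ζ
  set s := ‖l - ζ‖ with hs
  have h1 : cdist E l ≤ d + s := cdist_le_add E l ζ
  have hl0 := cdist_nonneg E l
  have h2 : ((starRingEnd ℂ) ζ * l).re ≤ ‖l‖ := by
    refine (Complex.re_le_norm _).trans ?_
    rw [norm_mul, RCLike.norm_conj, hζ, one_mul]
  have h3 : (cuspDenom E l ζ).re = 1 + 3 * (d ^ 2 / 100) - ((starRingEnd ℂ) ζ * l).re := by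
    rw [cuspDenom, sub_re, ofReal_re]
  have h4 : s ≤ ‖cuspDenom E l ζ‖ + 3 * (d ^ 2 / 100) := by
    have : 1 - (starRingEnd ℂ) ζ * l = cuspDenom E l ζ - ((3 * (d ^ 2 / 100) : ℝ) : ℂ) := by
      rw [cuspDenom]; push_cast; ring
    rw [hs, ← norm_one_sub_conj_mul hζ, this]
    refine (norm_sub_le _ _).trans ?_
    rw [Complex.norm_real, Real.norm_of_nonneg (by positivity)]
  have hs0 : 0 ≤ s := norm_nonneg _
  set W := ‖cuspDenom E l ζ‖
  have hW : 0 ≤ W := norm_nonneg _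
  have h5 : cdist E l ^ 2 ≤ 2 * d ^ 2 + 2 * s ^ 2 := by nlinarith [sq_nonneg (d - s)]
  have h6 : s ^ 2 ≤ 2 * W ^ 2 + 18 * (d ^ 2 / 100) ^ 2 := by
    nlinarith [sq_nonneg (W - 3 * (d ^ 2 / 100))]
  have h7 : (d ^ 2 / 100) ^ 2 ≤ d ^ 2 / 100 := by
    have : d ^ 2 ≤ 1 := by nlinarith
    nlinarith [sq_nonneg d]
  rw [h3]
  nlinarith [sq_nonneg d]

theorem norm_cuspDenom_le (hζ : ‖ζ‖ = 1) : ‖cuspDenom E l ζ‖ ≤ 3 * (cdist E ζ ^ 2 / 100) + ‖l - ζ‖ := by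
  have : cuspDenom E l ζ = ((3 * (cdist E ζ ^ 2 / 100) : ℝ) : ℂ) + (1 - (starRingEnd ℂ) ζ * l) := by
    rw [cuspDenom]; push_cast; ring
  rw [this]
  refine (norm_add_le _ _).trans ?_
  rw [Complex.norm_real, Real.norm_of_nonneg (by positivity), norm_one_sub_conj_mul hζ]

theorem le_norm_cuspDenom (hτ1 : τ ≤ 1) (hζ : ‖ζ‖ = 1)
    (hl : ‖l‖ ≤ 1 + cdist E l ^ 2 / 100 - τ) : τ / 2 ≤ ‖cuspDenom E l ζ‖ := by
  have h1 := re_cuspDenom_ge hζ hl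
  have h2 := Complex.re_le_norm (cuspDenom E l ζ)
  by_contra! h
  nlinarith [norm_nonneg (cuspDenom E l ζ)]

theorem re_cuspKer_ge (hτ : 0 < τ) (hτ1 : τ ≤ 1) {z : ℂ} (hz : z ≠ 0)
    (hl : ‖l‖ ≤ 1 + cdist E l ^ 2 / 100 - τ) :
    τ / ‖cuspDenom E l (z / ‖z‖)‖ ^ 2 ≤ (cuspKer E l z).re := by
  have hζ : ‖z / (‖z‖ : ℂ)‖ = 1 := by
    rw [norm_div, Complex.norm_real, norm_norm, div_self (norm_ne_zero_iff.2 hz)]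
  have h1 := re_cuspDenom_ge hζ hl
  have h2 := le_norm_cuspDenom hτ1 hζ hl
  have h3 : 0 < ‖cuspDenom E l (z / ‖z‖)‖ := by linarith
  have h4 : (1 / 25 : ℂ).re = 1 / 25 := by
    rw [show (1 / 25 : ℂ) = ((1 / 25 : ℝ) : ℂ) by push_cast; rfl, ofReal_re]
  rw [cuspKer, add_re, Complex.inv_re, Complex.normSq_eq_norm_sq, h4, div_add' _ _ _ (by positivity),
    div_le_div_iff_of_pos_right (by positivity)]
  linarith

theorem norm_cuspKer_le (hτ : 0 < τ) (hτ1 : τ ≤ 1) {z : ℂ} (hz : z ≠ 0)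
    (hl : ‖l‖ ≤ 1 + cdist E l ^ 2 / 100 - τ) : ‖cuspKer E l z‖ ≤ 3 / τ := by
  have hζ : ‖z / (‖z‖ : ℂ)‖ = 1 := by
    rw [norm_div, Complex.norm_real, norm_norm, div_self (norm_ne_zero_iff.2 hz)]
  have h2 := le_norm_cuspDenom hτ1 hζ hl
  have h3 : ‖cuspDenom E l (z / ‖z‖)‖⁻¹ ≤ 2 / τ := by
    rw [← inv_div τ 2]; exact inv_anti₀ (by positivity) h2
  have h4 : ‖(1 / 25 : ℂ)‖ ≤ 1 / τ := by
    have : ‖(1 / 25 : ℂ)‖ = 1 / 25 := by norm_num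
    rw [this]
    exact one_div_le_one_div_of_le hτ (by linarith)
  calc _ ≤ ‖cuspDenom E l (z / ‖z‖)‖⁻¹ + ‖(1 / 25 : ℂ)‖ := by
        rw [← norm_inv]; exact norm_add_le _ _
    _ ≤ 2 / τ + 1 / τ := add_le_add h3 h4
    _ = 3 / τ := by ring

theorem measurable_cuspDenom (l : ℂ) : Measurable fun z : ℂ => cuspDenom E l (z / ‖z‖) := by
  have h : Measurable fun z : ℂ => z / (‖z‖ : ℂ) :=
    measurable_id.div (Complex.measurable_ofReal.comp measurable_norm)
  have h2 : Continuous fun ζ : ℂ => cuspDenom E l ζ := by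
    have := continuous_cdist E
    unfold cuspDenom
    fun_prop
  exact h2.measurable.comp h

theorem measurable_cuspKer (l : ℂ) : Measurable (cuspKer E l) :=
  (measurable_cuspDenom l).inv.add_const _

theorem integrable_cuspKer (hτ : 0 < τ) (hτ1 : τ ≤ 1) {μ : Measure ℂ} [IsFiniteMeasure μ]
    (hμ : ∀ᵐ z ∂μ, z ≠ 0) (hl : ‖l‖ ≤ 1 + cdist E l ^ 2 / 100 - τ) : Integrable (cuspKer E l) μ :=
  Integrable.of_bound (measurable_cuspKer l).aestronglyMeasurable (3 / τ) <| by
    filter_upwards [hμ] with z hz using norm_cuspKer_le hτ hτ1 hz hl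

theorem differentiableOn_integral_cuspKer (hτ : 0 < τ) (hτ1 : τ ≤ 1) {μ : Measure ℂ}
    [IsFiniteMeasure μ] (hμ : ∀ᵐ z ∂μ, z ≠ 0) :
    DifferentiableOn ℂ (fun l => ∫ z, cuspKer E l z ∂μ) (cuspNhd E τ) := by
  intro l hl
  refine DifferentiableAt.differentiableWithinAt ?_
  have hnhds : cuspNhd E τ ∈ nhds l := (isOpen_cuspNhd E τ).mem_nhds hl
  have hle : ∀ x ∈ cuspNhd E τ, ‖x‖ ≤ 1 + cdist E x ^ 2 / 100 - τ := fun x hx =>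
    le_of_lt hx
  refine (hasDerivAt_integral_of_dominated_loc_of_deriv_le
    (F' := fun l z => (starRingEnd ℂ) (z / ‖z‖) / cuspDenom E l (z / ‖z‖) ^ 2)
    (bound := fun _ => (2 / τ) ^ 2) hnhds
    (Eventually.of_forall fun x => (measurable_cuspKer x).aestronglyMeasurable)
    (integrable_cuspKer hτ hτ1 hμ (hle l hl)) ?_ ?_ (integrable_const _) ?_).2.differentiableAt
  · refine Measurable.aestronglyMeasurable (Measurable.div ?_ ((measurable_cuspDenom l).pow_const 2))
    exact Complex.continuous_conj.measurable.comp
      (measurable_id.div (Complex.measurable_ofReal.comp measurable_norm))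
  · filter_upwards [hμ] with z hz x hx
    have hζ : ‖z / (‖z‖ : ℂ)‖ = 1 := by
      rw [norm_div, Complex.norm_real, norm_norm, div_self (norm_ne_zero_iff.2 hz)]
    have h2 := le_norm_cuspDenom hτ1 hζ (hle x hx)
    rw [norm_div, RCLike.norm_conj, hζ, norm_pow, one_div, ← inv_pow]
    refine pow_le_pow_left₀ (by positivity) ?_ 2
    rw [← inv_div τ 2]; exact inv_anti₀ (by positivity) h2
  · filter_upwards [hμ] with z hz x hx
    have hζ : ‖z / (‖z‖ : ℂ)‖ = 1 := by
      rw [norm_div, Complex.norm_real, norm_norm, div_self (norm_ne_zero_iff.2 hz)]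
    have h2 := le_norm_cuspDenom hτ1 hζ (hle x hx)
    have hne : cuspDenom E x (z / ‖z‖) ≠ 0 := norm_pos_iff.1 (by linarith)
    have hd : HasDerivAt (fun l => cuspDenom E l (z / ‖z‖)) (-(starRingEnd ℂ) (z / ‖z‖)) x :=
      (((hasDerivAt_id x).const_mul ((starRingEnd ℂ) (z / ‖z‖))).const_sub
        ((1 + 3 * (cdist E (z / ‖z‖) ^ 2 / 100) : ℝ) : ℂ)).congr_deriv (by rw [mul_one])
    exact ((hd.inv hne).add_const _).congr_deriv (by rw [neg_neg])
end

/-- The measure with density `σ` on the annulus of width `2τ` inside the unit circle. -/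
def annulusMeasure (σ : ℂ → ℝ) (τ : ℝ) : Measure ℂ :=
  (volume.restrict {z : ℂ | 1 - 2 * τ < ‖z‖ ∧ ‖z‖ < 1}).withDensity fun z => ENNReal.ofReal (σ z)

/-- The holomorphic multiplier used to majorize near the cusps. -/
def cuspMult (E : Set ℂ) (σ : ℂ → ℝ) (τ : ℝ) (l : ℂ) : ℂ :=
  Complex.exp (-((2500 / τ : ℝ) : ℂ) * ∫ z, cuspKer E l z ∂(annulusMeasure σ τ))

section
variable {E : Set ℂ} {σ : ℂ → ℝ} {τ e : ℝ}

theorem measurableSet_annulus (a : ℝ) : MeasurableSet {z : ℂ | a < ‖z‖ ∧ ‖z‖ < 1} :=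
  (measurableSet_lt measurable_const measurable_norm).inter
    (measurableSet_lt measurable_norm measurable_const)

theorem annulusMeasure_univ_le (hσm : Measurable σ)
    (he : ∀ ρ ∈ Ioo (1 - 2 * τ) 1, ∫⁻ θ in Ioo (-Real.pi) Real.pi,
      ENNReal.ofReal (σ (circleMap 0 ρ θ)) ≤ ENNReal.ofReal e) (hτ : 0 ≤ τ) :
    annulusMeasure σ τ univ ≤ ENNReal.ofReal (2 * τ * e) := by
  rw [annulusMeasure, withDensity_apply _ MeasurableSet.univ, Measure.restrict_univ]
  refine (lintegral_annulus_le hσm.ennreal_ofReal he).trans (le_of_eq ?_)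
  rw [← ENNReal.ofReal_mul (by linarith)]
  congr 1; ring

theorem isFiniteMeasure_annulusMeasure (hσm : Measurable σ)
    (he : ∀ ρ ∈ Ioo (1 - 2 * τ) 1, ∫⁻ θ in Ioo (-Real.pi) Real.pi,
      ENNReal.ofReal (σ (circleMap 0 ρ θ)) ≤ ENNReal.ofReal e) (hτ : 0 ≤ τ) :
    IsFiniteMeasure (annulusMeasure σ τ) :=
  ⟨(annulusMeasure_univ_le hσm he hτ).trans_lt ENNReal.ofReal_lt_top⟩

theorem ae_mem_annulus : ∀ᵐ z ∂(annulusMeasure σ τ), 1 - 2 * τ < ‖z‖ ∧ ‖z‖ < 1 :=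
  (withDensity_absolutelyContinuous _ _).ae_le (ae_restrict_mem (measurableSet_annulus _))

theorem ae_annulus_ne_zero (hτ : τ ≤ 1 / 2) : ∀ᵐ z ∂(annulusMeasure σ τ), z ≠ 0 := by
  filter_upwards [ae_mem_annulus] with z hz
  refine norm_pos_iff.1 (lt_of_le_of_lt ?_ hz.1)
  linarith

theorem lintegral_le_annulusMeasure (hσ1 : ∀ z, 1 ≤ ‖z‖ → σ z = 0) {s : Set ℂ}
    (hs : MeasurableSet s) (hsub : ∀ z ∈ s, 1 - 2 * τ < ‖z‖) :
    ∫⁻ z in s, ENNReal.ofReal (σ z) ≤ annulusMeasure σ τ s := by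
  rw [annulusMeasure, withDensity_apply _ hs, Measure.restrict_restrict hs,
    ← lintegral_indicator hs, ← lintegral_indicator (hs.inter (measurableSet_annulus _))]
  refine lintegral_mono fun z => ?_
  by_cases hz : z ∈ s
  · rw [indicator_of_mem hz]
    rcases lt_or_ge ‖z‖ 1 with h | h
    · rw [indicator_of_mem (s := s ∩ {z : ℂ | 1 - 2 * τ < ‖z‖ ∧ ‖z‖ < 1}) ⟨hz, hsub z hz, h⟩]
    · rw [hσ1 z h, ENNReal.ofReal_zero]; exact zero_le
  · rw [indicator_of_notMem hz]; exact zero_le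

theorem norm_cuspMult (l : ℂ) (hinteg : Integrable (cuspKer E l) (annulusMeasure σ τ)) :
    ‖cuspMult E σ τ l‖ = Real.exp (-(2500 / τ * ∫ z, (cuspKer E l z).re ∂(annulusMeasure σ τ))) := by
  have h : (∫ z, cuspKer E l z ∂(annulusMeasure σ τ)).re = ∫ z, (cuspKer E l z).re ∂(annulusMeasure σ τ) :=
    (integral_re hinteg).symm
  rw [cuspMult, Complex.norm_exp, ← Complex.ofReal_neg, Complex.re_ofReal_mul, h]
  congr 1; ring

/-- Near a bad boundary point of the cusp neighbourhood the multiplier beats the area mean of `σ`. -/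
theorem log_norm_mul_cuspMult_le {Q : ℂ → ℂ} {C : ℝ} {Z : Set ℂ} (hE : E ⊆ sphere 0 1)
    (hne : E.Nonempty) (hτ : 0 < τ) (hτ1 : τ ≤ 1 / 100)
    (hQ : DifferentiableOn ℂ Q {z | 0 < cdist E z}) (hC : 1 ≤ C)
    (hσm : Measurable σ) (hσ0 : ∀ z, 0 ≤ σ z) (hσ1 : ∀ z, 1 ≤ ‖z‖ → σ z = 0) (hZ : Z.Countable)
    (hb : ∀ z, 0 < cdist E z → z ∉ Z → ‖Q z‖ * |‖z‖ - 1| ≤ C * Real.exp (σ z))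
    [IsFiniteMeasure (annulusMeasure σ τ)]
    {l : ℂ} (hl : ‖l‖ = 1 + cdist E l ^ 2 / 100 - τ) (hbad : cdist E l ^ 2 / 100 < 2 * τ) :
    ‖Q l * cuspMult E σ τ l‖ ≤ 64 * C / τ := by
  rcases eq_or_ne (Q l) 0 with h0 | h0
  · rw [h0, zero_mul, norm_zero]; positivity
  set d := cdist E l with hd
  have hd0 : 0 ≤ d := cdist_nonneg E l
  have hdlow : τ / 2 ≤ d := by
    rcases le_or_gt (d ^ 2 / 100) (τ / 2) with h | h
    · refine le_trans (le_min (by linarith) ?_) (min_abs_norm_sub_one_le_cdist hE hne l)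
      rw [hl, abs_of_nonpos (by linarith)]; linarith
    · nlinarith
  have hlow : 1 - τ ≤ ‖l‖ := by rw [hl]; nlinarith [sq_nonneg d]
  have hup : ‖l‖ ≤ 1 + τ := by rw [hl]; linarith
  have hclosed : ∀ ρ ≤ τ / 4, ∀ z ∈ closedBall l ρ, 0 < cdist E z := fun ρ hρ z hz => by
    have h1 := cdist_le_add E l z
    rw [mem_closedBall, dist_eq_norm, norm_sub_rev] at hz
    linarith
  have hopen : IsOpen {z | 0 < cdist E z} := isOpen_lt continuous_const (continuous_cdist E)
  have hlog : ∀ ρ ∈ Ioo (τ / 4 / 2) (τ / 4),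
      ENNReal.ofReal (2 * Real.pi * (Real.log ‖Q l‖ - Real.log (64 * C / τ))) ≤
      ∫⁻ θ in Ioo (-Real.pi) Real.pi, ENNReal.ofReal (σ (circleMap l ρ θ)) := fun ρ hρ => by
    have hρ0 : 0 < ρ := lt_trans (by positivity) hρ.1
    refine le_trans (ENNReal.ofReal_le_ofReal ?_) (ofReal_log_le_lintegral_of_growth (Q := Q) (C := C)
      hρ0 (by linarith [hρ.2]) (by linarith) (by linarith) (fun z hz =>
        hQ.analyticAt (hopen.mem_nhds (hclosed ρ hρ.2.le z hz))) h0 hC hσm hσ0 hZ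
      (fun z hz => hb z (hclosed ρ hρ.2.le z hz)))
    refine mul_le_mul_of_nonneg_left ?_ (by positivity)
    have : Real.log (8 * C / ρ) ≤ Real.log (64 * C / τ) := by
      refine Real.log_le_log (by positivity) ?_
      rw [div_le_div_iff₀ hρ0 hτ]
      nlinarith [hρ.1]
    linarith
  have harea := ofReal_le_lintegral_ball (by positivity : 0 < τ / 4) hσm.ennreal_ofReal hlog
  have hball : ∀ z ∈ ball l (τ / 4), 1 - 2 * τ < ‖z‖ := fun z hz => by
    rw [mem_ball, dist_eq_norm, norm_sub_rev] at hz
    have := norm_sub_norm_le l z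
    linarith
  have hmass := harea.trans (lintegral_le_annulusMeasure hσ1 measurableSet_ball hball)
  rw [ENNReal.ofReal_le_iff_le_toReal (measure_ne_top _ _)] at hmass
  set m := (annulusMeasure σ τ (ball l (τ / 4))).toReal with hm
  have hm0 : 0 ≤ m := ENNReal.toReal_nonneg
  have hae : ∀ᵐ z ∂(annulusMeasure σ τ), z ≠ 0 := ae_annulus_ne_zero (by linarith)
  have hinteg := integrable_cuspKer (E := E) hτ (by linarith) hae hl.le
  have hre : m * (1 / (196 * τ)) ≤ ∫ z, (cuspKer E l z).re ∂(annulusMeasure σ τ) := by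
    have h1 : ∫ z, (ball l (τ / 4)).indicator (fun _ => 1 / (196 * τ)) z ∂(annulusMeasure σ τ) =
        m * (1 / (196 * τ)) := by
      rw [integral_indicator_const _ measurableSet_ball, smul_eq_mul]; rfl
    rw [← h1]
    refine integral_mono_ae ((integrable_const _).indicator measurableSet_ball) hinteg.re ?_
    filter_upwards [hae, ae_mem_annulus] with z hz hzA
    have hge := re_cuspKer_ge (E := E) hτ (by linarith) hz hl.le
    by_cases hzb : z ∈ ball l (τ / 4)
    · rw [indicator_of_mem hzb]
      refine le_trans ?_ hge
      have hζ : ‖z / (‖z‖ : ℂ)‖ = 1 := by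
        rw [norm_div, Complex.norm_real, norm_norm, div_self (norm_ne_zero_iff.2 hz)]
      have hzn : 0 < ‖z‖ := norm_pos_iff.2 hz
      have hzl : ‖z - l‖ < τ / 4 := by rwa [mem_ball, dist_eq_norm] at hzb
      have h2 : ‖z - z / ‖z‖‖ = 1 - ‖z‖ := by
        have : z - z / ‖z‖ = z / ‖z‖ * ((‖z‖ - 1 : ℝ) : ℂ) := by
          have : (‖z‖ : ℂ) ≠ 0 := by exact_mod_cast hzn.ne'
          push_cast; field_simp
        rw [this, norm_mul, hζ, one_mul, Complex.norm_real, Real.norm_eq_abs,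
          abs_of_nonpos (by linarith)]; ring
      have h3 : ‖l - z / ‖z‖‖ ≤ 3 / 2 * τ := by
        have h4 : ‖l - z / ‖z‖‖ ≤ ‖l - z‖ + ‖z - z / ‖z‖‖ := by
          simpa using norm_add_le (l - z) (z - z / ‖z‖)
        have h5 := norm_sub_norm_le l z
        rw [norm_sub_rev] at hzl
        linarith
      have h4 : cdist E (z / ‖z‖) ≤ d + 3 / 2 * τ := by
        refine (cdist_le_add E _ l).trans ?_
        rw [norm_sub_rev]; linarith
      have h5 : ‖cuspDenom E l (z / ‖z‖)‖ ≤ 14 * τ := by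
        refine (norm_cuspDenom_le hζ).trans ?_
        have h6 := cdist_nonneg E (z / ‖z‖)
        have h7 : cdist E (z / ‖z‖) ^ 2 ≤ 2 * d ^ 2 + 2 * (3 / 2 * τ) ^ 2 := by
          nlinarith [sq_nonneg (d - 3 / 2 * τ)]
        nlinarith
      have h6 := le_norm_cuspDenom (E := E) (by linarith : τ ≤ 1) hζ hl.le
      have h7 : 0 < ‖cuspDenom E l (z / ‖z‖)‖ := by linarith
      rw [div_le_div_iff₀ (by positivity) (by positivity)]
      nlinarith
    · rw [indicator_of_notMem hzb]
      exact le_trans (by positivity) hge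
  rw [norm_mul, norm_cuspMult l hinteg]
  have hQ0 : 0 < ‖Q l‖ := norm_pos_iff.2 h0
  rw [← Real.exp_log hQ0, ← Real.exp_add, ← Real.exp_log (by positivity : 0 < 64 * C / τ),
    Real.exp_le_exp]
  have hpi : 3 < Real.pi := Real.pi_gt_three
  have h1 : 2500 / τ * (m * (1 / (196 * τ))) ≤
      2500 / τ * ∫ z, (cuspKer E l z).re ∂(annulusMeasure σ τ) :=
    mul_le_mul_of_nonneg_left hre (by positivity)
  have h2 : 2500 / τ * (m * (1 / (196 * τ))) = (625 / 49) * (m / τ ^ 2) := by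
    field_simp; ring
  have h3 : Real.log ‖Q l‖ - Real.log (64 * C / τ) ≤ 625 / 49 * (m / τ ^ 2) := by
    have h4 : (Real.log ‖Q l‖ - Real.log (64 * C / τ)) * Real.pi ≤ 32 * (m / τ ^ 2) := by
      rw [← mul_div_assoc, le_div_iff₀ (by positivity)]
      nlinarith
    have h5 : 0 ≤ m / τ ^ 2 := by positivity
    by_contra! h
    nlinarith
  linarith
end

section
variable {E : Set ℂ} {Q F : ℂ → ℂ} {B C₀ : ℝ}

theorem closure_cuspNhd_subset (E : Set ℂ) {τ τ' : ℝ} (h : τ' < τ) :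
    closure (cuspNhd E τ) ⊆ cuspNhd E τ' := fun z hz => by
  have hc : IsClosed {z : ℂ | ‖z‖ ≤ 1 + cdist E z ^ 2 / 100 - τ} :=
    isClosed_le continuous_norm (by have := continuous_cdist E; fun_prop)
  have h1 : ‖z‖ ≤ 1 + cdist E z ^ 2 / 100 - τ :=
    closure_minimal (s := cuspNhd E τ) (t := {z : ℂ | ‖z‖ ≤ 1 + cdist E z ^ 2 / 100 - τ})
      (fun w hw => le_of_lt (show ‖w‖ < 1 + cdist E w ^ 2 / 100 - τ from hw)) hc hz
  exact lt_of_le_of_lt h1 (by linarith)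

theorem norm_mul_le_of_small_mass (hE : E ⊆ sphere 0 1) (hne : E.Nonempty) (hB : 0 ≤ B)
    (hQ : DifferentiableOn ℂ Q {z | 0 < cdist E z})
    (hF : DifferentiableOn ℂ F (cuspNhd E 0)) (hFB : ∀ z ∈ cuspNhd E 0, ‖F z‖ ≤ B * cdist E z ^ 4)
    (hout : ∀ z, 1 < ‖z‖ → ‖Q z‖ * (‖z‖ - 1) ≤ C₀)
    {σ : ℂ → ℝ} {τ τ₀ e C : ℝ} {Z : Set ℂ} (hτ : 0 < τ) (hτ1 : τ ≤ 1 / 100) (hττ₀ : τ < τ₀)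
    (hτ₀ : τ₀ ≤ 1) (hC : 1 ≤ C) (hsmall : 2560000 * C * B * τ ≤ 1) (he0 : 0 ≤ e)
    (hσm : Measurable σ) (hσ0 : ∀ z, 0 ≤ σ z) (hσ1 : ∀ z, 1 ≤ ‖z‖ → σ z = 0) (hZ : Z.Countable)
    (hb : ∀ z, 0 < cdist E z → z ∉ Z → ‖Q z‖ * |‖z‖ - 1| ≤ C * Real.exp (σ z))
    (he : ∀ ρ ∈ Ioo (1 - 2 * τ) 1, ∫⁻ θ in Ioo (-Real.pi) Real.pi,
      ENNReal.ofReal (σ (circleMap 0 ρ θ)) ≤ ENNReal.ofReal e)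
    {z : ℂ} (hz : z ∈ cuspNhd E τ₀) :
    ‖Q z * F z‖ ≤ max (200 * C₀ * B) 1 * Real.exp (15000 * e / τ₀) := by
  have := isFiniteMeasure_annulusMeasure hσm he hτ.le
  have hae : ∀ᵐ z ∂(annulusMeasure σ τ), z ≠ 0 := ae_annulus_ne_zero (by linarith)
  have hcl : closure (cuspNhd E τ) ⊆ cuspNhd E (τ / 2) := closure_cuspNhd_subset E (by linarith)
  have h0 : cuspNhd E (τ / 2) ⊆ cuspNhd E 0 := cuspNhd_mono E (by positivity)
  have hd : DiffContOnCl ℂ (fun l => Q l * F l * cuspMult E σ τ l) (cuspNhd E τ) := by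
    refine DifferentiableOn.diffContOnCl (DifferentiableOn.mono ?_ hcl)
    refine ((hQ.mono fun w hw => cdist_pos_of_mem_cuspNhd hE hne (h0 hw)).mul (hF.mono h0)).mul ?_
    exact ((differentiableOn_integral_cuspKer (by positivity) (by linarith) hae).const_mul _).cexp
  have hbdd : Bornology.IsBounded (cuspNhd E τ) :=
    (Metric.isBounded_closedBall (x := (0 : ℂ)) (r := 101 / 100)).subset fun w hw => by
      rw [mem_closedBall, dist_zero_right]
      exact norm_le_of_mem_cuspNhd (cuspNhd_mono E hτ.le hw)
  have hfront : ∀ l ∈ frontier (cuspNhd E τ),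
      ‖Q l * F l * cuspMult E σ τ l‖ ≤ max (200 * C₀ * B) 1 := by
    intro l hl
    have hleq : ‖l‖ = 1 + cdist E l ^ 2 / 100 - τ :=
      frontier_lt_subset_eq continuous_norm (by have := continuous_cdist E; fun_prop) hl
    have hl0 : l ∈ cuspNhd E 0 := h0 (hcl (frontier_subset_closure hl))
    have hinteg := integrable_cuspKer (E := E) hτ (by linarith) hae hleq.le
    have hk1 : ‖cuspMult E σ τ l‖ ≤ 1 := by
      rw [norm_cuspMult l hinteg, Real.exp_le_one_iff]
      have : 0 ≤ ∫ z, (cuspKer E l z).re ∂(annulusMeasure σ τ) := by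
        refine integral_nonneg_of_ae ?_
        filter_upwards [hae] with w hw
        exact le_trans (by positivity) (re_cuspKer_ge (E := E) hτ (by linarith) hw hleq.le)
      have := mul_nonneg (by positivity : 0 ≤ 2500 / τ) this
      linarith
    have hFl := hFB l hl0
    have hdpos := cdist_pos_of_mem_cuspNhd hE hne hl0
    have hd1 := cdist_le_one E l
    set d := cdist E l
    rcases le_or_gt (2 * τ) (d ^ 2 / 100) with hgood | hbad
    · refine le_trans ?_ (le_max_left _ _)
      have h1 : 1 < ‖l‖ := by rw [hleq]; linarith
      have h2 : ‖Q l‖ * (d ^ 2 / 200) ≤ C₀ := by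
        refine le_trans ?_ (hout l h1)
        exact mul_le_mul_of_nonneg_left (by linarith) (norm_nonneg _)
      have h3 : d ^ 4 ≤ d ^ 2 := by
        have : d ^ 2 ≤ 1 := by nlinarith
        nlinarith [sq_nonneg d]
      calc ‖Q l * F l * cuspMult E σ τ l‖ ≤ ‖Q l * F l‖ * 1 := by
            rw [norm_mul]; exact mul_le_mul_of_nonneg_left hk1 (norm_nonneg _)
        _ ≤ ‖Q l‖ * (B * d ^ 2) := by
            rw [mul_one, norm_mul]
            refine mul_le_mul_of_nonneg_left (hFl.trans ?_) (norm_nonneg _)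
            exact mul_le_mul_of_nonneg_left h3 hB
        _ = (‖Q l‖ * (d ^ 2 / 200)) * (200 * B) := by ring
        _ ≤ C₀ * (200 * B) := mul_le_mul_of_nonneg_right h2 (by positivity)
        _ = 200 * C₀ * B := by ring
    · refine le_trans ?_ (le_max_right _ _)
      have h1 := log_norm_mul_cuspMult_le hE hne hτ hτ1 hQ hC hσm hσ0 hσ1 hZ hb hleq hbad
      have h2 : d ^ 4 ≤ (200 * τ) ^ 2 := by
        have : d ^ 2 ≤ 200 * τ := by linarith
        nlinarith [sq_nonneg d]
      calc ‖Q l * F l * cuspMult E σ τ l‖ = ‖Q l * cuspMult E σ τ l‖ * ‖F l‖ := by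
            rw [← norm_mul]; congr 1; ring
        _ ≤ (64 * C / τ) * (B * (200 * τ) ^ 2) :=
            mul_le_mul h1 (hFl.trans (mul_le_mul_of_nonneg_left h2 hB)) (norm_nonneg _) (by positivity)
        _ = 2560000 * C * B * τ := by field_simp; ring
        _ ≤ 1 := hsmall
  have hmax := Complex.norm_le_of_forall_mem_frontier_norm_le hbdd hd hfront
    (subset_closure (cuspNhd_mono E hττ₀.le hz))
  have hzle : ‖z‖ ≤ 1 + cdist E z ^ 2 / 100 - τ₀ := le_of_lt hz
  have hinteg := integrable_cuspKer (E := E) (hτ.trans hττ₀) hτ₀ hae hzle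
  have hmass : (annulusMeasure σ τ).real univ ≤ 2 * τ * e :=
    ENNReal.toReal_le_of_le_ofReal (by positivity) (annulusMeasure_univ_le hσm he hτ.le)
  have hI : ∫ w, (cuspKer E z w).re ∂(annulusMeasure σ τ) ≤ 3 / τ₀ * (2 * τ * e) := by
    have h3 : 0 < τ₀ := hτ.trans hττ₀
    calc _ ≤ ∫ _w, 3 / τ₀ ∂(annulusMeasure σ τ) := by
          refine integral_mono_ae hinteg.re (integrable_const _) ?_
          filter_upwards [hae] with w hw
          exact (Complex.re_le_norm _).trans (norm_cuspKer_le h3 hτ₀ hw hzle)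
      _ = (annulusMeasure σ τ).real univ * (3 / τ₀) := by rw [integral_const, smul_eq_mul]
      _ ≤ 2 * τ * e * (3 / τ₀) := mul_le_mul_of_nonneg_right hmass (by positivity)
      _ = _ := by ring
  rw [norm_mul, norm_cuspMult z hinteg, Real.exp_neg, ← div_eq_mul_inv, div_le_iff₀ (Real.exp_pos _)] at hmax
  refine hmax.trans (mul_le_mul_of_nonneg_left ?_ (le_trans zero_le_one (le_max_right _ _)))
  rw [Real.exp_le_exp]
  calc _ ≤ 2500 / τ * (3 / τ₀ * (2 * τ * e)) := mul_le_mul_of_nonneg_left hI (by positivity)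
    _ = 15000 * e / τ₀ := by
      have h3 : 0 < τ₀ := hτ.trans hττ₀
      field_simp; ring

/-- A maximum principle on the cusp neighbourhood: a function holomorphic off `E` with controlled
growth on both sides of the circle is bounded after multiplication by a function vanishing fast
enough on `E`. -/
theorem norm_mul_le_of_mem_cuspNhd (hE : E ⊆ sphere 0 1) (hne : E.Nonempty) (hB : 0 ≤ B)
    (hQ : DifferentiableOn ℂ Q {z | 0 < cdist E z})
    (hF : DifferentiableOn ℂ F (cuspNhd E 0)) (hFB : ∀ z ∈ cuspNhd E 0, ‖F z‖ ≤ B * cdist E z ^ 4)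
    (hout : ∀ z, 1 < ‖z‖ → ‖Q z‖ * (‖z‖ - 1) ≤ C₀)
    (hin : ∀ e > 0, ∃ (σ : ℂ → ℝ) (C : ℝ) (Z : Set ℂ), Measurable σ ∧ (∀ z, 0 ≤ σ z) ∧
      (∀ z, 1 ≤ ‖z‖ → σ z = 0) ∧ Z.Countable ∧
      (∀ z, ‖z‖ < 1 → z ∉ Z → ‖Q z‖ * (1 - ‖z‖) ≤ C * Real.exp (σ z)) ∧
      ∀ ρ ∈ Ioo (0 : ℝ) 1, ∫⁻ θ in Ioo (-Real.pi) Real.pi,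
        ENNReal.ofReal (σ (circleMap 0 ρ θ)) ≤ ENNReal.ofReal e)
    {z : ℂ} (hz : z ∈ cuspNhd E 0) : ‖Q z * F z‖ ≤ max (200 * C₀ * B) 1 := by
  obtain ⟨τ₀, hτ₀, hτ₀1, hzτ⟩ : ∃ τ₀ > 0, τ₀ ≤ 1 ∧ z ∈ cuspNhd E τ₀ := by
    have hz' : ‖z‖ < 1 + cdist E z ^ 2 / 100 - 0 := hz
    refine ⟨min 1 ((1 + cdist E z ^ 2 / 100 - ‖z‖) / 2), lt_min one_pos (by linarith),
      min_le_left _ _, ?_⟩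
    have := min_le_right 1 ((1 + cdist E z ^ 2 / 100 - ‖z‖) / 2)
    show ‖z‖ < 1 + cdist E z ^ 2 / 100 - _
    linarith
  have hstep : ∀ e > 0, ‖Q z * F z‖ ≤ max (200 * C₀ * B) 1 * Real.exp (15000 * e / τ₀) := by
    intro e he
    obtain ⟨σ, C, Z, hσm, hσ0, hσ1, hZ, hb, hmass⟩ := hin e he
    set C' := max 1 (max C C₀) with hC'
    have h1 : 1 ≤ C' := le_max_left _ _
    have hCC : C ≤ C' := (le_max_left _ _).trans (le_max_right _ _)
    have hCC₀ : C₀ ≤ C' := (le_max_right _ _).trans (le_max_right _ _)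
    have hpos : 0 < 2560000 * C' * B + 1 := by positivity
    set τ := min (1 / 100) (min (τ₀ / 2) (1 / (2560000 * C' * B + 1))) with hτdef
    have hτpos : 0 < τ := lt_min (by norm_num) (lt_min (by positivity) (by positivity))
    have hτ1 : τ ≤ 1 / 100 := min_le_left _ _
    have hτ2 : τ ≤ τ₀ / 2 := (min_le_right _ _).trans (min_le_left _ _)
    have hτ3 : τ ≤ 1 / (2560000 * C' * B + 1) := (min_le_right _ _).trans (min_le_right _ _)
    rw [le_div_iff₀ hpos] at hτ3
    refine norm_mul_le_of_small_mass hE hne hB hQ hF hFB hout (σ := σ) (Z := Z) hτpos hτ1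
      (by linarith) hτ₀1 h1 (by nlinarith) he.le hσm hσ0 hσ1 hZ ?_
      (fun ρ hρ => hmass ρ ⟨by linarith [hρ.1], hρ.2⟩) hzτ
    intro w _ hwZ
    have hexp : 1 ≤ Real.exp (σ w) := Real.one_le_exp (hσ0 w)
    rcases lt_trichotomy ‖w‖ 1 with h | h | h
    · rw [abs_of_nonpos (by linarith), neg_sub]
      exact (hb w h hwZ).trans (mul_le_mul_of_nonneg_right hCC (Real.exp_pos _).le)
    · rw [h, sub_self, abs_zero, mul_zero]; positivity
    · rw [abs_of_pos (by linarith)]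
      exact (hout w h).trans (by nlinarith)
  have hlim : Tendsto (fun e : ℝ => max (200 * C₀ * B) 1 * Real.exp (15000 * e / τ₀))
      (nhdsWithin 0 (Ioi 0)) (nhds (max (200 * C₀ * B) 1 * Real.exp (15000 * 0 / τ₀))) :=
    (Continuous.tendsto (by fun_prop) 0).mono_left nhdsWithin_le_nhds
  rw [mul_zero, zero_div, Real.exp_zero, mul_one] at hlim
  exact ge_of_tendsto hlim (eventually_mem_nhdsWithin.mono fun e he => hstep e he)
end

theorem AnalyticOnNhd.countable_zeros {f : ℂ → ℂ} {U : Set ℂ} (hf : AnalyticOnNhd ℂ f U)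
    (hU : IsConnected U) {x : ℂ} (hx : x ∈ U) (hfx : f x ≠ 0) :
    {z ∈ U | f z = 0}.Countable := by
  have h1 := hf.preimage_zero_mem_codiscreteWithin hfx hx hU
  have h2 : {z ∈ U | f z = 0}ᶜ ∈ codiscreteWithin U := by
    refine mem_of_superset h1 fun z hz hz' => hz hz'.2
  have h3 := isDiscrete_of_codiscreteWithin h2
  rw [show {z ∈ U | f z = 0} ∩ U = {z ∈ U | f z = 0} from
    inter_eq_left.2 fun z hz => hz.1] at h3
  exact (HereditarilyLindelofSpace.isLindelof _).countable_of_isDiscrete h3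

theorem posLog_inv_norm_le (w : ℂ) {δ : ℝ} (hδ : 0 < δ) :
    Real.posLog ‖w‖⁻¹ ≤ δ + ‖w - 1‖ ^ 2 / δ - Real.log ‖w‖ := by
  have h1 : Real.posLog ‖w‖ ≤ ‖w - 1‖ := by
    rw [Real.posLog_eq_log_max_one (norm_nonneg _)]
    have h2 := Real.log_le_sub_one_of_pos (x := max 1 ‖w‖) (by positivity)
    have h3 : max 1 ‖w‖ ≤ 1 + ‖w - 1‖ := by
      refine max_le (by linarith [norm_nonneg (w - 1)]) ?_
      calc ‖w‖ = ‖1 + (w - 1)‖ := by ring_nf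
        _ ≤ ‖(1:ℂ)‖ + ‖w - 1‖ := norm_add_le _ _
        _ = _ := by simp
    linarith
  have h2 : ‖w - 1‖ ≤ δ + ‖w - 1‖ ^ 2 / δ := by
    rw [← sub_nonneg]
    have : δ + ‖w - 1‖ ^ 2 / δ - ‖w - 1‖ =
      ((δ - ‖w - 1‖ / 2) ^ 2 + 3 / 4 * ‖w - 1‖ ^ 2) / δ := by field_simp; ring
    rw [this]; positivity
  have h3 := Real.posLog_sub_posLog_inv (x := ‖w‖)
  linarith

theorem intervalIntegral_norm_sq_powSum_sub_one_le {c : ℕ → ℂ}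
    (hc : Summable fun n => ‖c n‖ ^ 2) {ρ : ℝ} (h0 : 0 < ρ) (h1 : ρ < 1) :
    ∫ θ in (0:ℝ)..(2 * Real.pi), ‖powSum c (circleMap 0 ρ θ) - 1‖ ^ 2 ≤
      2 * Real.pi * (‖c 0 - 1‖ ^ 2 + ∑' n, ‖c (n + 1)‖ ^ 2) := by
  have hcb : ∀ n, ‖c n‖ ≤ Real.sqrt (∑' n, ‖c n‖ ^ 2) := fun n =>
    Real.le_sqrt_of_sq_le (hc.le_tsum n fun _ _ => by positivity)
  set C := Real.sqrt (∑' n, ‖c n‖ ^ 2)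
  have hC : 0 ≤ C := Real.sqrt_nonneg _
  let c' : ℕ → ℂ := fun n => c n - if n = 0 then 1 else 0
  let b : ℕ → ℂ := fun n => c' n * (ρ : ℂ) ^ n
  have hc'b : ∀ n, ‖c' n‖ ≤ C + 1 := fun n => by
    refine (norm_sub_le _ _).trans (add_le_add (hcb n) ?_)
    split_ifs <;> simp
  have hb : Summable fun n => ‖b n‖ := by
    refine Summable.of_nonneg_of_le (fun _ => norm_nonneg _) (fun n => ?_)
      ((summable_geometric_of_lt_one h0.le h1).mul_left (C + 1))
    simp only [b, norm_mul, norm_pow, norm_real, Real.norm_of_nonneg h0.le]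
    gcongr
    exact hc'b n
  have heq : ∀ θ : ℝ, powSum c (circleMap 0 ρ θ) - 1 = powSum b (Complex.exp (θ * I)) := by
    intro θ
    have hz : ‖circleMap 0 ρ θ‖ < 1 := by simpa [abs_of_pos h0] using h1
    have hs := (hasSum_powSum hcb hz).sub (hasSum_ite_eq 0 (1:ℂ))
    refine hs.unique ?_
    have hs2 := hasSum_powSum_of_summable hb (z := Complex.exp (θ * I))
      (Complex.norm_exp_ofReal_mul_I θ).le
    rw [show (fun n => c n * circleMap 0 ρ θ ^ n - if n = 0 then (1:ℂ) else 0) =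
      fun n => b n * Complex.exp (θ * I) ^ n from funext fun n => ?_]
    · exact hs2
    by_cases hn : n = 0
    · simp [hn, b, c']
    · simp [hn, b, c', circleMap, mul_pow]; ring
  simp_rw [heq]
  rw [integral_norm_sq_powSum hb]
  have hsum' : Summable fun n => ‖c (n + 1)‖ ^ 2 := (summable_nat_add_iff 1).2 hc
  have hle : ∀ n, ‖b n‖ ^ 2 ≤ ‖c' n‖ ^ 2 := fun n => by
    simp only [b, norm_mul, norm_pow, norm_real, Real.norm_of_nonneg h0.le]
    gcongr
    exact mul_le_of_le_one_right (norm_nonneg _) (pow_le_one₀ h0.le h1.le)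
  have hc's : Summable fun n => ‖c' n‖ ^ 2 := by
    rw [← summable_nat_add_iff 1]
    simpa [c'] using hsum'
  have h2 : ∑' n, ‖c' n‖ ^ 2 = ‖c 0 - 1‖ ^ 2 + ∑' n, ‖c (n + 1)‖ ^ 2 := by
    rw [hc's.tsum_eq_zero_add]
    simp [c']
  rw [← h2]
  refine mul_le_mul_of_nonneg_left ?_ (by positivity)
  exact Summable.tsum_le_tsum hle
    (Summable.of_nonneg_of_le (fun _ => by positivity) hle hc's) hc's

/-- A function in `H²` close to `1` is bounded below, off its zeros, by `exp (-σ)` where `σ` has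
small mean on every circle. -/
theorem exists_log_majorant {c : ℕ → ℂ} (hc : Summable fun n => ‖c n‖ ^ 2) {δ : ℝ} (hδ : 0 < δ)
    (hδ2 : δ ≤ 1 / 2) (hη : ‖c 0 - 1‖ ^ 2 + ∑' n, ‖c (n + 1)‖ ^ 2 < δ ^ 2) :
    ∃ (σ : ℂ → ℝ) (Z : Set ℂ), Measurable σ ∧ (∀ z, 0 ≤ σ z) ∧ (∀ z, 1 ≤ ‖z‖ → σ z = 0) ∧
      Z.Countable ∧
      (∀ z, ‖z‖ < 1 → z ∉ Z → powSum c z ≠ 0 ∧ ‖powSum c z‖⁻¹ ≤ Real.exp (σ z)) ∧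
      ∀ ρ ∈ Ioo (0:ℝ) 1, ∫⁻ θ in Ioo (-Real.pi) Real.pi,
        ENNReal.ofReal (σ (circleMap 0 ρ θ)) ≤ ENNReal.ofReal (8 * Real.pi * δ) := by
  classical
  have hcb : ∀ n, ‖c n‖ ≤ Real.sqrt (∑' n, ‖c n‖ ^ 2) := fun n =>
    Real.le_sqrt_of_sq_le (hc.le_tsum n fun _ _ => by positivity)
  have hd := differentiableOn_powSum hcb
  have han : AnalyticOnNhd ℂ (powSum c) (ball 0 1) := hd.analyticOnNhd isOpen_ball
  have hc0 : powSum c 0 = c 0 := by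
    refine HasSum.tsum_eq ?_
    simpa using hasSum_single (f := fun n => c n * (0:ℂ) ^ n) 0 (fun n hn => by simp [hn])
  have hpi := Real.pi_pos
  have hnear : ‖c 0 - 1‖ < δ := by
    refine lt_of_pow_lt_pow_left₀ 2 hδ.le (lt_of_le_of_lt ?_ hη)
    exact le_add_of_nonneg_right (tsum_nonneg fun _ => by positivity)
  have hc0n : 1 - δ < ‖c 0‖ := by
    have := norm_sub_norm_le (1:ℂ) (c 0)
    rw [norm_one, norm_sub_rev] at this
    linarith
  have hc0p : 0 < ‖c 0‖ := by linarith
  have hlogc0 : -(2 * δ) ≤ Real.log ‖c 0‖ := by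
    have h1 := Real.one_sub_inv_le_log_of_pos hc0p
    have h2 : ‖c 0‖⁻¹ ≤ 1 + 2 * δ := by
      rw [inv_le_iff_one_le_mul₀ hc0p]
      nlinarith
    linarith
  let H : ℂ → ℂ := (ball (0:ℂ) 1).piecewise (powSum c) fun _ => 1
  have hHm : Measurable H :=
    hd.continuousOn.measurable_piecewise continuousOn_const measurableSet_ball
  have hHin : ∀ z, ‖z‖ < 1 → H z = powSum c z := fun z hz =>
    piecewise_eq_of_mem _ _ _ (by simpa using hz)
  refine ⟨fun z => Real.posLog ‖H z‖⁻¹, {z ∈ ball 0 1 | powSum c z = 0}, ?_,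
    fun z => Real.posLog_nonneg, ?_, ?_, ?_, ?_⟩
  · have : Measurable fun x : ℝ => Real.posLog x := by
      unfold Real.posLog
      exact measurable_const.max Real.measurable_log
    exact this.comp hHm.norm.inv
  · intro z hz
    have : H z = 1 := piecewise_eq_of_notMem _ _ _ (by simpa using hz)
    simp [this]
  · exact AnalyticOnNhd.countable_zeros han
      ((convex_ball _ _).isConnected ⟨0, by simp⟩) (x := 0) (by simp)
      (by rw [hc0]; exact norm_pos_iff.1 hc0p)
  · intro z hz hzZ
    have hne : powSum c z ≠ 0 := fun h => hzZ ⟨by simpa using hz, h⟩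
    refine ⟨hne, ?_⟩
    simp only [hHin z hz]
    have hp : 0 < ‖powSum c z‖⁻¹ := inv_pos.2 (norm_pos_iff.2 hne)
    calc ‖powSum c z‖⁻¹ = Real.exp (Real.log ‖powSum c z‖⁻¹) := (Real.exp_log hp).symm
      _ ≤ _ := Real.exp_le_exp.2 (le_max_right _ _)
  · rintro ρ ⟨h0, h1⟩
    have hin : ∀ θ : ℝ, ‖circleMap 0 ρ θ‖ < 1 := fun θ => by simpa [abs_of_pos h0] using h1
    simp_rw [fun θ => hHin _ (hin θ)]
    have hcont : Continuous fun θ : ℝ => powSum c (circleMap 0 ρ θ) :=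
      hd.continuousOn.comp_continuous (continuous_circleMap 0 ρ) fun θ => by simpa using hin θ
    have hsub : closedBall (0:ℂ) ρ ⊆ ball 0 1 := closedBall_subset_ball h1
    have hlog : CircleIntegrable (fun z => Real.log ‖powSum c z‖) 0 ρ := by
      apply MeromorphicOn.circleIntegrable_log_norm
      rw [abs_of_pos h0]
      exact (han.mono (sphere_subset_closedBall.trans hsub)).meromorphicOn
    have hlog' : IntervalIntegrable (fun θ => Real.log ‖powSum c (circleMap 0 ρ θ)‖) volume 0
      (2 * Real.pi) := hlog
    have hsqI : IntervalIntegrable (fun θ => δ + ‖powSum c (circleMap 0 ρ θ) - 1‖ ^ 2 / δ) volume 0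
      (2 * Real.pi) := Continuous.intervalIntegrable (by fun_prop) _ _
    have hgI := hsqI.sub hlog'
    have hmeas : Measurable fun θ : ℝ => Real.posLog ‖powSum c (circleMap 0 ρ θ)‖⁻¹ := by
      have : Measurable fun x : ℝ => Real.posLog x := by
        unfold Real.posLog
        exact measurable_const.max Real.measurable_log
      exact this.comp hcont.norm.measurable.inv
    have hσI : IntervalIntegrable (fun θ => Real.posLog ‖powSum c (circleMap 0 ρ θ)‖⁻¹) volume 0
        (2 * Real.pi) := by
      refine hgI.mono_fun' hmeas.aestronglyMeasurable (Eventually.of_forall fun θ => ?_)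
      beta_reduce
      rw [Real.norm_of_nonneg Real.posLog_nonneg]
      exact posLog_inv_norm_le _ hδ
    have hper : Function.Periodic (fun θ => Real.posLog ‖powSum c (circleMap 0 ρ θ)‖⁻¹)
      (2 * Real.pi) := fun θ => by simp [periodic_circleMap 0 ρ θ]
    have hle : -Real.pi ≤ Real.pi := by linarith
    have hσI' := hper.intervalIntegrable₀ Real.two_pi_pos.ne' hσI (-Real.pi) Real.pi
    rw [intervalIntegrable_iff_integrableOn_Ioo_of_le hle] at hσI'
    rw [← ofReal_integral_eq_lintegral_ofReal hσI'
      (Eventually.of_forall fun θ => Real.posLog_nonneg)]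
    refine ENNReal.ofReal_le_ofReal ?_
    rw [← integral_Ioc_eq_integral_Ioo, ← intervalIntegral.integral_of_le hle]
    have hshift := hper.intervalIntegral_add_eq (-Real.pi) 0
    rw [show -Real.pi + 2 * Real.pi = Real.pi by ring, zero_add] at hshift
    rw [hshift]
    have hmono := intervalIntegral.integral_mono_on Real.two_pi_pos.le hσI hgI
      fun θ _ => posLog_inv_norm_le _ hδ
    rw [intervalIntegral.integral_sub hsqI hlog',
      intervalIntegral.integral_add intervalIntegrable_const
        (Continuous.intervalIntegrable (by fun_prop) _ _),
      intervalIntegral.integral_div, intervalIntegral.integral_const, smul_eq_mul] at hmono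
    have hJ := log_norm_le_circleAverage h0 (han.mono hsub)
      (by rw [hc0]; exact norm_pos_iff.1 hc0p)
    rw [Real.circleAverage, smul_eq_mul, hc0, inv_mul_eq_div, le_div_iff₀ Real.two_pi_pos] at hJ
    have hS := intervalIntegral_norm_sq_powSum_sub_one_le hc h0 h1
    have hS2 : (∫ θ in (0:ℝ)..(2 * Real.pi), ‖powSum c (circleMap 0 ρ θ) - 1‖ ^ 2) / δ ≤
        2 * Real.pi * δ := by
      rw [div_le_iff₀ hδ]
      nlinarith
    nlinarith

/-- `backSum φ n z = ∑ j < n, z ^ (n - 1 - j) * φ j`. -/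
def backSum (φ : ℕ → ℂ) : ℕ → ℂ → ℂ
  | 0, _ => 0
  | n + 1, z => z * backSum φ n z + φ n

theorem norm_backSum_le {φ : ℕ → ℂ} {C : ℝ} (hφ : ∀ n, ‖φ n‖ ≤ C) {z : ℂ} (hz : ‖z‖ < 1) (n : ℕ) :
    ‖backSum φ n z‖ ≤ C / (1 - ‖z‖) := by
  have hC : 0 ≤ C := (norm_nonneg _).trans (hφ 0)
  have hz' : 0 < 1 - ‖z‖ := by linarith
  induction n with
  | zero => simp only [backSum, norm_zero]; positivity
  | succ n ih =>
    calc ‖backSum φ (n + 1) z‖ ≤ ‖z‖ * ‖backSum φ n z‖ + ‖φ n‖ := by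
          rw [← norm_mul]; exact norm_add_le _ _
      _ ≤ ‖z‖ * (C / (1 - ‖z‖)) + C := by gcongr; exact hφ n
      _ = C / (1 - ‖z‖) := by field_simp; ring

theorem differentiable_backSum (φ : ℕ → ℂ) (n : ℕ) : Differentiable ℂ (backSum φ n) := by
  induction n with
  | zero => exact differentiable_const 0
  | succ n ih => exact (differentiable_id.mul ih).add_const _

theorem backSum_add (φ : ℕ → ℂ) (k l : ℕ) (z : ℂ) :
    backSum φ (l + k) z = z ^ k * backSum φ l z + backSum (fun i => φ (l + i)) k z := by
  induction k with
  | zero => simp [backSum]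
  | succ k ih => rw [← add_assoc, backSum, ih, backSum]; ring

theorem hasSum_mul_backSum_shift {φ h : ℕ → ℂ} (hh : ∀ i, HasSum (fun l => h l * φ (l + i)) 0)
    (k : ℕ) (z : ℂ) : HasSum (fun l => h l * backSum (fun i => φ (l + i)) k z) 0 := by
  induction k with
  | zero => simp [backSum, hasSum_zero]
  | succ k ih =>
    have := (ih.mul_left z).add (hh k)
    rw [mul_zero, add_zero] at this
    exact this.congr_fun fun l => by simp only [backSum]; ring

/-- The bracket of a summable sequence with the partial quotients of a bounded one. -/
def bracket (φ h : ℕ → ℂ) (z : ℂ) : ℂ := ∑' n, h n * backSum φ n z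

section
variable {φ h : ℕ → ℂ} {C : ℝ}

theorem summable_norm_mul_backSum (hφ : ∀ n, ‖φ n‖ ≤ C) (hh : Summable fun n => ‖h n‖)
    {z : ℂ} (hz : ‖z‖ < 1) :
    Summable fun n => ‖h n * backSum φ n z‖ := by
  refine Summable.of_nonneg_of_le (fun _ => norm_nonneg _) (fun n => ?_)
    (hh.mul_right (C / (1 - ‖z‖)))
  rw [norm_mul]
  exact mul_le_mul_of_nonneg_left (norm_backSum_le hφ hz n) (norm_nonneg _)

theorem norm_bracket_mul_le (hφ : ∀ n, ‖φ n‖ ≤ C) (hh : Summable fun n => ‖h n‖)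
    {z : ℂ} (hz : ‖z‖ < 1) :
    ‖bracket φ h z‖ * (1 - ‖z‖) ≤ C * ∑' n, ‖h n‖ := by
  have hz' : 0 < 1 - ‖z‖ := by linarith
  rw [← le_div_iff₀ hz']
  calc ‖bracket φ h z‖ ≤ ∑' n, ‖h n * backSum φ n z‖ :=
        norm_tsum_le_tsum_norm (summable_norm_mul_backSum hφ hh hz)
    _ ≤ ∑' n, ‖h n‖ * (C / (1 - ‖z‖)) := by
        refine (summable_norm_mul_backSum hφ hh hz).tsum_le_tsum (fun n => ?_) (hh.mul_right _)
        rw [norm_mul]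
        exact mul_le_mul_of_nonneg_left (norm_backSum_le hφ hz n) (norm_nonneg _)
    _ = C * (∑' n, ‖h n‖) / (1 - ‖z‖) := by rw [tsum_mul_right]; ring

theorem differentiableOn_bracket (hφ : ∀ n, ‖φ n‖ ≤ C) (hh : Summable fun n => ‖h n‖) :
    DifferentiableOn ℂ (bracket φ h) (ball 0 1) := by
  intro z hz
  rw [mem_ball_zero_iff] at hz
  obtain ⟨r, hr, hr1⟩ := exists_between hz
  have hC : 0 ≤ C := (norm_nonneg _).trans (hφ 0)
  have hd : DifferentiableOn ℂ (bracket φ h) (ball 0 r) := by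
    refine differentiableOn_tsum_of_summable_norm (hh.mul_right (C / (1 - r)))
      (fun n => ((differentiable_backSum φ n).const_mul _).differentiableOn) isOpen_ball
      fun n w hw => ?_
    rw [mem_ball_zero_iff] at hw
    rw [norm_mul]
    refine mul_le_mul_of_nonneg_left ((norm_backSum_le hφ (hw.trans hr1) n).trans ?_)
      (norm_nonneg _)
    have : 0 < 1 - r := by linarith
    gcongr
  exact ((hd z (by simpa using hr)).differentiableAt
    (isOpen_ball.mem_nhds (by simpa using hr))).differentiableWithinAt

theorem hasSum_mul_backSum_add (hφ : ∀ n, ‖φ n‖ ≤ C) (hh : Summable fun n => ‖h n‖)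
    (hann : ∀ i, HasSum (fun l => h l * φ (l + i)) 0) {z : ℂ}
    (hz : ‖z‖ < 1) (k : ℕ) :
    HasSum (fun l => h l * backSum φ (l + k) z) (z ^ k * bracket φ h z) := by
  have h1 := ((summable_norm_mul_backSum hφ hh hz).of_norm.hasSum.mul_left (z ^ k)).add
    (hasSum_mul_backSum_shift hann k z)
  rw [add_zero] at h1
  exact h1.congr_fun fun l => by rw [backSum_add]; ring

theorem powSum_mul_bracket_comm (hφ : ∀ n, ‖φ n‖ ≤ C) (hh : Summable fun n => ‖h n‖)
    {h' : ℕ → ℂ} (hh' : Summable fun n => ‖h' n‖)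
    (hann : ∀ i, HasSum (fun l => h l * φ (l + i)) 0)
    (hann' : ∀ i, HasSum (fun l => h' l * φ (l + i)) 0) {z : ℂ} (hz : ‖z‖ < 1) :
    powSum h' z * bracket φ h z = powSum h z * bracket φ h' z := by
  have hsum : Summable (Function.uncurry fun k l : ℕ => h' k * (h l * backSum φ (l + k) z)) := by
    refine Summable.of_norm_bounded
      ((hh'.mul_of_nonneg hh (fun _ => norm_nonneg _) fun _ => norm_nonneg _).mul_right
        (C / (1 - ‖z‖))) fun p => ?_
    simp only [Function.uncurry, norm_mul, ← mul_assoc]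
    gcongr
    exact norm_backSum_le hφ hz _
  have hcomm := hsum.tsum_comm
  have hl : ∀ k, ∑' l, h' k * (h l * backSum φ (l + k) z) = h' k * z ^ k * bracket φ h z := by
    intro k
    rw [tsum_mul_left, (hasSum_mul_backSum_add hφ hh hann hz k).tsum_eq]; ring
  have hr : ∀ l, ∑' k, h' k * (h l * backSum φ (l + k) z) = h l * z ^ l * bracket φ h' z := by
    intro l
    rw [show (fun k => h' k * (h l * backSum φ (l + k) z)) =
      fun k => h l * (h' k * backSum φ (k + l) z) from funext fun k => by rw [add_comm l]; ring,
      tsum_mul_left, (hasSum_mul_backSum_add hφ hh' hann' hz l).tsum_eq]; ring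
  simp_rw [hl, hr, tsum_mul_right] at hcomm
  exact hcomm.symm
end

section
variable {K : Set (ℕ → ℂ)} {φ f : ℕ → ℂ} {C : ℝ} {S F : ℂ → ℂ}

theorem mul_bracket_eq
    (hK : ∀ h ∈ K, Summable fun n => ‖h n‖) (hφ : ∀ n, ‖φ n‖ ≤ C)
    (hann : ∀ h ∈ K, ∀ i, HasSum (fun l => h l * φ (l + i)) 0)
    (hS : DifferentiableOn ℂ S (ball 0 1)) (hS0 : ∃ w ∈ ball (0:ℂ) 1, S w ≠ 0)
    {h h' : ℕ → ℂ} {g g' : ℂ → ℂ} (hh : h ∈ K) (hh' : h' ∈ K)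
    (hg : DifferentiableOn ℂ g (ball 0 1)) (hg' : DifferentiableOn ℂ g' (ball 0 1))
    (hhg : ∀ w ∈ ball (0:ℂ) 1, powSum h w = S w * g w)
    (hhg' : ∀ w ∈ ball (0:ℂ) 1, powSum h' w = S w * g' w) {z : ℂ} (hz : z ∈ ball (0:ℂ) 1) :
    g' z * bracket φ h z = g z * bracket φ h' z := by
  have hd : DifferentiableOn ℂ (fun w => g' w * bracket φ h w - g w * bracket φ h' w) (ball 0 1) :=
    (hg'.mul (differentiableOn_bracket hφ (hK h hh))).sub
      (hg.mul (differentiableOn_bracket hφ (hK h' hh')))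
  obtain ⟨w₀, hw₀, hSw⟩ := hS0
  have hne : ∀ᶠ w in nhds w₀, S w ≠ 0 :=
    (hS.continuousOn.continuousAt (isOpen_ball.mem_nhds hw₀)).eventually_ne hSw
  have hev : (fun w => g' w * bracket φ h w - g w * bracket φ h' w) =ᶠ[nhds w₀] 0 := by
    filter_upwards [hne, isOpen_ball.mem_nhds hw₀] with w hw hwb
    have h1 := powSum_mul_bracket_comm hφ (hK h hh) (hK h' hh') (hann h hh) (hann h' hh')
      (mem_ball_zero_iff.1 hwb)
    rw [hhg w hwb, hhg' w hwb] at h1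
    refine mul_left_cancel₀ hw ?_
    simp only [Pi.zero_apply, mul_zero]
    linear_combination h1
  have := (hd.analyticOnNhd isOpen_ball).eqOn_zero_of_preconnected_of_eventuallyEq_zero
    (convex_ball _ _).isPreconnected hw₀ hev hz
  exact sub_eq_zero.1 this

theorem exists_interior_quotient
    (hK : ∀ h ∈ K, Summable fun n => ‖h n‖) (hφ : ∀ n, ‖φ n‖ ≤ C)
    (hann : ∀ h ∈ K, ∀ i, HasSum (fun l => h l * φ (l + i)) 0)
    (hS : DifferentiableOn ℂ S (ball 0 1)) (hS0 : ∃ w ∈ ball (0:ℂ) 1, S w ≠ 0)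
    (hf : Summable fun n => ‖f n‖)
    (hF : DifferentiableOn ℂ F (ball 0 1))
    (hex : ∀ z ∈ ball (0:ℂ) 1, ∃ h ∈ K, ∃ g : ℂ → ℂ, DifferentiableOn ℂ g (ball 0 1) ∧
      (∀ w ∈ ball (0:ℂ) 1, powSum h w = S w * g w) ∧ g z ≠ 0) :
    ∃ Q : ℂ → ℂ, DifferentiableOn ℂ Q (ball 0 1) ∧ ∀ h ∈ K, ∀ g : ℂ → ℂ,
      DifferentiableOn ℂ g (ball 0 1) → (∀ w ∈ ball (0:ℂ) 1, powSum h w = S w * g w) →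
      ∀ z ∈ ball (0:ℂ) 1, g z * Q z = F z * bracket φ h z - g z * bracket φ f z := by
  choose! H hHK G hG hHG hGne using hex
  let Q : ℂ → ℂ := fun z => F z * bracket φ (H z) z / G z z - bracket φ f z
  have hQ : ∀ h ∈ K, ∀ g : ℂ → ℂ,
      DifferentiableOn ℂ g (ball 0 1) → (∀ w ∈ ball (0:ℂ) 1, powSum h w = S w * g w) →
      ∀ z ∈ ball (0:ℂ) 1, g z * Q z = F z * bracket φ h z - g z * bracket φ f z := by
    intro h hh g hg hhg z hz
    have h1 := mul_bracket_eq hK hφ hann hS hS0 hh (hHK z hz) hg (hG z hz) hhg (hHG z hz) hz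
    have h2 := hGne z hz
    simp only [Q]
    field_simp
    linear_combination (-F z) * h1
  refine ⟨Q, fun z hz => ?_, hQ⟩
  have hcont : ∀ᶠ w in nhds z, G z w ≠ 0 :=
    ((hG z hz).continuousOn.continuousAt (isOpen_ball.mem_nhds hz)).eventually_ne (hGne z hz)
  have heq : Q =ᶠ[nhds z] fun w => F w * bracket φ (H z) w / G z w - bracket φ f w := by
    filter_upwards [hcont, isOpen_ball.mem_nhds hz] with w hw hwb
    have := hQ (H z) (hHK z hz) (G z) (hG z hz) (hHG z hz) w hwb
    field_simp
    linear_combination this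
  have hb := isOpen_ball.mem_nhds hz
  have hd : DifferentiableAt ℂ (fun w => F w * bracket φ (H z) w / G z w - bracket φ f w) z :=
    (((hF.differentiableAt hb).mul
      ((differentiableOn_bracket hφ (hK _ (hHK z hz))).differentiableAt hb)).div
      ((hG z hz).differentiableAt hb) (hGne z hz)).sub
      ((differentiableOn_bracket hφ hf).differentiableAt hb)
  exact (hd.congr_of_eventuallyEq heq).differentiableWithinAt
end

theorem norm_sum_mul_pow_le_of_mem_spectrum {A : Type*} [NormedRing A] [NormedAlgebra ℂ A]
    [CompleteSpace A] (a : A) (h : ℕ → ℂ) (M : ℕ) {z : ℂ} (hz : z ∈ spectrum ℂ a)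
    {B : ℝ} (h1 : ‖(1 : A)‖ ≤ 1) (hB : ‖∑ k ∈ Finset.range M, h k • a ^ k‖ ≤ B) :
    ‖∑ k ∈ Finset.range M, h k * z ^ k‖ ≤ B := by
  let P : Polynomial ℂ := ∑ k ∈ Finset.range M, Polynomial.C (h k) * Polynomial.X ^ k
  have hP : Polynomial.aeval a P = ∑ k ∈ Finset.range M, h k • a ^ k := by
    simp [P, Algebra.smul_def]
  have hz' : P.eval z ∈ spectrum ℂ (Polynomial.aeval a P) :=
    spectrum.subset_polynomial_aeval a P ⟨z, hz, rfl⟩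
  have h4 : P.eval z = ∑ k ∈ Finset.range M, h k * z ^ k := by
    simp [P, Polynomial.eval_finsetSum]
  rw [hP, h4] at hz'
  exact (spectrum.norm_le_norm_mul_of_mem hz').trans
    ((mul_le_of_le_one_right (norm_nonneg _) h1).trans hB)

theorem hasSum_of_recurrence {ℓ ψ : ℕ → ℂ} {B : ℝ} (hℓ : ∀ n, ‖ℓ n‖ ≤ B) {z : ℂ} (hz : 1 < ‖z‖)
    (hrec : ∀ n, ℓ (n + 1) = z * ℓ n - ψ n) : HasSum (fun n => ψ n * z⁻¹ ^ (n + 1)) (ℓ 0) := by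
  have hz0 : z ≠ 0 := norm_pos_iff.1 (by linarith)
  have hB : 0 ≤ B := (norm_nonneg _).trans (hℓ 0)
  have hinv : ‖z⁻¹‖ < 1 := by rw [norm_inv]; exact inv_lt_one_of_one_lt₀ hz
  have hψ : ∀ n, ‖ψ n‖ ≤ ‖z‖ * B + B := fun n => by
    rw [show ψ n = z * ℓ n - ℓ (n + 1) by rw [hrec]; ring]
    refine (norm_sub_le _ _).trans ?_
    rw [norm_mul]
    gcongr
    exacts [hℓ n, hℓ (n + 1)]
  have hsum : Summable fun n => ψ n * z⁻¹ ^ (n + 1) := by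
    refine Summable.of_norm_bounded
      (((summable_nat_add_iff 1).2 (summable_geometric_of_lt_one (norm_nonneg z⁻¹) hinv)).mul_left
        (‖z‖ * B + B)) fun n => ?_
    rw [norm_mul, norm_pow]
    exact mul_le_mul_of_nonneg_right (hψ n) (by positivity)
  have hpart : ∀ N, ∑ n ∈ Finset.range N, ψ n * z⁻¹ ^ (n + 1) = ℓ 0 - z⁻¹ ^ N * ℓ N := by
    intro N
    induction N with
    | zero => simp
    | succ N ih => rw [Finset.sum_range_succ, ih, hrec N, pow_succ]; field_simp; ring
  have h0 : Tendsto (fun N => z⁻¹ ^ N * ℓ N) atTop (nhds 0) := by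
    refine squeeze_zero_norm (a := fun N => ‖z⁻¹‖ ^ N * B) (fun N => ?_) ?_
    · rw [norm_mul, norm_pow]; gcongr; exact hℓ N
    · simpa using (tendsto_pow_atTop_nhds_zero_of_lt_one (norm_nonneg z⁻¹) hinv).mul_const B
  have h1 := hsum.hasSum.tendsto_sum_nat
  simp_rw [hpart] at h1
  have h2 := tendsto_nhds_unique h1 (by simpa using (h0.const_sub (ℓ 0)))
  rw [← h2]
  exact hsum.hasSum

/-- The backward shift of a bounded sequence. -/
def backShift (y : BoundedContinuousFunction ℕ ℂ) : BoundedContinuousFunction ℕ ℂ :=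
  BoundedContinuousFunction.ofNormedAddCommGroupDiscrete (fun n => y (n + 1)) ‖y‖
    fun _ => y.norm_coe_le_norm _

theorem backShift_apply (y : BoundedContinuousFunction ℕ ℂ) (n : ℕ) :
    backShift y n = y (n + 1) := rfl

theorem summable_mul_bounded {h : ℕ → ℂ} (hh : Summable fun n => ‖h n‖)
    (y : BoundedContinuousFunction ℕ ℂ) (i : ℕ) : Summable fun l => h l * y (l + i) := by
  refine Summable.of_norm_bounded (hh.mul_right ‖y‖) fun l => ?_
  rw [norm_mul]
  exact mul_le_mul_of_nonneg_left (y.norm_coe_le_norm _) (norm_nonneg _)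

theorem norm_tsum_mul_bounded_le {h : ℕ → ℂ} (hh : Summable fun n => ‖h n‖)
    (y : BoundedContinuousFunction ℕ ℂ) (i : ℕ) :
    ‖∑' l, h l * y (l + i)‖ ≤ (∑' l, ‖h l‖) * ‖y‖ := by
  rw [← tsum_mul_right]
  refine tsum_of_norm_bounded (hh.mul_right ‖y‖).hasSum fun l => ?_
  rw [norm_mul]
  exact mul_le_mul_of_nonneg_left (y.norm_coe_le_norm _) (norm_nonneg _)

/-- The bounded sequences all of whose backward shifts annihilate `K`. -/
def annih (K : Set (ℕ → ℂ)) (hK : ∀ h ∈ K, Summable fun n => ‖h n‖) :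
    Submodule ℂ (BoundedContinuousFunction ℕ ℂ) where
  carrier := {y | ∀ h ∈ K, ∀ i, ∑' l, h l * y (l + i) = 0}
  zero_mem' := fun h _ i => by simp
  add_mem' := fun {y y'} hy hy' h hh i => by
    have := (summable_mul_bounded (hK h hh) y i).tsum_add (summable_mul_bounded (hK h hh) y' i)
    rw [hy h hh i, hy' h hh i, add_zero] at this
    rw [← this]
    exact tsum_congr fun l => by simp [mul_add]
  smul_mem' := fun c y hy h hh i => by
    have : ∀ l, h l * (c • y) (l + i) = c * (h l * y (l + i)) := fun l => by
      simp only [BoundedContinuousFunction.coe_smul, smul_eq_mul]; ring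
    simp_rw [this]
    rw [tsum_mul_left, hy h hh i, mul_zero]

section
variable {K : Set (ℕ → ℂ)} (hK : ∀ h ∈ K, Summable fun n => ‖h n‖)

theorem isClosed_annih : IsClosed (annih K hK : Set (BoundedContinuousFunction ℕ ℂ)) := by
  refine isClosed_of_closure_subset fun y hy h hh i => ?_
  rw [Metric.mem_closure_iff] at hy
  refine norm_eq_zero.1 (le_antisymm (le_of_forall_pos_le_add fun ε hε => ?_) (norm_nonneg _))
  have hA : 0 ≤ ∑' l, ‖h l‖ := tsum_nonneg fun _ => norm_nonneg _
  obtain ⟨y', hy', hd⟩ := hy (ε / (∑' l, ‖h l‖ + 1)) (by positivity)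
  have h1 := (summable_mul_bounded (hK h hh) y i).tsum_sub (summable_mul_bounded (hK h hh) y' i)
  rw [hy' h hh i, sub_zero] at h1
  rw [← h1, zero_add]
  have h2 := norm_tsum_mul_bounded_le (hK h hh) (y - y') i
  rw [dist_eq_norm, lt_div_iff₀ (by positivity)] at hd
  calc _ = ‖∑' l, h l * (y - y') (l + i)‖ := by
        congr 1; exact tsum_congr fun l => by simp [mul_sub]
    _ ≤ (∑' l, ‖h l‖) * ‖y - y'‖ := h2
    _ ≤ ε := by nlinarith [norm_nonneg (y - y')]

instance completeSpace_annih : CompleteSpace (annih K hK) :=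
  (isClosed_annih hK).completeSpace_coe

/-- The backward shift on `annih K`. -/
def shiftCLM : annih K hK →L[ℂ] annih K hK :=
  LinearMap.mkContinuous
    { toFun := fun y => ⟨backShift y.1, fun h hh i => by
        simpa only [backShift_apply, add_assoc] using y.2 h hh (i + 1)⟩
      map_add' := fun y y' => by ext n; rfl
      map_smul' := fun c y => by ext n; rfl } 1 fun y => by
    rw [one_mul]
    exact (BoundedContinuousFunction.norm_le (norm_nonneg _)).2 fun n => y.1.norm_coe_le_norm _

theorem shiftCLM_apply (y : annih K hK) (n : ℕ) : (shiftCLM hK y).1 n = y.1 (n + 1) := rfl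

theorem norm_shiftCLM_le : ‖shiftCLM hK‖ ≤ 1 := LinearMap.mkContinuous_norm_le _ zero_le_one _

theorem shiftCLM_pow_apply (y : annih K hK) (k n : ℕ) :
    ((shiftCLM hK ^ k) y).1 n = y.1 (n + k) := by
  induction k generalizing n with
  | zero => simp
  | succ k ih =>
    rw [pow_succ', mul_apply_eq_comp, shiftCLM_apply, ih]
    congr 1; ring

/-- The functional on `annih K` given by a summable sequence. -/
def pairCLM {f : ℕ → ℂ} (hf : Summable fun n => ‖f n‖) : annih K hK →L[ℂ] ℂ :=
  LinearMap.mkContinuous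
    { toFun := fun y => ∑' l, f l * y.1 l
      map_add' := fun y y' => by
        refine Eq.trans (tsum_congr fun l => ?_)
          ((summable_mul_bounded hf y.1 0).tsum_add (summable_mul_bounded hf y'.1 0))
        simp [mul_add]
      map_smul' := fun c y => by
        rw [RingHom.id_apply, smul_eq_mul, ← tsum_mul_left]
        exact tsum_congr fun l => by
          simp only [Submodule.coe_smul, BoundedContinuousFunction.coe_smul, smul_eq_mul]; ring }
    (∑' l, ‖f l‖) fun y => norm_tsum_mul_bounded_le hf y.1 0

theorem mem_resolventSet_of_one_lt_norm {z : ℂ} (hz : 1 < ‖z‖) :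
    z ∈ resolventSet ℂ (shiftCLM hK) := by
  by_contra hmem
  have h1 := spectrum.norm_le_norm_mul_of_mem (a := shiftCLM hK) (k := z) hmem
  have h2 : ‖(1 : annih K hK →L[ℂ] annih K hK)‖ ≤ 1 := ContinuousLinearMap.norm_id_le
  nlinarith [norm_shiftCLM_le hK, norm_nonneg (shiftCLM hK),
    norm_nonneg (1 : annih K hK →L[ℂ] annih K hK)]

theorem sum_smul_shiftCLM_pow_apply (h : ℕ → ℂ) (M : ℕ) (y : annih K hK) (n : ℕ) :
    ((∑ k ∈ Finset.range M, h k • shiftCLM hK ^ k) y).1 n =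
      ∑ k ∈ Finset.range M, h k * y.1 (k + n) := by
  induction M with
  | zero => rfl
  | succ M ih =>
    rw [Finset.sum_range_succ, Finset.sum_range_succ, ← ih, add_comm M n,
      ← shiftCLM_pow_apply hK y M n]
    rfl

theorem norm_sum_smul_shiftCLM_pow_le {h : ℕ → ℂ} (hh : h ∈ K) (M : ℕ) :
    ‖∑ k ∈ Finset.range M, h k • shiftCLM hK ^ k‖ ≤ ∑' k, ‖h (k + M)‖ := by
  have hsM : Summable fun k => ‖h (k + M)‖ := (summable_nat_add_iff M).2 (hK h hh)
  have htail0 : 0 ≤ ∑' k, ‖h (k + M)‖ := tsum_nonneg fun _ => norm_nonneg _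
  refine ContinuousLinearMap.opNorm_le_bound _ htail0 fun y => ?_
  have key : ∀ n, ‖((∑ k ∈ Finset.range M, h k • shiftCLM hK ^ k) y).1 n‖ ≤
      (∑' k, ‖h (k + M)‖) * ‖y.1‖ := fun n => by
    have hs := (summable_mul_bounded (hK h hh) y.1 n).sum_add_tsum_nat_add M
    rw [y.2 h hh n] at hs
    rw [sum_smul_shiftCLM_pow_apply, eq_neg_of_add_eq_zero_left hs, norm_neg]
    simp_rw [add_assoc]
    exact norm_tsum_mul_bounded_le hsM y.1 (M + n)
  exact (BoundedContinuousFunction.norm_le (by positivity)).2 key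

theorem mem_resolventSet_of_powSum_ne_zero {h : ℕ → ℂ} (hh : h ∈ K) {z : ℂ} (hz : ‖z‖ ≤ 1)
    (hne : powSum h z ≠ 0) : z ∈ resolventSet ℂ (shiftCLM hK) := by
  by_contra hmem
  have hsum := hK h hh
  have hpos : 0 < ‖powSum h z‖ / 2 := half_pos (norm_pos_iff.2 hne)
  obtain ⟨M, hM⟩ := ((tendsto_sum_nat_add fun n => ‖h n‖).eventually_lt_const hpos).exists
  have htail0 : 0 ≤ ∑' k, ‖h (k + M)‖ := tsum_nonneg fun _ => norm_nonneg _
  have hsM : Summable fun k => ‖h (k + M)‖ := (summable_nat_add_iff M).2 hsum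
  have h2 : ‖(1 : annih K hK →L[ℂ] annih K hK)‖ ≤ 1 := ContinuousLinearMap.norm_id_le
  have h3 : ‖∑ k ∈ Finset.range M, h k * z ^ k‖ ≤ ∑' k, ‖h (k + M)‖ :=
    norm_sum_mul_pow_le_of_mem_spectrum (shiftCLM hK) h M hmem h2
      (norm_sum_smul_shiftCLM_pow_le hK hh M)
  have h5 := (hasSum_powSum_of_summable hsum hz).summable.sum_add_tsum_nat_add M
  rw [(hasSum_powSum_of_summable hsum hz).tsum_eq] at h5
  have h6 : ‖∑' k, h (k + M) * z ^ (k + M)‖ ≤ ∑' k, ‖h (k + M)‖ := by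
    refine tsum_of_norm_bounded hsM.hasSum fun k => ?_
    rw [norm_mul, norm_pow]
    exact mul_le_of_le_one_right (norm_nonneg _) (pow_le_one₀ (norm_nonneg _) hz)
  have h7 : ‖powSum h z‖ ≤ ‖∑ k ∈ Finset.range M, h k * z ^ k‖ +
      ‖∑' k, h (k + M) * z ^ (k + M)‖ := by
    rw [← h5]; exact norm_add_le _ _
  linarith
end

theorem differentiableAt_functional_resolvent {E : Type*} [NormedAddCommGroup E] [NormedSpace ℂ E]
    [CompleteSpace E] {T : E →L[ℂ] E} {z : ℂ} (hz : z ∈ resolventSet ℂ T) (L : E →L[ℂ] ℂ) (y : E) :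
    DifferentiableAt ℂ (fun w => L (resolvent T w y)) z := by
  have h1 := (spectrum.hasDerivAt_resolvent_const_left hz).differentiableAt
  exact L.differentiableAt.comp z (h1.clm_apply (differentiableAt_const y))

section
variable {K : Set (ℕ → ℂ)} (hK : ∀ h ∈ K, Summable fun n => ‖h n‖)

theorem eq_pow_mul_sub_backSum {x φ : ℕ → ℂ} {z : ℂ} (hx : ∀ n, x (n + 1) = z * x n - φ n) (n : ℕ) :
    x n = z ^ n * x 0 - backSum φ n z := by
  induction n with
  | zero => simp [backSum]
  | succ n ih => rw [hx, ih, backSum]; ring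

theorem resolvent_apply_recurrence {z : ℂ} (hz : z ∈ resolventSet ℂ (shiftCLM hK))
    (y : annih K hK) (n : ℕ) :
    (resolvent (shiftCLM hK) z y).1 (n + 1) = z * (resolvent (shiftCLM hK) z y).1 n - y.1 n := by
  have hu : IsUnit (algebraMap ℂ (annih K hK →L[ℂ] annih K hK) z - shiftCLM hK) := hz
  have h1 : (algebraMap ℂ (annih K hK →L[ℂ] annih K hK) z - shiftCLM hK) *
      resolvent (shiftCLM hK) z = 1 := Ring.mul_inverse_cancel _ hu
  have h2 := congrArg (fun A : annih K hK →L[ℂ] annih K hK => (A y).1 n) h1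
  have h3 : z * (resolvent (shiftCLM hK) z y).1 n - (resolvent (shiftCLM hK) z y).1 (n + 1) =
      y.1 n := h2
  linear_combination -h3

theorem hasSum_mul_resolvent_of_norm_lt_one {z : ℂ} (hz : z ∈ resolventSet ℂ (shiftCLM hK))
    (hz1 : ‖z‖ < 1) (y : annih K hK) {h : ℕ → ℂ} (hh : Summable fun n => ‖h n‖) :
    HasSum (fun n => h n * (resolvent (shiftCLM hK) z y).1 n)
      (powSum h z * (resolvent (shiftCLM hK) z y).1 0 - bracket y.1 h z) := by
  have h1 := ((hasSum_powSum_of_summable hh hz1.le).mul_right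
    ((resolvent (shiftCLM hK) z y).1 0)).sub
      (summable_norm_mul_backSum (fun n => y.1.norm_coe_le_norm n) hh hz1).of_norm.hasSum
  refine h1.congr_fun fun n => ?_
  rw [eq_pow_mul_sub_backSum (resolvent_apply_recurrence hK hz y) n]
  ring

theorem hasSum_pairCLM_resolvent {z : ℂ} (hz : 1 < ‖z‖) (y : annih K hK) {f : ℕ → ℂ}
    (hf : Summable fun n => ‖f n‖) :
    HasSum (fun n => (∑' k, f k * y.1 (k + n)) * z⁻¹ ^ (n + 1))
      (pairCLM hK hf (resolvent (shiftCLM hK) z y)) := by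
  have hr := resolvent_apply_recurrence hK (mem_resolventSet_of_one_lt_norm hK hz) y
  generalize resolvent (shiftCLM hK) z y = w at hr ⊢
  refine hasSum_of_recurrence (ℓ := fun n => ∑' k, f k * w.1 (k + n)) (z := z)
    (fun n => norm_tsum_mul_bounded_le hf w.1 n) hz fun n => ?_
  rw [← tsum_mul_left, ← ((summable_mul_bounded hf w.1 n).mul_left z).tsum_sub
    (summable_mul_bounded hf y.1 n)]
  refine tsum_congr fun k => ?_
  rw [← add_assoc, hr]; ring

theorem differentiableAt_pairCLM_resolvent {z : ℂ} (hz : z ∈ resolventSet ℂ (shiftCLM hK))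
    (y : annih K hK) {f : ℕ → ℂ} (hf : Summable fun n => ‖f n‖) :
    DifferentiableAt ℂ (fun w => pairCLM hK hf (resolvent (shiftCLM hK) w y)) z := by
  exact differentiableAt_functional_resolvent hz (pairCLM hK hf) y

end

/-- The analytic function attached to a functional annihilating an ideal. -/
theorem exists_cauchy_transform {K : Set (ℕ → ℂ)} {φ f : ℕ → ℂ} {C : ℝ} {S F : ℂ → ℂ}
    (hK : ∀ h ∈ K, Summable fun n => ‖h n‖) (hφ : ∀ n, ‖φ n‖ ≤ C)
    (hann : ∀ h ∈ K, ∀ i, ∑' l, h l * φ (l + i) = 0)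
    (hS : DifferentiableOn ℂ S (ball 0 1)) (hS0 : ∃ w ∈ ball (0:ℂ) 1, S w ≠ 0)
    (hf : Summable fun n => ‖f n‖) (hF : DifferentiableOn ℂ F (ball 0 1))
    (hfF : ∀ w ∈ ball (0:ℂ) 1, powSum f w = S w * F w)
    (hex : ∀ z ∈ ball (0:ℂ) 1, ∃ h ∈ K, ∃ g : ℂ → ℂ, DifferentiableOn ℂ g (ball 0 1) ∧
      (∀ w ∈ ball (0:ℂ) 1, powSum h w = S w * g w) ∧ g z ≠ 0) :
    ∃ Q : ℂ → ℂ,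
      (∀ z, ‖z‖ ≠ 1 ∨ (∃ h ∈ K, powSum h z ≠ 0) → DifferentiableAt ℂ Q z) ∧
      (∀ z, 1 < ‖z‖ → HasSum (fun n => (∑' k, f k * φ (k + n)) * z⁻¹ ^ (n + 1)) (Q z)) ∧
      ∀ h ∈ K, ∀ g : ℂ → ℂ, DifferentiableOn ℂ g (ball 0 1) →
        (∀ w ∈ ball (0:ℂ) 1, powSum h w = S w * g w) →
        ∀ z ∈ ball (0:ℂ) 1, g z * Q z = F z * bracket φ h z - g z * bracket φ f z := by
  classical
  let b : BoundedContinuousFunction ℕ ℂ :=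
    BoundedContinuousFunction.ofNormedAddCommGroupDiscrete φ C hφ
  let y : annih K hK := ⟨b, hann⟩
  have hann' : ∀ h ∈ K, ∀ i, HasSum (fun l => h l * φ (l + i)) 0 := fun h hh i => by
    rw [← hann h hh i]; exact (summable_mul_bounded (hK h hh) b i).hasSum
  obtain ⟨Q₀, hQ₀, hQ₀'⟩ := exists_interior_quotient hK hφ hann' hS hS0 hf hF hex
  let R : ℂ → ℂ := fun z => pairCLM hK hf (resolvent (shiftCLM hK) z y)
  let Q : ℂ → ℂ := fun z => if ‖z‖ < 1 then Q₀ z else R z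
  have hQin : ∀ z, ‖z‖ < 1 → Q z = Q₀ z := fun z hz => if_pos hz
  have hQR : ∀ z ∈ resolventSet ℂ (shiftCLM hK), Q z = R z := by
    intro z hz
    by_cases hz1 : ‖z‖ < 1
    swap
    · exact if_neg hz1
    rw [hQin z hz1]
    have hzb : z ∈ ball (0:ℂ) 1 := mem_ball_zero_iff.2 hz1
    obtain ⟨h, hh, g, hg, hhg, hgz⟩ := hex z hzb
    have h1 := hQ₀' h hh g hg hhg z hzb
    have h2 := (hasSum_mul_resolvent_of_norm_lt_one hK hz hz1 y (hK h hh)).tsum_eq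
    have h3 : ∑' n, h n * (resolvent (shiftCLM hK) z y).1 n = 0 :=
      (resolvent (shiftCLM hK) z y).2 h hh 0
    have h4 : R z = _ := (hasSum_mul_resolvent_of_norm_lt_one hK hz hz1 y hf).tsum_eq
    rw [h3] at h2
    rw [h4, hfF z hzb]
    rw [hhg z hzb] at h2
    have h5 : (y.1 : ℕ → ℂ) = φ := rfl
    rw [h5] at h2 ⊢
    refine mul_left_cancel₀ hgz ?_
    linear_combination h1 + F z * h2
  have hres : ∀ z ∈ resolventSet ℂ (shiftCLM hK), DifferentiableAt ℂ Q z := by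
    intro z hz
    refine (differentiableAt_pairCLM_resolvent hK hz y hf).congr_of_eventuallyEq ?_
    filter_upwards [(spectrum.isOpen_resolventSet (𝕜 := ℂ) (shiftCLM hK)).mem_nhds hz] with w hw
    exact hQR w hw
  refine ⟨Q, fun z hz => ?_, fun z hz => ?_, fun h hh g hg hhg z hz => ?_⟩
  · rcases lt_trichotomy ‖z‖ 1 with h1 | h1 | h1
    · have hzb : ball (0:ℂ) 1 ∈ nhds z := isOpen_ball.mem_nhds (mem_ball_zero_iff.2 h1)
      refine (hQ₀.differentiableAt hzb).congr_of_eventuallyEq ?_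
      filter_upwards [hzb] with w hw using hQin w (mem_ball_zero_iff.1 hw)
    · obtain ⟨h, hh, hne⟩ := hz.resolve_left (not_not.2 h1)
      exact hres z (mem_resolventSet_of_powSum_ne_zero hK hh h1.le hne)
    · exact hres z (mem_resolventSet_of_one_lt_norm hK h1)
  · rw [hQR z (mem_resolventSet_of_one_lt_norm hK hz)]
    exact hasSum_pairCLM_resolvent hK hz y hf
  · rw [hQin z (mem_ball_zero_iff.1 hz)]
    exact hQ₀' h hh g hg hhg z hz

theorem bounded_of_summable_sq {c : ℕ → ℂ} (hc : Summable fun n => ‖c n‖ ^ 2) :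
    ∃ C, ∀ n, ‖c n‖ ≤ C := by
  refine ⟨Real.sqrt (∑' n, ‖c n‖ ^ 2), fun n => Real.le_sqrt_of_sq_le ?_⟩
  exact hc.le_tsum n fun _ _ => by positivity

theorem powSum_ne_zero_of_near_one {c : ℕ → ℂ} (hc : Summable fun n => ‖c n‖ ^ 2) {z : ℂ}
    (hz : ‖z‖ < 1)
    (h : ‖c 0 - 1‖ ^ 2 + ∑' n, ‖c (n + 1)‖ ^ 2 < ((1 - ‖z‖) / 2) ^ 2) : powSum c z ≠ 0 := by
  set η := (1 - ‖z‖) / 2 with hη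
  have hη0 : 0 < η := by rw [hη]; linarith
  have hs : Summable fun n => ‖c (n + 1)‖ ^ 2 := (summable_nat_add_iff 1).2 hc
  have ht : 0 ≤ ∑' n, ‖c (n + 1)‖ ^ 2 := tsum_nonneg fun _ => by positivity
  have h0 : ‖c 0 - 1‖ ≤ η := by
    refine (pow_le_pow_iff_left₀ (norm_nonneg _) hη0.le two_ne_zero).1 ?_
    linarith
  have hn (n : ℕ) : ‖c (n + 1)‖ ≤ η := by
    refine (pow_le_pow_iff_left₀ (norm_nonneg _) hη0.le two_ne_zero).1 ?_
    have := hs.le_tsum n fun _ _ => by positivity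
    nlinarith [sq_nonneg ‖c 0 - 1‖]
  obtain ⟨C, hC⟩ := bounded_of_summable_sq hc
  have hsum := (hasSum_nat_add_iff' 1).2 (hasSum_powSum hC hz)
  simp only [Finset.range_one, Finset.sum_singleton, pow_zero, mul_one] at hsum
  have hgeo : HasSum (fun n : ℕ => η * ‖z‖ ^ (n + 1)) (η * (‖z‖ * (1 - ‖z‖)⁻¹)) := by
    refine (((hasSum_geometric_of_lt_one (norm_nonneg z) hz).mul_left ‖z‖).mul_left η).congr_fun
      fun n => ?_
    ring
  have hle : ‖powSum c z - c 0‖ ≤ η * (‖z‖ * (1 - ‖z‖)⁻¹) := by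
    rw [← hsum.tsum_eq]
    refine tsum_of_norm_bounded hgeo fun n => ?_
    rw [norm_mul, norm_pow]
    gcongr
    exact hn n
  intro h0'
  rw [h0', zero_sub, norm_neg] at hle
  have h1 : (1 : ℝ) ≤ ‖c 0‖ + ‖c 0 - 1‖ := by
    calc (1 : ℝ) = ‖c 0 - (c 0 - 1)‖ := by simp
      _ ≤ _ := norm_sub_le _ _
  have hz' : 0 < 1 - ‖z‖ := by linarith
  have h2 : η * (‖z‖ * (1 - ‖z‖)⁻¹) = ‖z‖ / 2 := by rw [hη]; field_simp
  rw [h2] at hle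
  rw [hη] at h0
  linarith

theorem mul_sub_one_le_of_hasSum {ψ : ℕ → ℂ} {A : ℝ} (hψ : ∀ n, ‖ψ n‖ ≤ A) {z q : ℂ}
    (hz : 1 < ‖z‖) (h : HasSum (fun n => ψ n * z⁻¹ ^ (n + 1)) q) : ‖q‖ * (‖z‖ - 1) ≤ A := by
  have hz0 : 0 < ‖z‖ := by linarith
  have hr : ‖z‖⁻¹ < 1 := inv_lt_one_of_one_lt₀ hz
  have hgeo : HasSum (fun n : ℕ => A * ‖z‖⁻¹ ^ (n + 1)) (A * (‖z‖⁻¹ * (1 - ‖z‖⁻¹)⁻¹)) := by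
    refine (((hasSum_geometric_of_lt_one (by positivity) hr).mul_left ‖z‖⁻¹).mul_left A).congr_fun
      fun n => ?_
    ring
  have hle : ‖q‖ ≤ A * (‖z‖⁻¹ * (1 - ‖z‖⁻¹)⁻¹) := by
    rw [← h.tsum_eq]
    refine tsum_of_norm_bounded hgeo fun n => ?_
    rw [norm_mul, norm_pow, norm_inv]
    gcongr
    exact hψ n
  have hz1 : 0 < ‖z‖ - 1 := by linarith
  calc ‖q‖ * (‖z‖ - 1) ≤ A * (‖z‖⁻¹ * (1 - ‖z‖⁻¹)⁻¹) * (‖z‖ - 1) := by gcongr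
    _ = A := by
      have : (1 - ‖z‖⁻¹) = (‖z‖ - 1) / ‖z‖ := by field_simp
      rw [this]; field_simp

theorem cdist_eq_zero_of_mem {E : Set ℂ} {z : ℂ} (hz : z ∈ E) : cdist E z = 0 :=
  le_antisymm (by simpa using cdist_le_dist hz z) (cdist_nonneg E z)

/-- The Cauchy transform of the sequence `n ↦ ∑ k, f k * φ (k + n)`, continued across the circle
off `E`, is dominated by the outer function in the cusped neighbourhood of the disk. -/
theorem exists_cauchy_transform_bound {p : ℕ} (hp : 3 ≤ p) {K : Set (ℕ → ℂ)} (hK : IsShiftIdeal K)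
    (hKE : ∀ z, ‖z‖ = 1 → z ∉ Eset (1 / (p : ℝ)) → ∃ h ∈ K, powSum h z ≠ 0)
    {S : ℕ → ℂ} (hS : HasSum (fun n => ‖S n‖ ^ 2) 1)
    (hSK : ∀ h ∈ K, ∃ c : ℕ → ℂ, Summable (fun n => ‖c n‖ ^ 2) ∧ ∀ w, ‖w‖ < 1 →
      powSum h w = powSum S w * powSum c w ∧ ‖powSum c w‖ ≤ ∑' n, ‖h n‖)
    (hSε : ∀ ε > 0, ∃ h ∈ K, ∃ c : ℕ → ℂ, Summable (fun n => ‖c n‖ ^ 2) ∧ (∀ w, ‖w‖ < 1 →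
      powSum h w = powSum S w * powSum c w ∧ ‖powSum c w‖ ≤ ∑' n, ‖h n‖) ∧
      ‖c 0 - 1‖ ^ 2 + ∑' n, ‖c (n + 1)‖ ^ 2 < ε)
    {φ f : ℕ → ℂ} {C B : ℝ} {F : ℂ → ℂ} (hφ : ∀ n, ‖φ n‖ ≤ C)
    (hann : ∀ h ∈ K, ∀ i, ∑' l, h l * φ (l + i) = 0) (hf : Summable fun n => ‖f n‖)
    (hF : DifferentiableOn ℂ F (ball 0 1)) (hFB : ∀ w ∈ ball (0 : ℂ) 1, ‖F w‖ ≤ B)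
    (hfF : ∀ w ∈ ball (0 : ℂ) 1, powSum f w = powSum S w * F w) :
    ∃ (Q : ℂ → ℂ) (M A : ℝ), DifferentiableOn ℂ Q {z | 0 < cdist (Eset (1 / (p : ℝ))) z} ∧
      (∀ z, 1 < ‖z‖ → HasSum (fun n => (∑' k, f k * φ (k + n)) * z⁻¹ ^ (n + 1)) (Q z)) ∧
      (∀ z, 1 < ‖z‖ → ‖Q z‖ * (‖z‖ - 1) ≤ A) ∧
      ∀ z ∈ cuspNhd (Eset (1 / (p : ℝ))) 0, ‖Q z * outerFn p z‖ ≤ M := by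
  have hC0 : 0 ≤ C := (norm_nonneg _).trans (hφ 0)
  have hB0 : 0 ≤ B := (norm_nonneg _).trans (hFB 0 (mem_ball_self one_pos))
  have hdiff {c : ℕ → ℂ} (hc : Summable fun n => ‖c n‖ ^ 2) :
      DifferentiableOn ℂ (powSum c) (ball 0 1) := by
    obtain ⟨C', hC'⟩ := bounded_of_summable_sq hc
    exact differentiableOn_powSum hC'
  have hS0 : ∃ w ∈ ball (0 : ℂ) 1, powSum S w ≠ 0 := by
    by_contra! hcon
    obtain ⟨a, haK, ha0⟩ := hK.exists_ne
    obtain ⟨c, -, hc⟩ := hSK a haK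
    refine ha0 (powSum_coeff_unique (C := ∑' n, ‖a n‖) ?_ ?_ fun z hz => ?_)
    · exact norm_le_tsum_of_summable (hK.summable a haK)
    · intro n
      simpa using tsum_nonneg fun _ => norm_nonneg _
    · rw [(hc z (by simpa using hz)).1, hcon z hz]
      simp [powSum]
  obtain ⟨Q, hQd, hQs, hQg⟩ := exists_cauchy_transform (K := K) hK.summable hφ hann
    (hdiff hS.summable) hS0 hf hF hfF fun z hz => by
      have hz' : ‖z‖ < 1 := by simpa using hz
      obtain ⟨h, hh, c, hc, hw, hlt⟩ := hSε (((1 - ‖z‖) / 2) ^ 2) (by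
        have : 0 < 1 - ‖z‖ := by linarith
        positivity)
      exact ⟨h, hh, powSum c, hdiff hc, fun w hw' => (hw w (by simpa using hw')).1,
        powSum_ne_zero_of_near_one hc hz' hlt⟩
  have hψ (n : ℕ) : ‖∑' k, f k * φ (k + n)‖ ≤ (∑' k, ‖f k‖) * C := by
    refine tsum_of_norm_bounded (hf.hasSum.mul_right C) fun k => ?_
    rw [norm_mul]
    gcongr
    exact hφ _
  have hout (z : ℂ) (hz : 1 < ‖z‖) : ‖Q z‖ * (‖z‖ - 1) ≤ (∑' k, ‖f k‖) * C :=
    mul_sub_one_le_of_hasSum hψ hz (hQs z hz)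
  have hQE : DifferentiableOn ℂ Q {z | 0 < cdist (Eset (1 / (p : ℝ))) z} := fun z hz => by
    refine (hQd z ?_).differentiableWithinAt
    by_cases hz1 : ‖z‖ = 1
    · refine Or.inr (hKE z hz1 fun hzE => ?_)
      have hz : 0 < cdist (Eset (1 / (p : ℝ))) z := hz
      rw [cdist_eq_zero_of_mem hzE] at hz
      exact hz.false
    · exact Or.inl hz1
  refine ⟨Q, _, _, hQE, hQs, hout, fun z hz => norm_mul_le_of_mem_cuspNhd (Eset_subset_sphere _)
    (Eset_nonempty p) (Real.exp_nonneg (outerWeight p)) hQE (differentiableOn_outerFn hp)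
    (fun z hz => norm_outerFn_le hp hz) hout ?_ hz⟩
  intro e he
  have hδ : 0 < min (1 / 2) (e / (8 * Real.pi)) := lt_min (by norm_num) (by positivity)
  obtain ⟨h, hh, c, hc, hw, hlt⟩ := hSε (min (1 / 2) (e / (8 * Real.pi)) ^ 2) (by positivity)
  obtain ⟨σ, Z, hσm, hσ0, hσ1, hZ, hσc, hσi⟩ :=
    exists_log_majorant hc hδ (min_le_left _ _) hlt
  refine ⟨σ, B * (C * ∑' n, ‖h n‖) + C * ∑' n, ‖f n‖, Z, hσm, hσ0, hσ1, hZ, fun z hz hzZ => ?_,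
    fun ρ hρ => (hσi ρ hρ).trans (ENNReal.ofReal_le_ofReal ?_)⟩
  · obtain ⟨hcz, hcσ⟩ := hσc z hz hzZ
    have hz' : z ∈ ball (0 : ℂ) 1 := by simpa using hz
    have hid := hQg h hh (powSum c) (hdiff hc) (fun w hw' => (hw w (by simpa using hw')).1) z hz'
    have hQz : Q z = (powSum c z)⁻¹ * (F z * bracket φ h z) - bracket φ f z := by
      field_simp
      linear_combination hid
    have h1z : 0 ≤ 1 - ‖z‖ := by linarith
    have hbh := norm_bracket_mul_le hφ (hK.summable h hh) hz
    have hbf := norm_bracket_mul_le hφ hf hz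
    have hexp : 1 ≤ Real.exp (σ z) := Real.one_le_exp (hσ0 z)
    have hf0 : 0 ≤ C * ∑' n, ‖f n‖ := mul_nonneg hC0 (tsum_nonneg fun _ => norm_nonneg _)
    calc ‖Q z‖ * (1 - ‖z‖)
        ≤ (‖powSum c z‖⁻¹ * (‖F z‖ * ‖bracket φ h z‖) + ‖bracket φ f z‖) * (1 - ‖z‖) := by
          gcongr
          rw [hQz]
          refine (norm_sub_le _ _).trans ?_
          rw [norm_mul, norm_mul, norm_inv]
      _ = ‖powSum c z‖⁻¹ * (‖F z‖ * (‖bracket φ h z‖ * (1 - ‖z‖))) +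
          ‖bracket φ f z‖ * (1 - ‖z‖) := by ring
      _ ≤ Real.exp (σ z) * (B * (C * ∑' n, ‖h n‖)) + C * ∑' n, ‖f n‖ := by
          gcongr
          exact hFB z hz'
      _ ≤ Real.exp (σ z) * (B * (C * ∑' n, ‖h n‖)) + (C * ∑' n, ‖f n‖) * Real.exp (σ z) := by
          exact add_le_add le_rfl (le_mul_of_one_le_right hf0 hexp)
      _ = _ := by ring
  · calc 8 * Real.pi * min (1 / 2) (e / (8 * Real.pi)) ≤ 8 * Real.pi * (e / (8 * Real.pi)) := by
          gcongr
          exact min_le_right _ _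
      _ = e := by field_simp

theorem summable_taylorCoeff_of_bounded {F : ℂ → ℂ} {M : ℝ} (hF : DifferentiableOn ℂ F (ball 0 1))
    (hM : ∀ z ∈ ball (0 : ℂ) 1, ‖iteratedDeriv 2 F z‖ ≤ M) :
    Summable fun n => ‖taylorCoeff F n‖ := by
  have hF2 : DifferentiableOn ℂ (iteratedDeriv 2 F) (ball 0 1) := by
    have : iteratedDeriv 2 F = deriv (deriv F) := by
      rw [iteratedDeriv_eq_iterate]; rfl
    rw [this]
    exact (hF.deriv isOpen_ball).deriv isOpen_ball
  have hb (n : ℕ) : ‖iteratedDeriv (n + 2) F 0‖ ≤ n.factorial * M := by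
    have hr : ∀ r ∈ Ioo (0 : ℝ) 1, ‖iteratedDeriv (n + 2) F 0‖ ≤ n.factorial * M / r ^ n := by
      intro r hr
      have := Complex.norm_iteratedDeriv_le_of_forall_mem_sphere_norm_le (c := 0) (C := M)
        (f := iteratedDeriv 2 F) n hr.1
        (DifferentiableOn.diffContOnCl (hF2.mono (closure_ball_subset_closedBall.trans
          (closedBall_subset_ball hr.2)))) fun z hz => hM z (sphere_subset_closedBall.trans
            (closedBall_subset_ball hr.2) hz)
      rwa [iteratedDeriv_eq_iterate, iteratedDeriv_eq_iterate, ← Function.iterate_add_apply,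
        ← iteratedDeriv_eq_iterate] at this
    have hlim : Tendsto (fun r : ℝ => n.factorial * M / r ^ n) (nhdsWithin 1 (Iio 1))
        (nhds (n.factorial * M / 1 ^ n)) := by
      refine (ContinuousAt.tendsto ?_).mono_left nhdsWithin_le_nhds
      fun_prop (disch := norm_num)
    rw [one_pow, div_one] at hlim
    refine ge_of_tendsto hlim ?_
    filter_upwards [Ioo_mem_nhdsLT (show (0 : ℝ) < 1 by norm_num)] with r hr' using hr r hr'
  have hM0 : 0 ≤ M := (norm_nonneg _).trans (hM 0 (mem_ball_self one_pos))
  refine (summable_nat_add_iff 2).1 ?_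
  have hsum : Summable fun n : ℕ => M * (1 / ((n + 1 : ℕ) : ℝ) ^ 2) :=
    ((summable_nat_add_iff 1).2 (Real.summable_one_div_nat_pow.2 one_lt_two)).mul_left M
  refine hsum.of_nonneg_of_le (fun _ => norm_nonneg _) fun n => ?_
  unfold taylorCoeff
  rw [norm_div, Complex.norm_natCast, div_le_iff₀ (by positivity)]
  refine (hb n).trans ?_
  have h1 : ((n + 2).factorial : ℝ) = (n + 2) * (n + 1) * n.factorial := by
    rw [Nat.factorial_succ, Nat.factorial_succ]; push_cast; ring
  rw [h1]
  push_cast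
  have hf : (0 : ℝ) < n.factorial := by positivity
  have : M * (1 / ((n : ℝ) + 1) ^ 2) * ((n + 2) * (n + 1) * n.factorial) =
      n.factorial * M * ((n + 2) / (n + 1)) := by
    field_simp
  rw [this]
  refine le_mul_of_one_le_right (by positivity) ?_
  rw [le_div_iff₀ (by positivity)]
  linarith

theorem hasSum_taylorCoeff {F : ℂ → ℂ} (hF : DifferentiableOn ℂ F (ball 0 1)) {z : ℂ}
    (hz : z ∈ ball (0 : ℂ) 1) : HasSum (fun n => taylorCoeff F n * z ^ n) (F z) := by
  refine (Complex.hasSum_taylorSeries_on_ball hF hz).congr_fun fun n => ?_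
  simp only [taylorCoeff, sub_zero, smul_eq_mul]
  ring

theorem closedBall_subset_cuspNhd {E : Set ℂ} {z : ℂ} (hz : z ∈ ball (0 : ℂ) 1)
    {w : ℂ} (hw : ‖w - z‖ ≤ cdist E z ^ 2 / 1000) :
    w ∈ cuspNhd E 0 ∨ cdist E z = 0 := by
  rcases (cdist_nonneg E z).eq_or_lt with h0 | h0
  · exact Or.inr h0.symm
  left
  have h1 := cdist_le_add E z w
  have h2 := cdist_le_one E z
  have h3 : ‖w‖ ≤ ‖z‖ + ‖w - z‖ := by
    simpa using norm_add_le z (w - z)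
  have hz' : ‖z‖ < 1 := by simpa using hz
  rw [norm_sub_rev] at h1
  have h4 : 999 / 1000 * cdist E z ≤ cdist E w := by nlinarith
  show ‖w‖ < 1 + cdist E w ^ 2 / 100 - 0
  nlinarith

theorem exists_outer_coeff {p : ℕ} (hp : 3 ≤ p) : ∃ c : ℕ → ℂ, (Summable fun n => ‖c n‖) ∧
    c 0 ≠ 0 ∧ ∀ z ∈ ball (0 : ℂ) 1, powSum c z = outerFn p z ^ 3 := by
  set E := Eset (1 / (p : ℝ)) with hE
  have hd : DifferentiableOn ℂ (fun z => outerFn p z ^ 3) (cuspNhd E 0) :=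
    (differentiableOn_outerFn hp).pow 3
  have hd1 := hd.mono (ball_subset_cuspNhd E)
  refine ⟨taylorCoeff fun z => outerFn p z ^ 3, ?_, ?_, fun z hz =>
    (hasSum_taylorCoeff hd1 hz).tsum_eq⟩
  · refine summable_taylorCoeff_of_bounded
      (M := 2 * (Real.exp (outerWeight p) * 2 ^ 4) ^ 3 * 1000 ^ 2) hd1 fun z hz => ?_
    have hz' : ‖z‖ < 1 := by simpa using hz
    have hpos : 0 < cdist E z :=
      cdist_pos_of_norm_ne_one (Eset_subset_sphere _) (Eset_nonempty p) hz'.ne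
    have hle := cdist_le_one E z
    have hsub : closedBall z (cdist E z ^ 2 / 1000) ⊆ cuspNhd E 0 := fun w hw =>
      (closedBall_subset_cuspNhd hz (by rwa [mem_closedBall, dist_eq_norm] at hw)).resolve_right
        hpos.ne'
    have := Complex.norm_iteratedDeriv_le_of_forall_mem_sphere_norm_le
      (C := (Real.exp (outerWeight p) * (2 * cdist E z) ^ 4) ^ 3) 2
      (show 0 < cdist E z ^ 2 / 1000 by positivity)
      (DifferentiableOn.diffContOnCl (hd.mono (closure_ball_subset_closedBall.trans hsub)))
      fun w hw => by
        have hw1 := sphere_subset_closedBall hw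
        rw [norm_pow]
        have h1 := norm_outerFn_le hp (hsub hw1)
        have h2 := cdist_le_add E w z
        rw [mem_closedBall, dist_eq_norm] at hw1
        have h3 : cdist E w ≤ 2 * cdist E z := by nlinarith
        have h4 := cdist_nonneg E w
        calc ‖outerFn p w‖ ^ 3 ≤ (Real.exp (outerWeight p) * cdist E w ^ 4) ^ 3 := by gcongr
          _ ≤ _ := by gcongr
    refine this.trans ?_
    rw [div_le_iff₀ (by positivity)]
    have : cdist E z ^ 12 ≤ cdist E z ^ 4 := pow_le_pow_of_le_one hpos.le hle (by norm_num)
    have he := Real.exp_pos (outerWeight p)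
    calc ((2 : ℕ).factorial : ℝ) * (Real.exp (outerWeight p) * (2 * cdist E z) ^ 4) ^ 3
        = 2 * (Real.exp (outerWeight p) * 2 ^ 4) ^ 3 * cdist E z ^ 12 := by
          simp only [Nat.factorial]; push_cast; ring
      _ ≤ 2 * (Real.exp (outerWeight p) * 2 ^ 4) ^ 3 * cdist E z ^ 4 := by gcongr
      _ = _ := by ring
  · simp [taylorCoeff, outerFn]

theorem hasSum_circleIntegral {F : ℕ → ℂ → ℂ} {f : ℂ → ℂ} {R : ℝ} (hR : 0 ≤ R) {u : ℕ → ℝ}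
    (hc : ∀ n, ContinuousOn (F n) (sphere 0 R)) (hu : Summable u)
    (hb : ∀ n, ∀ z ∈ sphere (0 : ℂ) R, ‖F n z‖ ≤ u n)
    (hs : ∀ z ∈ sphere (0 : ℂ) R, HasSum (fun n => F n z) (f z)) :
    HasSum (fun n => ∮ z in C(0, R), F n z) (∮ z in C(0, R), f z) := by
  unfold circleIntegral
  have hmem (θ : ℝ) : circleMap 0 R θ ∈ sphere (0 : ℂ) R := circleMap_mem_sphere _ hR θ
  refine intervalIntegral.hasSum_integral_of_dominated_convergence (fun n _ => R * u n)
    (fun n => ?_) (fun n => ?_) ?_ ?_ ?_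
  · refine Continuous.aestronglyMeasurable ?_
    have h1 : Continuous fun θ => F n (circleMap 0 R θ) :=
      (hc n).comp_continuous (continuous_circleMap _ _) hmem
    have h2 : Continuous fun θ => deriv (circleMap 0 R) θ := by
      simp only [deriv_circleMap]; fun_prop
    exact h2.smul h1
  · refine Eventually.of_forall fun θ _ => ?_
    rw [norm_smul, deriv_circleMap, norm_mul, norm_circleMap_zero, Complex.norm_I, mul_one,
      abs_of_nonneg hR]
    gcongr
    exact hb n _ (hmem θ)
  · exact Eventually.of_forall fun θ _ => hu.mul_left R
  · exact continuous_const.intervalIntegrable _ _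
  · exact Eventually.of_forall fun θ _ => (hs _ (hmem θ)).const_smul _

theorem circleIntegral_pow_mul_of_hasSum {ψ : ℕ → ℂ} {A R : ℝ} (hψ : ∀ n, ‖ψ n‖ ≤ A) (hR : 1 < R)
    {Q : ℂ → ℂ} (hQ : ∀ z, 1 < ‖z‖ → HasSum (fun n => ψ n * z⁻¹ ^ (n + 1)) (Q z)) (m : ℕ) :
    ∮ z in C(0, R), z ^ m * Q z = 2 * Real.pi * I * ψ m := by
  have hR0 : 0 < R := by linarith
  have hne {z : ℂ} (hz : z ∈ sphere (0 : ℂ) R) : z ≠ 0 := by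
    rintro rfl; simp at hz; exact hR0.ne hz
  have h := hasSum_circleIntegral (F := fun n z => z ^ m * (ψ n * z⁻¹ ^ (n + 1)))
    (f := fun z => z ^ m * Q z) hR0.le (u := fun n => R ^ m * (A * R⁻¹ ^ (n + 1)))
    (fun n => by
      refine (continuousOn_id.pow m).mul (continuousOn_const.mul (ContinuousOn.pow ?_ _))
      exact continuousOn_inv₀.mono fun z hz => hne hz)
    ((((summable_nat_add_iff 1).2 (summable_geometric_of_lt_one (inv_nonneg.2 hR0.le)
      (inv_lt_one_of_one_lt₀ hR))).mul_left A).mul_left _)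
    (fun n z hz => by
      have hz' : ‖z‖ = R := by simpa using hz
      rw [norm_mul, norm_mul, norm_pow, norm_pow, norm_inv, hz']
      gcongr
      exact hψ n)
    fun z hz => (hQ z (by have hz' : ‖z‖ = R := by simpa using hz
                          rwa [hz'])).mul_left _
  refine h.unique ?_
  have hval : (fun n => ∮ z in C(0, R), z ^ m * (ψ n * z⁻¹ ^ (n + 1))) =
      fun n => ψ n * ∮ z in C(0, R), (z - 0) ^ ((m : ℤ) - (n + 1)) := by
    funext n
    rw [← smul_eq_mul (ψ n), ← circleIntegral.integral_smul]
    refine circleIntegral.integral_congr hR0.le fun z hz => ?_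
    rw [sub_zero, zpow_sub₀ (hne hz), zpow_natCast, smul_eq_mul]
    norm_cast
    rw [inv_pow, div_eq_mul_inv]
    ring
  rw [hval]
  convert hasSum_single (f := fun n => ψ n * ∮ z in C(0, R), (z - 0) ^ ((m : ℤ) - (n + 1))) m ?_
    using 1
  · have : ((m : ℤ) - (m + 1)) = -1 := by ring
    rw [this]
    simp only [zpow_neg_one]
    rw [circleIntegral.integral_sub_center_inv 0 hR0.ne']
    ring
  · intro n hn
    rw [circleIntegral.integral_sub_zpow_of_ne (by lia), mul_zero]

theorem hasSum_circleIntegral_powSum_reflect {c ψ : ℕ → ℂ} {A R : ℝ} (hc : Summable fun n => ‖c n‖)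
    (hψ : ∀ n, ‖ψ n‖ ≤ A) (hR : 1 < R) {Q : ℂ → ℂ} (hQc : ContinuousOn Q (sphere 0 R))
    (hQ : ∀ z, 1 < ‖z‖ → HasSum (fun n => ψ n * z⁻¹ ^ (n + 1)) (Q z)) (N : ℕ) :
    HasSum (fun k => c k * (((R : ℂ) ^ 2)⁻¹) ^ (N * k) * (2 * Real.pi * I * ψ (N * k)))
      (∮ z in C(0, R), powSum c ((z / (R : ℂ) ^ 2) ^ N) * Q z) := by
  have hR0 : 0 < R := by linarith
  have hsph {z : ℂ} (hz : z ∈ sphere (0 : ℂ) R) : ‖z‖ = R := by simpa using hz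
  have hle {z : ℂ} (hz : z ∈ sphere (0 : ℂ) R) : ‖(z / (R : ℂ) ^ 2) ^ N‖ ≤ 1 := by
    rw [norm_pow, norm_div, norm_pow, Complex.norm_real, Real.norm_of_nonneg hR0.le, hsph hz]
    refine pow_le_one₀ (by positivity) ?_
    rw [div_le_one (by positivity)]
    nlinarith
  have h := hasSum_circleIntegral (F := fun k z => c k * ((z / (R : ℂ) ^ 2) ^ N) ^ k * Q z)
    (f := fun z => powSum c ((z / (R : ℂ) ^ 2) ^ N) * Q z) hR0.le
    (u := fun k => ‖c k‖ * (A / (R - 1)))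
    (fun k => by
      refine ContinuousOn.mul (Continuous.continuousOn ?_) hQc
      fun_prop)
    (hc.mul_right _)
    (fun k z hz => by
      have hQz : ‖Q z‖ ≤ A / (R - 1) := by
        rw [le_div_iff₀ (by linarith)]
        have := mul_sub_one_le_of_hasSum hψ (by rwa [hsph hz]) (hQ z (by rwa [hsph hz]))
        rwa [hsph hz] at this
      rw [norm_mul, norm_mul, norm_pow]
      refine mul_le_mul ?_ hQz (norm_nonneg _) (norm_nonneg _)
      exact mul_le_of_le_one_right (norm_nonneg _) (pow_le_one₀ (norm_nonneg _) (hle hz)))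
    fun z hz => (hasSum_powSum_of_summable hc (hle hz)).mul_right _
  refine h.congr_fun fun k => ?_
  rw [← circleIntegral_pow_mul_of_hasSum hψ hR hQ (N * k), ← smul_eq_mul,
    ← circleIntegral.integral_smul]
  refine circleIntegral.integral_congr hR0.le fun z hz => ?_
  rw [smul_eq_mul, ← pow_mul, div_eq_mul_inv, mul_pow]
  ring

theorem norm_mul_le_of_hasSum {c ψ : ℕ → ℂ} {r : ℕ → ℂ} {s : ℂ} {ε : ℝ} {N : ℕ}
    (hc : Summable fun n => ‖c n‖) (hr : ∀ k, ‖r k‖ ≤ 1) (hr0 : r 0 = 1)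
    (hψ : ∀ m, N ≤ m → ‖ψ m‖ ≤ ε)
    (h : HasSum (fun k => c k * r k * (2 * Real.pi * I * ψ (N * k))) s) :
    2 * Real.pi * (‖c 0‖ * ‖ψ 0‖) ≤ ‖s‖ + (∑' k, ‖c k‖) * (2 * Real.pi * ε) := by
  have hε : 0 ≤ ε := (norm_nonneg _).trans (hψ N le_rfl)
  have hpi := Real.pi_pos
  have h1 := (hasSum_nat_add_iff' 1).2 h
  simp only [Finset.range_one, Finset.sum_singleton, hr0, mul_zero, mul_one] at h1
  have hc1 : Summable fun n => ‖c (n + 1)‖ := (summable_nat_add_iff 1).2 hc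
  have hn2 : ‖(2 * Real.pi * I : ℂ)‖ = 2 * Real.pi := by
    simp [abs_of_pos hpi]
  have hle : ‖s - c 0 * (2 * Real.pi * I * ψ 0)‖ ≤ (∑' k, ‖c (k + 1)‖) * (2 * Real.pi * ε) := by
    rw [← h1.tsum_eq]
    refine tsum_of_norm_bounded (hc1.hasSum.mul_right _) fun k => ?_
    rw [norm_mul, norm_mul, norm_mul, hn2]
    have hk := hψ (N * (k + 1)) (Nat.le_mul_of_pos_right _ k.succ_pos)
    calc ‖c (k + 1)‖ * ‖r (k + 1)‖ * (2 * Real.pi * ‖ψ (N * (k + 1))‖)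
        ≤ ‖c (k + 1)‖ * 1 * (2 * Real.pi * ε) := by gcongr; exact hr _
      _ = _ := by ring
  have hle2 : (∑' k, ‖c (k + 1)‖) ≤ ∑' k, ‖c k‖ := by
    rw [hc.tsum_eq_zero_add]
    linarith [norm_nonneg (c 0)]
  have h3 : ‖c 0 * (2 * Real.pi * I * ψ 0)‖ = 2 * Real.pi * (‖c 0‖ * ‖ψ 0‖) := by
    rw [norm_mul, norm_mul, hn2]; ring
  rw [← h3]
  calc ‖c 0 * (2 * Real.pi * I * ψ 0)‖ = ‖s - (s - c 0 * (2 * Real.pi * I * ψ 0))‖ := by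
        congr 1; ring
    _ ≤ ‖s‖ + ‖s - c 0 * (2 * Real.pi * I * ψ 0)‖ := norm_sub_le _ _
    _ ≤ _ := by
      refine add_le_add le_rfl (hle.trans ?_)
      gcongr

theorem norm_outerFn_mul_le_inside {p : ℕ} (hp : 3 ≤ p) {Q : ℂ → ℂ} {M : ℝ}
    (hM : ∀ z ∈ cuspNhd (Eset (1 / (p : ℝ))) 0, ‖Q z * outerFn p z‖ ≤ M) (n : ℕ) {z : ℂ}
    (hz : ‖z‖ < 1) :
    ‖outerFn p (z ^ p ^ n) ^ 3 * Q z‖ ≤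
      (Real.exp (3 * outerWeight p) ^ n) ^ 3 * Real.exp (outerWeight p) * M *
        cdist (Eset (1 / (p : ℝ))) z ^ 2 := by
  have hzc := ball_subset_cuspNhd (Eset (1 / (p : ℝ))) (by simpa using hz : z ∈ ball (0 : ℂ) 1)
  have h1 := norm_outerFn_pow_pow_le hp n hz
  have h2 := norm_outerFn_le_one hp hz
  have h3 := norm_outerFn_le hp hzc
  have h4 := hM z hzc
  have hM0 : 0 ≤ M := (norm_nonneg _).trans h4
  have h5 := cdist_nonneg (Eset (1 / (p : ℝ))) z
  have h6 := cdist_le_one (Eset (1 / (p : ℝ))) z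
  rw [norm_mul] at h4
  rw [norm_mul, norm_pow]
  calc ‖outerFn p (z ^ p ^ n)‖ ^ 3 * ‖Q z‖
      ≤ (Real.exp (3 * outerWeight p) ^ n * ‖outerFn p z‖) ^ 3 * ‖Q z‖ := by gcongr
    _ = (Real.exp (3 * outerWeight p) ^ n) ^ 3 * (‖Q z‖ * ‖outerFn p z‖) *
        (‖outerFn p z‖ * ‖outerFn p z‖) := by ring
    _ ≤ (Real.exp (3 * outerWeight p) ^ n) ^ 3 * M *
        (Real.exp (outerWeight p) * cdist (Eset (1 / (p : ℝ))) z ^ 4 * 1) := by gcongr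
    _ ≤ (Real.exp (3 * outerWeight p) ^ n) ^ 3 * M *
        (Real.exp (outerWeight p) * cdist (Eset (1 / (p : ℝ))) z ^ 2 * 1) := by
        gcongr ?_ * (?_ * ?_ * 1)
        exact pow_le_pow_of_le_one h5 h6 (by norm_num)
    _ = _ := by ring

theorem norm_outerFn_mul_le_outside {p : ℕ} (hp : 3 ≤ p) {Q : ℂ → ℂ} {M A : ℝ} (hA0 : 0 ≤ A)
    (hM : ∀ z ∈ cuspNhd (Eset (1 / (p : ℝ))) 0, ‖Q z * outerFn p z‖ ≤ M)
    (hA : ∀ z, 1 < ‖z‖ → ‖Q z‖ * (‖z‖ - 1) ≤ A) (n : ℕ) {z : ℂ}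
    (hz : 1 < ‖z‖) (hz2 : ‖z‖ ≤ 2) :
    ‖outerFn p ((z / (‖z‖ : ℂ) ^ 2) ^ p ^ n) ^ 3 * Q z‖ ≤
      (Real.exp (3 * outerWeight p) ^ n) ^ 3 * Real.exp (outerWeight p) *
        (Real.exp (3 * outerWeight p) * M + 900 * A) *
        cdist (Eset (1 / (p : ℝ))) (z / (‖z‖ : ℂ) ^ 2) ^ 2 := by
  set E := Eset (1 / (p : ℝ)) with hE
  set w := z / (‖z‖ : ℂ) ^ 2 with hw
  have hz0 : 0 < ‖z‖ := by linarith
  have hwn : ‖w‖ = ‖z‖⁻¹ := by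
    rw [hw, norm_div, norm_pow, Complex.norm_real, norm_norm]; field_simp
  have hw1 : ‖w‖ < 1 := by rw [hwn]; exact inv_lt_one_of_one_lt₀ hz
  have hwc := ball_subset_cuspNhd E (by simpa using hw1 : w ∈ ball (0 : ℂ) 1)
  have h1 := norm_outerFn_pow_pow_le hp n hw1
  have h2 := norm_outerFn_le_one hp hw1
  have h3 := norm_outerFn_le hp hwc
  have hM0 : 0 ≤ M :=
    (norm_nonneg _).trans (hM 0 (ball_subset_cuspNhd _ (mem_ball_self one_pos)))
  have h5 := cdist_nonneg E w
  have h6 := cdist_le_one E w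
  set κ := Real.exp (3 * outerWeight p) ^ n with hκ
  have hκ0 : 0 ≤ κ := by positivity
  rw [norm_mul, norm_pow]
  have hbase : ‖outerFn p (w ^ p ^ n)‖ ^ 3 * ‖Q z‖ ≤ κ ^ 3 * (‖outerFn p w‖ ^ 3 * ‖Q z‖) := by
    calc ‖outerFn p (w ^ p ^ n)‖ ^ 3 * ‖Q z‖ ≤ (κ * ‖outerFn p w‖) ^ 3 * ‖Q z‖ := by gcongr
      _ = _ := by ring
  refine hbase.trans ?_
  suffices ‖outerFn p w‖ ^ 3 * ‖Q z‖ ≤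
      Real.exp (outerWeight p) * (Real.exp (3 * outerWeight p) * M + 900 * A) * cdist E w ^ 2 by
    calc _ ≤ κ ^ 3 * (Real.exp (outerWeight p) * (Real.exp (3 * outerWeight p) * M + 900 * A) *
          cdist E w ^ 2) := by gcongr
      _ = _ := by ring
  have h42 : cdist E w ^ 4 ≤ cdist E w ^ 2 := pow_le_pow_of_le_one h5 h6 (by norm_num)
  by_cases hzc : z ∈ cuspNhd E 0
  · have h7 := norm_outerFn_reflect_le hp hzc hz
    have h8 := hM z hzc
    rw [norm_mul] at h8
    calc ‖outerFn p w‖ ^ 3 * ‖Q z‖ = ‖outerFn p w‖ ^ 2 * ‖outerFn p w‖ * ‖Q z‖ := by ring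
      _ ≤ (Real.exp (3 * outerWeight p) * ‖outerFn p z‖) *
          (Real.exp (outerWeight p) * cdist E w ^ 4) * ‖Q z‖ := by gcongr
      _ = Real.exp (outerWeight p) * (Real.exp (3 * outerWeight p) * (‖Q z‖ * ‖outerFn p z‖)) *
          cdist E w ^ 4 := by ring
      _ ≤ Real.exp (outerWeight p) * (Real.exp (3 * outerWeight p) * M) * cdist E w ^ 2 := by
          gcongr
      _ ≤ _ := by
          gcongr
          linarith
  · have hzc' : 1 + cdist E z ^ 2 / 100 ≤ ‖z‖ := by
      have : ¬ (‖z‖ < 1 + cdist E z ^ 2 / 100 - 0) := hzc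
      linarith
    have hmin := min_abs_norm_sub_one_le_cdist (Eset_subset_sphere (1 / (p : ℝ)))
      (Eset_nonempty p) z
    rw [abs_of_pos (by linarith : 0 < ‖z‖ - 1), min_eq_right (by linarith)] at hmin
    have hdist : ‖w - z‖ ≤ 2 * (‖z‖ - 1) := by
      have : w - z = z * (((‖z‖⁻¹) ^ 2 - 1 : ℝ) : ℂ) := by
        rw [hw]; push_cast; field_simp
      have hi : ‖z‖⁻¹ ≤ 1 := (inv_lt_one_of_one_lt₀ hz).le
      have hi0 : 0 < ‖z‖⁻¹ := by positivity
      have hi1 : ‖z‖ * ‖z‖⁻¹ = 1 := mul_inv_cancel₀ hz0.ne'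
      rw [this, norm_mul, Complex.norm_real, Real.norm_of_nonpos (by nlinarith)]
      nlinarith
    have h9 := cdist_le_add E w z
    have h10 : cdist E w ≤ 3 * cdist E z := by linarith
    have h11 := hA z hz
    calc ‖outerFn p w‖ ^ 3 * ‖Q z‖ = ‖outerFn p w‖ * (‖outerFn p w‖ ^ 2) * ‖Q z‖ := by ring
      _ ≤ (Real.exp (outerWeight p) * cdist E w ^ 4) * 1 * ‖Q z‖ := by
          gcongr
          exact pow_le_one₀ (norm_nonneg _) h2
      _ = Real.exp (outerWeight p) * (cdist E w ^ 2 * ‖Q z‖) * cdist E w ^ 2 := by ring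
      _ ≤ Real.exp (outerWeight p) * ((900 * (‖z‖ - 1)) * ‖Q z‖) * cdist E w ^ 2 := by
          gcongr
          calc cdist E w ^ 2 ≤ (3 * cdist E z) ^ 2 := by gcongr
            _ ≤ _ := by linarith
      _ = Real.exp (outerWeight p) * (900 * (‖Q z‖ * (‖z‖ - 1))) * cdist E w ^ 2 := by ring
      _ ≤ Real.exp (outerWeight p) * (900 * A) * cdist E w ^ 2 := by gcongr
      _ ≤ _ := by
          gcongr
          have : 0 ≤ Real.exp (3 * outerWeight p) * M := by positivity
          linarith

section ContourLimit

variable {E : Set ℂ} {Q : ℂ → ℂ} {c : ℕ → ℂ} {L : ℝ} {N : ℕ}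

theorem norm_le_on_closedBall (hQ : DifferentiableOn ℂ Q {z | 0 < cdist E z})
    (hc : Summable fun n => ‖c n‖)
    (hin : ∀ z, ‖z‖ < 1 → ‖powSum c (z ^ N) * Q z‖ ≤ L * cdist E z ^ 2) {z : ℂ}
    (hz : z ∈ closedBall (0 : ℂ) 1) (h0 : 0 < cdist E z) :
    ‖powSum c (z ^ N) * Q z‖ ≤ L * cdist E z ^ 2 := by
  have hz' : z ∈ closure (ball (0 : ℂ) 1) := by rwa [closure_ball _ one_ne_zero]
  have hQc : ContinuousAt Q z := ((hQ.differentiableAt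
    ((isOpen_lt continuous_const (continuous_cdist E)).mem_nhds h0))).continuousAt
  have hP : ContinuousOn (fun z => powSum c (z ^ N)) (closedBall 0 1) :=
    (continuousOn_powSum hc).comp (by fun_prop) fun w hw => by
      have : ‖w‖ ≤ 1 := by simpa using hw
      simpa using pow_le_one₀ (norm_nonneg _) this
  refine ContinuousWithinAt.closure_le hz' (f := fun z => ‖powSum c (z ^ N) * Q z‖)
    (g := fun z => L * cdist E z ^ 2) ?_ ?_ fun w hw => hin w (by simpa using hw)
  · exact (((hP z hz).mono ball_subset_closedBall).mul hQc.continuousWithinAt).norm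
  · exact ((continuous_const.mul ((continuous_cdist E).pow 2))).continuousWithinAt

open Classical in
/-- The boundary function of `z ↦ powSum c (z ^ N) * Q z`, extended by zero to `E`. -/
def zeroExt (E : Set ℂ) (Q : ℂ → ℂ) (c : ℕ → ℂ) (N : ℕ) (z : ℂ) : ℂ :=
  if cdist E z = 0 then 0 else powSum c (z ^ N) * Q z

theorem circleIntegral_zeroExt (hE : E ⊆ sphere 0 1) (hne : E.Nonempty)
    (hQ : DifferentiableOn ℂ Q {z | 0 < cdist E z}) (hc : Summable fun n => ‖c n‖)
    (hN : N ≠ 0)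
    (hin : ∀ z, ‖z‖ < 1 → ‖powSum c (z ^ N) * Q z‖ ≤ L * cdist E z ^ 2) :
    ∮ z in C(0, 1), zeroExt E Q c N z = 0 := by
  have hop : IsOpen {z | 0 < cdist E z} := isOpen_lt continuous_const (continuous_cdist E)
  have hev {z : ℂ} (h0 : 0 < cdist E z) :
      (fun z => powSum c (z ^ N) * Q z) =ᶠ[nhds z] zeroExt E Q c N := by
    filter_upwards [hop.mem_nhds h0] with w hw
    have hw : 0 < cdist E w := hw
    simp [zeroExt, hw.ne']
  have hP : ContinuousOn (fun z => powSum c (z ^ N)) (closedBall 0 1) :=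
    (continuousOn_powSum hc).comp (by fun_prop) fun w hw => by
      have : ‖w‖ ≤ 1 := by simpa using hw
      simpa using pow_le_one₀ (norm_nonneg _) this
  refine Complex.circleIntegral_eq_zero_of_differentiable_on_off_countable zero_le_one
    countable_empty ?_ ?_
  · intro z hz
    rcases (cdist_nonneg E z).eq_or_lt with h0 | h0
    · have hz0 : zeroExt E Q c N z = 0 := by simp [zeroExt, ← h0]
      rw [ContinuousWithinAt, hz0]
      refine squeeze_zero_norm' (a := fun w => L * cdist E w ^ 2) ?_ ?_
      · filter_upwards [self_mem_nhdsWithin] with w hw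
        rcases (cdist_nonneg E w).eq_or_lt with hw0 | hw0
        · simp [zeroExt, ← hw0]
        · rw [zeroExt, if_neg hw0.ne']
          exact norm_le_on_closedBall hQ hc hin hw hw0
      · have : Continuous fun w => L * cdist E w ^ 2 :=
          continuous_const.mul ((continuous_cdist E).pow 2)
        have h := (this.tendsto z).mono_left (nhdsWithin_le_nhds (s := closedBall 0 1))
        simpa [← h0] using h
    · have hQc := (hQ.differentiableAt (hop.mem_nhds h0)).continuousAt
      exact ((hP z hz).mul hQc.continuousWithinAt).congr_of_eventuallyEq
        ((hev h0).symm.filter_mono nhdsWithin_le_nhds) (hev h0).symm.eq_of_nhds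
  · rintro z ⟨hz, -⟩
    have hz' : ‖z‖ < 1 := by simpa using hz
    have h0 : 0 < cdist E z := cdist_pos_of_norm_ne_one hE hne hz'.ne
    refine DifferentiableAt.congr_of_eventuallyEq ?_ (hev h0).symm
    refine DifferentiableAt.mul ?_ (hQ.differentiableAt (hop.mem_nhds h0))
    have hzN : z ^ N ∈ ball (0 : ℂ) 1 := by
      simpa using pow_lt_one₀ (norm_nonneg z) hz' hN
    have hd : DifferentiableAt ℂ (powSum c) (z ^ N) :=
      (differentiableOn_powSum (norm_le_tsum_of_summable hc)).differentiableAt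
        (isOpen_ball.mem_nhds hzN)
    exact hd.comp z (f := fun z => z ^ N) (by fun_prop)

theorem tendsto_circleIntegral_reflect (hE : E ⊆ sphere 0 1) (hne : E.Nonempty)
    (hQ : DifferentiableOn ℂ Q {z | 0 < cdist E z}) (hc : Summable fun n => ‖c n‖)
    (hL : 0 ≤ L)
    (hout : ∀ z, 1 < ‖z‖ → ‖z‖ ≤ 2 → ‖powSum c ((z / (‖z‖ : ℂ) ^ 2) ^ N) * Q z‖ ≤
      L * cdist E (z / (‖z‖ : ℂ) ^ 2) ^ 2) :
    Tendsto (fun R : ℝ => ∮ z in C(0, R), powSum c ((z / (R : ℂ) ^ 2) ^ N) * Q z)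
      (nhdsWithin 1 (Ioi 1)) (nhds (∮ z in C(0, 1), zeroExt E Q c N z)) := by
  have hop : IsOpen {z | 0 < cdist E z} := isOpen_lt continuous_const (continuous_cdist E)
  have hmem : Ioo (1 : ℝ) 2 ∈ nhdsWithin (1 : ℝ) (Ioi 1) := Ioo_mem_nhdsGT one_lt_two
  have hnc {R : ℝ} (hR : R ∈ Ioo (1 : ℝ) 2) (θ : ℝ) : ‖circleMap 0 R θ‖ = R := by
    rw [norm_circleMap_zero, abs_of_pos (by linarith [hR.1])]
  have hrefl {R : ℝ} (hR : R ∈ Ioo (1 : ℝ) 2) (θ : ℝ) :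
      ‖circleMap 0 R θ / (R : ℂ) ^ 2‖ ≤ 1 := by
    rw [norm_div, norm_pow, Complex.norm_real, hnc hR, Real.norm_of_nonneg (by linarith [hR.1]),
      div_le_one (by nlinarith [hR.1])]
    nlinarith [hR.1]
  have hpow {w : ℂ} (hw : ‖w‖ ≤ 1) : w ^ N ∈ closedBall (0 : ℂ) 1 := by
    simpa using pow_le_one₀ (norm_nonneg _) hw
  have hbd {R : ℝ} (hR : R ∈ Ioo (1 : ℝ) 2) (θ : ℝ) :
      ‖powSum c ((circleMap 0 R θ / (R : ℂ) ^ 2) ^ N) * Q (circleMap 0 R θ)‖ ≤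
        L * cdist E (circleMap 0 R θ / (R : ℂ) ^ 2) ^ 2 := by
    have := hout (circleMap 0 R θ) (by rw [hnc hR]; exact hR.1) (by rw [hnc hR]; exact hR.2.le)
    rwa [hnc hR] at this
  have hcm (θ : ℝ) : Continuous fun R : ℝ => circleMap 0 R θ := by
    unfold circleMap; fun_prop
  have hrl (θ : ℝ) : Tendsto (fun R : ℝ => circleMap 0 R θ / (R : ℂ) ^ 2) (nhdsWithin 1 (Ioi 1))
      (nhds (circleMap 0 1 θ)) := by
    have : ContinuousAt (fun R : ℝ => circleMap 0 R θ / (R : ℂ) ^ 2) 1 :=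
      (hcm θ).continuousAt.div (by fun_prop) (by simp)
    have h := this.tendsto.mono_left (nhdsWithin_le_nhds (s := Ioi 1))
    simpa using h
  unfold circleIntegral
  refine intervalIntegral.tendsto_integral_filter_of_dominated_convergence (fun _ => 2 * L)
    ?_ ?_ (continuous_const.intervalIntegrable _ _) ?_
  · filter_upwards [hmem] with R hR
    refine Continuous.aestronglyMeasurable ?_
    have h2 : Continuous fun θ => deriv (circleMap 0 R) θ := by
      simp only [deriv_circleMap]; fun_prop
    have hP : Continuous fun θ => powSum c ((circleMap 0 R θ / (R : ℂ) ^ 2) ^ N) :=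
      (continuousOn_powSum hc).comp_continuous (by fun_prop) fun θ => hpow (hrefl hR θ)
    have hQ' : Continuous fun θ => Q (circleMap 0 R θ) :=
      hQ.continuousOn.comp_continuous (by fun_prop) fun θ =>
        cdist_pos_of_norm_ne_one hE hne (by rw [hnc hR]; exact hR.1.ne')
    exact h2.smul (hP.mul hQ')
  · filter_upwards [hmem] with R hR
    refine Eventually.of_forall fun θ _ => ?_
    rw [norm_smul, deriv_circleMap, norm_mul, hnc hR, Complex.norm_I, mul_one]
    refine mul_le_mul hR.2.le ((hbd hR θ).trans ?_) (norm_nonneg _) zero_le_two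
    exact mul_le_of_le_one_right hL (pow_le_one₀ (cdist_nonneg _ _) (cdist_le_one _ _))
  · refine Eventually.of_forall fun θ _ => ?_
    refine Tendsto.smul ?_ ?_
    · simp only [deriv_circleMap]
      exact (((hcm θ).mul continuous_const).tendsto 1).mono_left nhdsWithin_le_nhds
    · beta_reduce
      rcases (cdist_nonneg E (circleMap 0 1 θ)).eq_or_lt with h0 | h0
      · have hz0 : zeroExt E Q c N (circleMap 0 1 θ) = 0 := by simp [zeroExt, ← h0]
        rw [hz0]
        refine squeeze_zero_norm'
          (a := fun R : ℝ => L * cdist E (circleMap 0 R θ / (R : ℂ) ^ 2) ^ 2) ?_ ?_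
        · filter_upwards [hmem] with R hR using hbd hR θ
        · have : Continuous fun w => L * cdist E w ^ 2 :=
            continuous_const.mul ((continuous_cdist E).pow 2)
          have h := (this.tendsto _).comp (hrl θ)
          simpa [← h0, Function.comp_def] using h
      · rw [zeroExt, if_neg h0.ne']
        refine Tendsto.mul ?_ ?_
        · refine (continuousOn_powSum hc _ (hpow (by simp))).tendsto.comp
            (tendsto_nhdsWithin_iff.2 ⟨(hrl θ).pow N, ?_⟩)
          filter_upwards [hmem] with R hR using hpow (hrefl hR θ)
        · exact (hQ.differentiableAt (hop.mem_nhds h0)).continuousAt.tendsto.comp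
            (((hcm θ).tendsto 1).mono_left nhdsWithin_le_nhds)

end ContourLimit

/-- A bounded sequence tending to zero whose Cauchy transform continues across the circle off the
perfect symmetric set, dominated by the outer function, has vanishing first term. -/
theorem first_term_eq_zero {p : ℕ} (hp : 3 ≤ p) {Q : ℂ → ℂ} {M A C : ℝ} {ψ : ℕ → ℂ}
    (hψ : ∀ n, ‖ψ n‖ ≤ C) (hψ0 : Tendsto ψ atTop (nhds 0))
    (hQ : DifferentiableOn ℂ Q {z | 0 < cdist (Eset (1 / (p : ℝ))) z})
    (hQs : ∀ z, 1 < ‖z‖ → HasSum (fun n => ψ n * z⁻¹ ^ (n + 1)) (Q z))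
    (hA : ∀ z, 1 < ‖z‖ → ‖Q z‖ * (‖z‖ - 1) ≤ A)
    (hM : ∀ z ∈ cuspNhd (Eset (1 / (p : ℝ))) 0, ‖Q z * outerFn p z‖ ≤ M) : ψ 0 = 0 := by
  obtain ⟨c, hc, hc0, hco⟩ := exists_outer_coeff hp
  have hE := Eset_subset_sphere (1 / (p : ℝ))
  have hne := Eset_nonempty p
  have hA0 : 0 ≤ A := by
    have := hA 2 (by simp)
    simp only [Complex.norm_ofNat] at this
    refine le_trans ?_ this
    have := norm_nonneg (Q 2)
    linarith
  have hM0 : 0 ≤ M := (norm_nonneg _).trans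
    (hM 0 (ball_subset_cuspNhd _ (mem_ball_self one_pos)))
  have hpi := Real.pi_pos
  have key (n : ℕ) {ε : ℝ} (hε : ∀ m, p ^ n ≤ m → ‖ψ m‖ ≤ ε) :
      2 * Real.pi * (‖c 0‖ * ‖ψ 0‖) ≤ (∑' k, ‖c k‖) * (2 * Real.pi * ε) := by
    have hN : p ^ n ≠ 0 := by positivity
    have hin (z : ℂ) (hz : ‖z‖ < 1) := by
      have h := norm_outerFn_mul_le_inside hp hM n hz
      rw [← hco (z ^ p ^ n) (by simpa using pow_lt_one₀ (norm_nonneg z) hz hN)] at h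
      exact h
    have hout (z : ℂ) (hz : 1 < ‖z‖) (hz2 : ‖z‖ ≤ 2) := by
      have h := norm_outerFn_mul_le_outside hp hA0 hM hA n hz hz2
      rw [← hco ((z / (‖z‖ : ℂ) ^ 2) ^ p ^ n) (by
        rw [mem_ball_zero_iff, norm_pow]
        refine pow_lt_one₀ (norm_nonneg _) ?_ hN
        rw [norm_div, norm_pow, Complex.norm_real, norm_norm, div_lt_one (by positivity)]
        nlinarith)] at h
      exact h
    have hlim := tendsto_circleIntegral_reflect hE hne hQ hc (by positivity) hout
    rw [circleIntegral_zeroExt hE hne hQ hc hN hin] at hlim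
    have hlim2 := (hlim.norm.add_const ((∑' k, ‖c k‖) * (2 * Real.pi * ε)))
    rw [norm_zero, zero_add] at hlim2
    refine ge_of_tendsto hlim2 ?_
    filter_upwards [self_mem_nhdsWithin] with R hR
    have hR : 1 < R := hR
    have hR0 : 0 < R := by linarith
    have hsum := hasSum_circleIntegral_powSum_reflect hc hψ hR (Q := Q)
      (hQ.continuousOn.mono fun z hz => cdist_pos_of_norm_ne_one hE hne (by
        have : ‖z‖ = R := by simpa using hz
        rw [this]; exact hR.ne')) hQs (p ^ n)
    refine norm_mul_le_of_hasSum hc (fun k => ?_) (by simp) hε hsum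
    rw [norm_pow, norm_inv, norm_pow, Complex.norm_real, Real.norm_of_nonneg hR0.le]
    refine pow_le_one₀ (by positivity) (inv_le_one_of_one_le₀ ?_)
    nlinarith
  have hall : ∀ ε > 0, ‖c 0‖ * ‖ψ 0‖ ≤ (∑' k, ‖c k‖) * ε := by
    intro ε hε
    obtain ⟨m, hm⟩ := Metric.tendsto_atTop.1 hψ0 ε hε
    have h := key m (ε := ε) fun k hk => by
      have hmk : m ≤ k := (Nat.lt_pow_self (by lia : 1 < p)).le.trans hk
      simpa using (hm k hmk).le
    have h' : 2 * Real.pi * (‖c 0‖ * ‖ψ 0‖) ≤ 2 * Real.pi * ((∑' k, ‖c k‖) * ε) := by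
      linarith
    exact le_of_mul_le_mul_left h' (by positivity)
  have hle : ‖c 0‖ * ‖ψ 0‖ ≤ 0 := by
    have hlim : Tendsto (fun ε : ℝ => (∑' k, ‖c k‖) * ε) (nhdsWithin 0 (Ioi 0))
        (nhds ((∑' k, ‖c k‖) * 0)) :=
      ((continuous_const.mul continuous_id).tendsto 0).mono_left nhdsWithin_le_nhds
    rw [mul_zero] at hlim
    refine ge_of_tendsto hlim ?_
    filter_upwards [self_mem_nhdsWithin] with ε hε using hall ε hε
  have hc0' : 0 < ‖c 0‖ := norm_pos_iff.2 hc0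
  have : ‖ψ 0‖ ≤ 0 := by
    by_contra! hcon
    have := mul_pos hc0' hcon
    linarith
  exact norm_le_zero_iff.1 this

theorem taylorCoeff_mem_coeffSet {I : Set (ℂ → ℂ)} (hI : IsClosedIdealAPlus I) {f : ℂ → ℂ}
    (hf : f ∈ I) : taylorCoeff f ∈ coeffSet I :=
  (mem_iff_coeffSet hI (hI.1 hf)).1 hf

theorem isShiftIdeal_coeffSet {I : Set (ℂ → ℂ)} (hI : IsClosedIdealAPlus I)
    (hne : NontrivialIdeal I) : IsShiftIdeal (coeffSet I) := by
  obtain ⟨f, hf, z, hz, hfz⟩ := hne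
  have hfm := taylorCoeff_mem_coeffSet hI hf
  refine ⟨fun a ha => ha.1, ?_, fun a ha b hb => coeffSet_add hI ha hb,
    fun c a ha => coeffSet_smul hI c ha, fun a ha => coeffSet_shift hI ha,
    ⟨_, hfm, fun h0 => hfz ?_⟩⟩
  · simpa using coeffSet_smul hI 0 hfm
  · rw [(mem_APlus_iff.1 (hI.1 hf)).2 z (ball_subset_closedBall hz), h0]
    simp [powSum]

theorem mem_of_mem_idealGenW_of_innerDivides {p : ℕ} (hp : 3 ≤ p) {I : Set (ℂ → ℂ)}
    (hI : IsClosedIdealAPlus I) (hne : NontrivialIdeal I) {SI : ℂ → ℂ} (hSI : IsGcdInner I SI)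
    (hhull : hull I ∩ Metric.sphere (0 : ℂ) 1 ⊆ Eset (1 / (p : ℝ))) {f : ℂ → ℂ}
    (hf : f ∈ APlus) (hfI : f ∈ IdealGenW I) (hfS : InnerDivides SI f) : f ∈ I := by
  by_contra hcon
  rw [mem_iff_coeffSet hI hf] at hcon
  have hK := isShiftIdeal_coeffSet hI hne
  obtain ⟨hfs, hfp⟩ := mem_APlus_iff.1 hf
  obtain ⟨φ, C, hφ, hann, hne0⟩ := exists_annihilator hK.summable hK.zero_mem hK.add_mem
    hK.smul_mem (fun a ha h => coeffSet_closed hI ha h) hfs hcon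
  obtain ⟨S, hS, hS1, hSK, hSε⟩ := hK.exists_inner
  obtain ⟨u, ⟨hud, D, hD⟩, hu⟩ := hSI.2.2 (powSum S) (isInnerFunction_powSum hS hS1) fun h hh _ => by
    obtain ⟨c, hc, hw⟩ := hSK _ (taylorCoeff_mem_coeffSet hI hh)
    obtain ⟨C', hC'⟩ := bounded_of_summable_sq hc
    refine ⟨powSum c, ⟨differentiableOn_powSum hC', _, fun z hz => (hw z (by simpa using hz)).2⟩,
      fun z hz => ?_⟩
    rw [(mem_APlus_iff.1 (hI.1 hh)).2 z (ball_subset_closedBall hz)]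
    exact (hw z (by simpa using hz)).1
  obtain ⟨g, ⟨hgd, B, hB⟩, hg⟩ := hfS
  obtain ⟨Q, M, A, hQ, hQs, hA, hM⟩ := exists_cauchy_transform_bound hp hK
    (fun z hz hzE => by
      have hzh : z ∉ hull I := fun h => hzE (hhull ⟨h, by simpa using hz⟩)
      have hzc : z ∈ closedBall (0 : ℂ) 1 := by simpa using hz.le
      have : ∃ h ∈ I, h z ≠ 0 := by
        by_contra! hall
        exact hzh ⟨hzc, hall⟩
      obtain ⟨h, hh, hhz⟩ := this
      refine ⟨_, taylorCoeff_mem_coeffSet hI hh, ?_⟩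
      rwa [← (mem_APlus_iff.1 (hI.1 hh)).2 z hzc])
    hS hSK hSε hφ (fun h hh i => tsum_shift_eq_zero hI hann hφ hh i) hfs (F := fun w => u w * g w)
    (hud.mul hgd) (B := D * B)
    (fun w hw => by
      rw [norm_mul]
      exact mul_le_mul (hD w hw) (hB w hw) (norm_nonneg _) ((norm_nonneg _).trans (hD w hw)))
    (fun w hw => by
      rw [← hfp w (ball_subset_closedBall hw), hg w hw, hu w hw, mul_assoc])
  have hzero := first_term_eq_zero hp (C := (∑' k, ‖taylorCoeff f k‖) * C)
    (fun n => by
      refine tsum_of_norm_bounded (hfs.hasSum.mul_right C) fun k => ?_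
      rw [norm_mul]
      gcongr
      exact hφ _)
    (tendsto_corr_of_mem_idealGenW hI hφ hann hf hfI) hQ hQs hA hM
  exact hne0 hzero

theorem innerDivides_of_mem {I : Set (ℂ → ℂ)} {SI : ℂ → ℂ} (hSI : IsGcdInner I SI) {f : ℂ → ℂ}
    (hf : f ∈ I) : InnerDivides SI f := by
  by_cases h : ∃ z ∈ ball (0 : ℂ) 1, f z ≠ 0
  · exact hSI.2.1 f hf h
  · push Not at h
    exact ⟨0, ⟨differentiableOn_const 0, 0, by simp⟩, fun z hz => by simp [h z hz]⟩

/-- If `p ≥ 3` and `I ≠ {0}` is a closed ideal of `A⁺` with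
`h(I) ∩ Γ ⊆ E_{1/p}`, then `I = I^A ∩ S_I·H^∞`. -/
theorem stmt_0 (p : ℕ) (hp : 3 ≤ p)
    (I : Set (ℂ → ℂ)) (hI : IsClosedIdealAPlus I) (hne : NontrivialIdeal I)
    (SI : ℂ → ℂ) (hSI : IsGcdInner I SI)
    (hhull : hull I ∩ Metric.sphere (0 : ℂ) 1 ⊆ Eset (1 / (p : ℝ))) :
    ∀ f : ℂ → ℂ, f ∈ I ↔ (f ∈ APlus ∧ f ∈ IdealGenW I ∧ InnerDivides SI f) :=
  fun _ => ⟨fun hf => ⟨hI.1 hf, fun _ hJ => hJ.2 hf, innerDivides_of_mem hSI hf⟩,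
    fun h => mem_of_mem_idealGenW_of_innerDivides hp hI hne hSI hhull h.1 h.2.1 h.2.2⟩
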